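/- Let k be an algebraically closed field and let H, H' ⊆ P^3_k be irreducible cubic hypersurfaces such that P^3_k \ H and P^3_k \ H' are isomorphic. If H or H' is non-rational (i.e. not birational to P^2_k), then there exists an automorphism φ of P^3_k with φ(H) = H'. -/

import Mathlib

/-!
Common set-up: projective `n`-space over a field `k` as the scheme
`Proj k[x_0, …, x_n]`, complements of hypersurfaces as open subschemes,
hypersurfaces as reduced closed subschemes, and isomorphisms of varieties
over `k` as scheme isomorphisms commuting with the structure morphisms
to `Spec k`.
-/

open AlgebraicGeometry CategoryTheory MvPolynomial

attribute [local instance] MvPolynomial.gradedAlgebra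

noncomputable section

/-- The standard grading on the polynomial ring `k[x_0, …, x_n]`. -/
abbrev grading (k : Type) [Field k] (n : ℕ) := homogeneousSubmodule (Fin (n + 1)) k

/-- Projective `n`-space over `k`, as a scheme. -/
abbrev ProjSpace (k : Type) [Field k] (n : ℕ) : Scheme := Proj (grading k n)

/-- The base scheme `Spec k`. -/
abbrev SpecK (k : Type) [Field k] : Scheme := Spec (CommRingCat.of k)

/-- The structure morphism `ℙⁿ_k ⟶ Spec k`. -/
abbrev projStruct (k : Type) [Field k] (n : ℕ) : ProjSpace k n ⟶ SpecK k :=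
  Proj.toSpecZero (grading k n) ≫
    Spec.map (CommRingCat.ofHom (algebraMap k ((grading k n) 0)))

/-- The open complement `ℙⁿ_f = ℙⁿ ∖ V(f)` of the hypersurface `V(f)`, as a scheme. -/
abbrev PnF (k : Type) [Field k] (n : ℕ) (f : MvPolynomial (Fin (n + 1)) k) : Scheme :=
  (Proj.basicOpen (grading k n) f).toScheme

/-- The structure morphism `ℙⁿ_f ⟶ Spec k`. -/
abbrev PnFStruct (k : Type) [Field k] (n : ℕ) (f : MvPolynomial (Fin (n + 1)) k) :
    PnF k n f ⟶ SpecK k :=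
  (Proj.basicOpen (grading k n) f).ι ≫ projStruct k n

/-- Two schemes equipped with structure morphisms to a common base are isomorphic over
that base.  For varieties over `k` (with base `Spec k`) this is the usual notion of
isomorphism of varieties over `k`. -/
def IsoOver {X Y B : Scheme} (sX : X ⟶ B) (sY : Y ⟶ B) : Prop :=
  ∃ e : X ≅ Y, e.hom ≫ sY = sX

/-- The set of points of `ℙⁿ` where `f` vanishes. -/
def zeroLocusSet (k : Type) [Field k] (n : ℕ) (f : MvPolynomial (Fin (n + 1)) k) :
    Set (ProjSpace k n) :=
  {x | f ∈ (x : ProjectiveSpectrum (grading k n)).asHomogeneousIdeal}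

/-- `ι : H ⟶ ℙⁿ` realizes the scheme `H` as the hypersurface `V(f) ⊆ ℙⁿ`, i.e. as the
reduced closed subscheme of `ℙⁿ` whose underlying set is the zero locus of `f`. -/
structure IsHypersurface {k : Type} [Field k] {n : ℕ} (f : MvPolynomial (Fin (n + 1)) k)
    (H : Scheme) (ι : H ⟶ ProjSpace k n) : Prop where
  isClosedImmersion : IsClosedImmersion ι
  reduced : IsReduced H
  range_eq : Set.range ι.base = zeroLocusSet k n f

/-- A variety `H` over `k` (a scheme with structure morphism `s : H ⟶ Spec k`) is
rational if it is birational to `ℙ²_k`, i.e. if some nonempty open subvariety of `H`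
is isomorphic (over `k`) to a nonempty open subvariety of `ℙ²_k`. -/
def IsRationalSurface (k : Type) [Field k] {H : Scheme} (s : H ⟶ SpecK k) : Prop :=
  ∃ (U : H.Opens) (V : (ProjSpace k 2).Opens), U ≠ ⊥ ∧ V ≠ ⊥ ∧
    IsoOver (U.ι ≫ s) (V.ι ≫ projStruct k 2)

section PolynomialBasics

variable {σ : Type*} {k : Type*} [Field k]

lemma aeval_mul_const_of_isHomogeneous {A : Type*} [CommRing A] [Algebra k A]
    {F : MvPolynomial σ k} {n : ℕ} (hF : F.IsHomogeneous n) (v : σ → A) (c : A) :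
    aeval (fun i => v i * c) F = aeval v F * c ^ n := by
  rw [aeval_def, aeval_def, eval₂_eq, eval₂_eq, Finset.sum_mul]
  refine Finset.sum_congr rfl fun d hd => ?_
  have h := hF (mem_support_iff.mp hd)
  rw [mul_assoc]
  congr 1
  simp only [mul_pow, Finset.prod_mul_distrib, Finset.prod_pow_eq_pow_sum]
  congr 2
  rw [← h, Finsupp.weight_apply, Finsupp.sum]
  simp

/-- The homomorphism recording the degree grading with an auxiliary variable. -/
def gradeHom (σ k : Type*) [Field k] :
    MvPolynomial σ k →ₐ[k] Polynomial (MvPolynomial σ k) :=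
  aeval fun i => Polynomial.C (X i) * Polynomial.X

lemma gradeHom_of_isHomogeneous {F : MvPolynomial σ k} {n : ℕ} (hF : F.IsHomogeneous n) :
    gradeHom σ k F = Polynomial.C F * Polynomial.X ^ n := by
  rw [gradeHom, aeval_mul_const_of_isHomogeneous hF]
  congr 1
  have : (aeval fun i => (Polynomial.C (X i) : Polynomial (MvPolynomial σ k))) =
      (Polynomial.CAlgHom : MvPolynomial σ k →ₐ[MvPolynomial σ k] _).restrictScalars k := by
    ext i; simp
  rw [this]; rfl

lemma coeff_gradeHom (F : MvPolynomial σ k) (n : ℕ) :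
    (gradeHom σ k F).coeff n = homogeneousComponent n F := by
  conv_lhs => rw [← sum_homogeneousComponent F]
  rw [map_sum, Polynomial.finsetSum_coeff]
  have : ∀ i, (gradeHom σ k (homogeneousComponent i F)).coeff n =
      if i = n then homogeneousComponent n F else 0 := by
    intro i
    rw [gradeHom_of_isHomogeneous (homogeneousComponent_isHomogeneous i F),
      Polynomial.coeff_C_mul, Polynomial.coeff_X_pow]
    split_ifs with h1 h2 h2
    · subst h1; simp
    · exact absurd h1.symm h2
    · exact absurd h2.symm h1
    · simp
  simp only [this, Finset.sum_ite_eq', Finset.mem_range]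
  split_ifs with h
  · rfl
  · exact (homogeneousComponent_eq_zero _ _ (by omega)).symm

lemma gradeHom_ne_zero {F : MvPolynomial σ k} (hF : F ≠ 0) : gradeHom σ k F ≠ 0 := by
  intro h
  apply hF
  rw [← sum_homogeneousComponent F]
  refine Finset.sum_eq_zero fun i _ => ?_
  rw [← coeff_gradeHom, h, Polynomial.coeff_zero]

lemma isHomogeneous_of_mul_left {a b : MvPolynomial σ k} {n : ℕ}
    (h : (a * b).IsHomogeneous n) (h0 : a * b ≠ 0) : ∃ i ≤ n, a.IsHomogeneous i := by
  have ha := gradeHom_ne_zero (left_ne_zero_of_mul h0)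
  have hb := gradeHom_ne_zero (right_ne_zero_of_mul h0)
  have h1 := gradeHom_of_isHomogeneous h
  rw [map_mul] at h1
  have hd := congrArg Polynomial.natDegree h1
  have ht := congrArg Polynomial.natTrailingDegree h1
  rw [Polynomial.natDegree_mul ha hb, Polynomial.natDegree_C_mul_X_pow _ _ h0] at hd
  rw [Polynomial.natTrailingDegree_mul ha hb, Polynomial.C_mul_X_pow_eq_monomial,
    Polynomial.natTrailingDegree_monomial h0] at ht
  have h3 := Polynomial.natTrailingDegree_le_natDegree (gradeHom σ k a)
  have h4 := Polynomial.natTrailingDegree_le_natDegree (gradeHom σ k b)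
  refine ⟨(gradeHom σ k a).natDegree, by omega, ?_⟩
  have : a = homogeneousComponent (gradeHom σ k a).natDegree a := by
    conv_lhs => rw [← sum_homogeneousComponent a]
    rw [Finset.sum_eq_single (gradeHom σ k a).natDegree]
    · intro j _ hj
      rw [← coeff_gradeHom]
      rcases lt_or_gt_of_ne hj with hj | hj
      · exact Polynomial.coeff_eq_zero_of_lt_natTrailingDegree (by omega)
      · exact Polynomial.coeff_eq_zero_of_natDegree_lt hj
    · intro hj
      exact homogeneousComponent_eq_zero _ _ (by simpa using hj)
  have h5 := homogeneousComponent_isHomogeneous (gradeHom σ k a).natDegree a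
  rwa [← this] at h5

lemma isHomogeneous_right_of_mul {a b : MvPolynomial σ k} {m n : ℕ}
    (h : (a * b).IsHomogeneous (m + n)) (ha : a.IsHomogeneous m) (ha0 : a ≠ 0) :
    b.IsHomogeneous n := by
  by_cases hb : b = 0
  · rw [hb]; exact MvPolynomial.isHomogeneous_zero σ k n
  obtain ⟨i, _, hi⟩ := isHomogeneous_of_mul_left (a := b) (b := a) (by rwa [mul_comm])
    (mul_ne_zero hb ha0)
  have := (ha.mul hi).inj_right h (mul_ne_zero ha0 hb)
  obtain rfl : i = n := by omega
  exact hi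

lemma isHomogeneous_of_dvd {a F : MvPolynomial σ k} {n : ℕ}
    (h : F.IsHomogeneous n) (h0 : F ≠ 0) (ha : a ∣ F) : ∃ i ≤ n, a.IsHomogeneous i := by
  obtain ⟨b, rfl⟩ := ha
  exact isHomogeneous_of_mul_left h h0

lemma exists_C_mul_of_associated {a b : MvPolynomial σ k} (h : Associated a b) :
    ∃ c : k, c ≠ 0 ∧ b = C c * a := by
  obtain ⟨u, rfl⟩ := h
  obtain ⟨c, hc, hu⟩ := MvPolynomial.isUnit_iff_eq_C_of_isReduced.mp u.isUnit
  exact ⟨c, hc.ne_zero, by rw [hu, mul_comm]⟩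

/-- A family of elements without a common prime factor. -/
def CoprimeFamily {ι R : Type*} [CommRing R] (v : ι → R) : Prop :=
  ∀ q, Prime q → ∃ i, ¬ q ∣ v i

lemma exists_coprimeFamily {ι R : Type*} [Fintype ι] [CommRing R] [IsDomain R]
    [UniqueFactorizationMonoid R] (v : ι → R) (hv : v ≠ 0) :
    ∃ (h : R) (u : ι → R), h ≠ 0 ∧ (∀ i, v i = h * u i) ∧ CoprimeFamily u := by
  classical
  let _ : StrongNormalizationMonoid R :=
    UniqueFactorizationMonoid.strongNormalizationMonoid
  let _ := UniqueFactorizationMonoid.toNormalizedGCDMonoid R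
  obtain ⟨i, hi⟩ := Function.ne_iff.mp hv
  obtain ⟨u, h1, h2⟩ := Finset.extract_gcd v (s := Finset.univ) ⟨i, Finset.mem_univ i⟩
  refine ⟨Finset.univ.gcd v, u, ?_, fun i => h1 i (Finset.mem_univ i), ?_⟩
  · intro h
    exact hi (by rw [h1 i (Finset.mem_univ i), h, zero_mul]; rfl)
  · intro q hq
    by_contra! hc
    exact hq.not_isUnit (isUnit_of_dvd_one (h2 ▸ Finset.dvd_gcd fun i _ => hc i))

lemma associated_pow_of_forall_prime {R : Type*} [CommRing R] [IsDomain R]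
    [UniqueFactorizationMonoid R] {g x : R} (hg : Irreducible g) (hx : x ≠ 0)
    (h : ∀ q, Prime q → q ∣ x → q ∣ g) : ∃ d, Associated (g ^ d) x := by
  induction x using UniqueFactorizationMonoid.induction_on_prime with
  | h₁ => exact absurd rfl hx
  | h₂ x hu => exact ⟨0, by simpa using (associated_one_iff_isUnit.mpr hu).symm⟩
  | h₃ a p ha hp ih =>
    obtain ⟨d, hd⟩ := ih ha fun q hq hqa => h q hq (hqa.mul_left _)
    refine ⟨d + 1, ?_⟩
    rw [pow_succ']
    exact Associated.mul_mul
      (hp.irreducible.associated_of_dvd hg (h p hp (Dvd.intro _ rfl))).symm hd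

end PolynomialBasics

/-- The inclusion of the scalars into the ring of degree-zero fractions. -/
def awayScalar (k : Type) [Field k] (n : ℕ) (f : MvPolynomial (Fin (n + 1)) k) :
    k →+* HomogeneousLocalization.Away (grading k n) f :=
  (HomogeneousLocalization.fromZeroRingHom (grading k n) (Submonoid.powers f)).comp
    (algebraMap k ((grading k n) 0))

lemma awayι_projStruct {k : Type} [Field k] {n d : ℕ} {f : MvPolynomial (Fin (n + 1)) k}
    (hf : f ∈ grading k n d) (hd : 0 < d) :
    Proj.awayι (grading k n) f hf hd ≫ projStruct k n =
      Spec.map (CommRingCat.ofHom (awayScalar k n f)) := by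
  rw [← Category.assoc, Proj.awayι_toSpecZero, ← Spec.map_comp]
  rfl

lemma basicOpenIsoSpec_inv_PnFStruct {k : Type} [Field k] {n d : ℕ}
    {f : MvPolynomial (Fin (n + 1)) k} (hf : f ∈ grading k n d) (hd : 0 < d) :
    (Proj.basicOpenIsoSpec (grading k n) f hf hd).inv ≫ PnFStruct k n f =
      Spec.map (CommRingCat.ofHom (awayScalar k n f)) := by
  rw [← awayι_projStruct hf hd, ← Category.assoc, Proj.basicOpenIsoSpec_inv_ι]

lemma exists_ringEquiv_of_isoOver {k : Type} [Field k] {n d e : ℕ}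
    {f g : MvPolynomial (Fin (n + 1)) k} (hf : f ∈ grading k n d) (hd : 0 < d)
    (hg : g ∈ grading k n e) (he : 0 < e)
    (h : IsoOver (PnFStruct k n f) (PnFStruct k n g)) :
    ∃ σ : HomogeneousLocalization.Away (grading k n) f ≃+*
        HomogeneousLocalization.Away (grading k n) g,
      ∀ c, σ (awayScalar k n f c) = awayScalar k n g c := by
  obtain ⟨i, hi⟩ := h
  let j : Spec (.of (HomogeneousLocalization.Away (grading k n) g)) ≅
      Spec (.of (HomogeneousLocalization.Away (grading k n) f)) :=
    (Proj.basicOpenIsoSpec (grading k n) g hg he).symm ≪≫ i.symm ≪≫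
      (Proj.basicOpenIsoSpec (grading k n) f hf hd)
  have hj : j.hom ≫ Spec.map (CommRingCat.ofHom (awayScalar k n f)) =
      Spec.map (CommRingCat.ofHom (awayScalar k n g)) := by
    rw [← basicOpenIsoSpec_inv_PnFStruct hf hd, ← basicOpenIsoSpec_inv_PnFStruct hg he]
    simp only [j, Iso.trans_hom, Iso.symm_hom, Category.assoc, Iso.hom_inv_id_assoc]
    rw [← hi, Iso.inv_hom_id_assoc]
  let a := Scheme.Spec.preimageIso j
  refine ⟨(a.unop.commRingCatIsoToRingEquiv), fun c => ?_⟩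
  have h2 : Spec.map a.hom.unop = j.hom := Scheme.Spec.map_preimage j.hom
  rw [← h2, ← Spec.map_comp] at hj
  exact congrArg (fun φ => φ.hom c) (Spec.map_injective hj)

/-- The homogeneous coordinate ring of projective space. -/
abbrev PolyRing (k : Type) [Field k] (n : ℕ) : Type := MvPolynomial (Fin (n + 1)) k

/-- The fraction field of the homogeneous coordinate ring of projective space. -/
abbrev PolyFrac (k : Type) [Field k] (n : ℕ) : Type := FractionRing (PolyRing k n)

section AwayFrac

variable {k : Type} [Field k] {n : ℕ}

/-- Degree-zero fractions as elements of the fraction field of the polynomial ring. -/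
def awayFrac (f : MvPolynomial (Fin (n + 1)) k) (hf : f ≠ 0) :
    HomogeneousLocalization.Away (grading k n) f →+*
      PolyFrac k n :=
  (IsLocalization.lift (M := Submonoid.powers f) (S := Localization.Away f)
    (g := algebraMap (PolyRing k n) (PolyFrac k n)) (by
      rintro ⟨_, m, rfl⟩
      simpa using fun h => absurd h hf)).comp
  (algebraMap (HomogeneousLocalization.Away (grading k n) f) (Localization.Away f))

lemma awayFrac_mk {f : MvPolynomial (Fin (n + 1)) k} (hf : f ≠ 0) {d : ℕ}
    (hd : f ∈ grading k n d) (m : ℕ) (x : MvPolynomial (Fin (n + 1)) k)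
    (hx : x ∈ grading k n (m • d)) :
    awayFrac f hf (HomogeneousLocalization.Away.mk _ hd m x hx) =
      algebraMap (PolyRing k n) (PolyFrac k n) x / algebraMap _ _ f ^ m := by
  have hf' : algebraMap (PolyRing k n) (PolyFrac k n) f ≠ 0 := by
    simpa using hf
  rw [awayFrac, RingHom.comp_apply, HomogeneousLocalization.algebraMap_apply,
    HomogeneousLocalization.Away.val_mk, Localization.mk_eq_mk', IsLocalization.lift_mk'_spec,
    map_pow]
  field_simp

lemma awayFrac_injective {f : MvPolynomial (Fin (n + 1)) k} (hf : f ≠ 0) :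
    Function.Injective (awayFrac f hf) := by
  refine (IsLocalization.lift_injective_iff _ |>.mpr ?_).comp
    (HomogeneousLocalization.val_injective _)
  intro x y
  rw [(IsLocalization.injective (Localization.Away f)
    (powers_le_nonZeroDivisors_of_noZeroDivisors hf)).eq_iff,
    (IsFractionRing.injective _ _).eq_iff]

lemma awayFrac_awayScalar {f : MvPolynomial (Fin (n + 1)) k} (hf : f ≠ 0) (c : k) :
    awayFrac f hf (awayScalar k n f c) =
      algebraMap k (PolyFrac k n) c := by
  have : (awayScalar k n f c).val = algebraMap k (Localization.Away f) c := by
    rfl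
  rw [awayFrac, RingHom.comp_apply, HomogeneousLocalization.algebraMap_apply, this,
    IsScalarTower.algebraMap_apply k (MvPolynomial (Fin (n + 1)) k), IsLocalization.lift_eq,
    ← IsScalarTower.algebraMap_apply]

lemma isHomogeneous_bind₁ {σ τ k : Type*} [Field k] {F : MvPolynomial σ k} {d m : ℕ}
    (hF : F.IsHomogeneous d) {p : σ → MvPolynomial τ k} (hp : ∀ i, (p i).IsHomogeneous m) :
    (bind₁ p F).IsHomogeneous (m * d) :=
  hF.aeval p hp

lemma exists_polynomial_map {f g : PolyRing k n}
    (hf : f ≠ 0) (hfd : f ∈ grading k n 3) (hg : Irreducible g) (hgd : g ∈ grading k n 3)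
    (σ : HomogeneousLocalization.Away (grading k n) f ≃+*
      HomogeneousLocalization.Away (grading k n) g)
    (hσ : ∀ c, σ (awayScalar k n f c) = awayScalar k n g c) :
    ∃ (p : Fin (n + 1) → PolyRing k n) (m : ℕ) (c : k), c ≠ 0 ∧
      (∀ i, (p i).IsHomogeneous m) ∧ bind₁ p f = C c * g ^ m ∧
      ∀ (s : ℕ) (M : PolyRing k n) (hM : M ∈ grading k n (s • 3)),
        awayFrac g hg.ne_zero (σ (HomogeneousLocalization.Away.mk (grading k n) hfd s M hM)) =
          algebraMap (PolyRing k n) (PolyFrac k n) (bind₁ p M) /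
            algebraMap _ _ (bind₁ p f) ^ s := by
  classical
  have hfh : f.IsHomogeneous 3 := hfd
  have hgh : g.IsHomogeneous 3 := hgd
  have hg0 : g ≠ 0 := hg.ne_zero
  have hfK : algebraMap (PolyRing k n) (PolyFrac k n) f ≠ 0 := by simpa using hf
  have hgK : algebraMap (PolyRing k n) (PolyFrac k n) g ≠ 0 := by simpa using hg0
  have hX0 : algebraMap (PolyRing k n) (PolyFrac k n) (X 0) ≠ 0 := by simp
  have hmem : ∀ i : Fin (n + 1), (X i * X 0 ^ 2 : PolyRing k n) ∈ grading k n (1 • 3) := fun i =>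
    (isHomogeneous_X k i).mul ((isHomogeneous_X k 0).pow 2)
  let y : Fin (n + 1) → HomogeneousLocalization.Away (grading k n) f := fun i =>
    HomogeneousLocalization.Away.mk _ hfd 1 (X i * X 0 ^ 2) (hmem i)
  have hy : ∀ i, awayFrac f hf (y i) =
      algebraMap (PolyRing k n) (PolyFrac k n) (X i) *
        (algebraMap (PolyRing k n) (PolyFrac k n) (X 0) ^ 2 /
          algebraMap (PolyRing k n) (PolyFrac k n) f) := by
    intro i
    simp only [y]
    rw [awayFrac_mk]
    simp [mul_div_assoc]
  let φ := (awayFrac g hg0).comp σ.toRingHom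
  let e : Fin (n + 1) → PolyFrac k n := fun i => φ (y i)
  have hφe : ∀ M : PolyRing k n, φ (eval₂ (awayScalar k n f) y M) = aeval e M := by
    intro M
    rw [hom_eval₂, aeval_def]
    congr 1
    ext c
    simp only [φ, RingHom.comp_apply, RingEquiv.toRingHom_eq_coe, RingHom.coe_coe, hσ,
      awayFrac_awayScalar]
  have hfy : ∀ (d : ℕ) (M : PolyRing k n), M.IsHomogeneous d →
      awayFrac f hf (eval₂ (awayScalar k n f) y M) =
      algebraMap (PolyRing k n) (PolyFrac k n) M *
        (algebraMap (PolyRing k n) (PolyFrac k n) (X 0) ^ 2 /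
          algebraMap (PolyRing k n) (PolyFrac k n) f) ^ d := by
    intro d M hM
    rw [hom_eval₂]
    have h1 : (awayFrac f hf).comp (awayScalar k n f) = algebraMap k (PolyFrac k n) := by
      ext c; exact awayFrac_awayScalar hf c
    have h2 : (fun i => awayFrac f hf (y i)) = fun i =>
      algebraMap (PolyRing k n) (PolyFrac k n) (X i) *
        (algebraMap (PolyRing k n) (PolyFrac k n) (X 0) ^ 2 /
          algebraMap (PolyRing k n) (PolyFrac k n) f) := funext hy
    rw [h1, h2, ← aeval_def, aeval_mul_const_of_isHomogeneous hM]
    congr 1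
    have h3 : (aeval fun i => algebraMap (PolyRing k n) (PolyFrac k n) (X i)) =
        IsScalarTower.toAlgHom k (PolyRing k n) (PolyFrac k n) := by
      ext i; simp
    rw [h3]; rfl
  have key : ∀ (s : ℕ) (M : PolyRing k n) (hM : M ∈ grading k n (s • 3)),
      φ (HomogeneousLocalization.Away.mk (grading k n) hfd s M hM) * aeval e f ^ s =
        aeval e M := by
    intro s M hM
    rw [← hφe, ← hφe, ← map_pow, ← map_mul]
    congr 1
    apply awayFrac_injective hf
    rw [map_mul, map_pow, awayFrac_mk, hfy _ _ hfh, hfy _ _ hM]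
    generalize algebraMap (PolyRing k n) (PolyFrac k n) (X 0) ^ 2 / _ = t
    rw [smul_eq_mul, div_mul_eq_mul_div, div_eq_iff (pow_ne_zero _ hfK)]
    ring
  have hφinj : Function.Injective φ := (awayFrac_injective hg0).comp σ.injective
  have hef : aeval e f ≠ 0 := by
    rw [← hφe, Ne, map_eq_zero_iff _ hφinj, ← map_eq_zero_iff _ (awayFrac_injective hf),
      hfy _ _ hfh]
    exact mul_ne_zero hfK (pow_ne_zero _ (div_ne_zero (pow_ne_zero _ hX0) hfK))
  have hex : ∀ i, ∃ (N : ℕ) (x : PolyRing k n), x.IsHomogeneous (N * 3) ∧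
      e i * algebraMap (PolyRing k n) (PolyFrac k n) g ^ N = algebraMap _ _ x := by
    intro i
    obtain ⟨N, x, hx, hxe⟩ := HomogeneousLocalization.Away.mk_surjective _ hgd (σ (y i))
    refine ⟨N, x, hx, ?_⟩
    have : e i = awayFrac g hg0 (σ (y i)) := rfl
    rw [this, ← hxe, awayFrac_mk]
    field_simp
  choose N x hx hxe using hex
  let v : Fin (n + 1) → PolyRing k n := fun i => x i * g ^ (∑ j, N j - N i)
  have hNle : ∀ i, N i ≤ ∑ j, N j := fun i =>
    Finset.single_le_sum (f := N) (fun _ _ => Nat.zero_le _) (Finset.mem_univ i)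
  have hve : ∀ i, e i * algebraMap (PolyRing k n) (PolyFrac k n) g ^ (∑ j, N j) =
      algebraMap _ _ (v i) := by
    intro i
    simp only [v, map_mul, map_pow, ← hxe, mul_assoc, ← pow_add]
    rw [Nat.add_sub_cancel' (hNle i)]
  have hvh : ∀ i, (v i).IsHomogeneous ((∑ j, N j) * 3) := by
    intro i
    have := (hx i).mul (hgh.pow (∑ j, N j - N i))
    convert this using 1
    have := hNle i
    omega
  have he0 : e 0 ≠ 0 := by
    simp only [e]
    rw [Ne, map_eq_zero_iff _ hφinj, ← map_eq_zero_iff _ (awayFrac_injective hf), hy]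
    exact mul_ne_zero hX0 (div_ne_zero (pow_ne_zero _ hX0) hfK)
  have hv0 : v 0 ≠ 0 := by
    intro h
    have := hve 0
    rw [h, map_zero] at this
    exact mul_ne_zero he0 (pow_ne_zero _ hgK) this
  obtain ⟨h, p, hh0, hvp, hcop⟩ := exists_coprimeFamily v (fun h => hv0 (congrFun h 0))
  obtain ⟨a, ha, hah⟩ := isHomogeneous_of_dvd (hvh 0) hv0 ⟨_, hvp 0⟩
  have hph : ∀ i, (p i).IsHomogeneous ((∑ j, N j) * 3 - a) := by
    intro i
    refine isHomogeneous_right_of_mul (a := h) (m := a) ?_ hah hh0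
    rw [← hvp, Nat.add_sub_cancel' ha]
    exact hvh i
  generalize (∑ j, N j) * 3 - a = m at hph
  let lam := algebraMap (PolyRing k n) (PolyFrac k n) h /
    algebraMap (PolyRing k n) (PolyFrac k n) g ^ (∑ j, N j)
  have hlam : lam ≠ 0 := div_ne_zero (by simpa using hh0) (pow_ne_zero _ hgK)
  have hep : e = fun i => algebraMap (PolyRing k n) (PolyFrac k n) (p i) * lam := by
    ext i
    simp only [lam]
    field_simp
    rw [hve, hvp, map_mul, mul_comm]
  have hev : ∀ (d : ℕ) (M : PolyRing k n), M.IsHomogeneous d →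
      aeval e M = algebraMap (PolyRing k n) (PolyFrac k n) (bind₁ p M) * lam ^ d := by
    intro d M hM
    rw [hep, aeval_mul_const_of_isHomogeneous hM]
    congr 1
    have h3 : (aeval fun i => algebraMap (PolyRing k n) (PolyFrac k n) (p i)) =
        (IsScalarTower.toAlgHom k (PolyRing k n) (PolyFrac k n)).comp (bind₁ p) := by
      ext i; simp
    rw [h3]; rfl
  have hpf : algebraMap (PolyRing k n) (PolyFrac k n) (bind₁ p f) ≠ 0 := by
    intro h0
    rw [hev _ _ hfh, h0, zero_mul] at hef
    exact hef rfl
  have main : ∀ (s : ℕ) (M : PolyRing k n) (hM : M ∈ grading k n (s • 3)),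
      φ (HomogeneousLocalization.Away.mk (grading k n) hfd s M hM) =
        algebraMap (PolyRing k n) (PolyFrac k n) (bind₁ p M) /
          algebraMap (PolyRing k n) (PolyFrac k n) (bind₁ p f) ^ s := by
    intro s M hM
    have := key s M hM
    rw [hev _ _ hfh, hev _ _ hM] at this
    rw [eq_div_iff (pow_ne_zero _ hpf)]
    apply mul_right_cancel₀ (pow_ne_zero (s * 3) hlam)
    rw [smul_eq_mul] at this
    rw [← this]
    ring
  have hpf0 : bind₁ p f ≠ 0 := fun h0 => hpf (by rw [h0, map_zero])
  obtain ⟨d, hd⟩ := associated_pow_of_forall_prime hg hpf0 (by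
    intro q hq hqf
    by_contra hqg
    obtain ⟨i, hi⟩ := hcop q hq
    have hm3 : (X i ^ 3 : PolyRing k n) ∈ grading k n (1 • 3) := (isHomogeneous_X k i).pow 3
    have h1 := main 1 (X i ^ 3) hm3
    obtain ⟨N', w, hw, hwe⟩ := HomogeneousLocalization.Away.mk_surjective _ hgd
      (σ (HomogeneousLocalization.Away.mk (grading k n) hfd 1 (X i ^ 3) hm3))
    have h2 : φ (HomogeneousLocalization.Away.mk (grading k n) hfd 1 (X i ^ 3) hm3) =
      awayFrac g hg0 (σ (HomogeneousLocalization.Away.mk (grading k n) hfd 1 (X i ^ 3) hm3)) :=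
      rfl
    rw [h2, ← hwe, awayFrac_mk, pow_one, div_eq_div_iff (pow_ne_zero _ hgK) hpf] at h1
    simp only [← map_pow, ← map_mul] at h1
    have h3 := IsFractionRing.injective (PolyRing k n) (PolyFrac k n) h1
    have h4 : q ∣ (p i) ^ 3 * g ^ N' := by
      rw [map_pow, bind₁_X_right] at h3
      exact h3 ▸ hqf.mul_left _
    rcases hq.dvd_or_dvd h4 with h5 | h5
    · exact hi (hq.dvd_of_dvd_pow h5)
    · exact hqg (hq.dvd_of_dvd_pow h5))
  obtain ⟨c, hc, hcd⟩ := exists_C_mul_of_associated hd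
  have hdm : d = m := by
    have h1 := isHomogeneous_bind₁ hfh hph
    have h2 := (hgh.pow d).C_mul c
    rw [← hcd] at h2
    have := h1.inj_right h2 hpf0
    omega
  subst hdm
  exact ⟨p, d, c, hc, hph, hcd, main⟩

end AwayFrac

/-- Mutually inverse rational self-maps of projective space, given by homogeneous polynomials,
that identify the complements of `V(f)` and `V(g)`. -/
structure ComplementMaps {k : Type} [Field k] {n : ℕ} (f g : PolyRing k n)
    (p G : Fin (n + 1) → PolyRing k n) (d e : ℕ) (c c' : k) (μ ν : PolyRing k n) : Prop where
  hom_p : ∀ i, (p i).IsHomogeneous d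
  hom_G : ∀ i, (G i).IsHomogeneous e
  c_ne : c ≠ 0
  c'_ne : c' ≠ 0
  μ_ne : μ ≠ 0
  ν_ne : ν ≠ 0
  p_f : bind₁ p f = C c * g ^ d
  G_g : bind₁ G g = C c' * f ^ e
  p_G : ∀ j, bind₁ p (G j) = X j * μ
  G_p : ∀ j, bind₁ G (p j) = X j * ν

lemma exists_factor_of_proportional {k : Type} [Field k] {n : ℕ} (hn : 0 < n)
    (q : Fin (n + 1) → PolyRing k n) (g E : PolyRing k n) (hg : g ≠ 0) (hE : E ≠ 0)
    (h : ∀ j, q j * q 0 ^ 2 * g = X j * X 0 ^ 2 * E) :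
    ∃ μ, μ ≠ 0 ∧ ∀ j, q j = X j * μ := by
  have hX : ∀ j : Fin (n + 1), (X j : PolyRing k n) ≠ 0 := fun j => X_ne_zero j
  have hq0 : q 0 ≠ 0 := by
    intro h0
    have := h 0
    rw [h0, zero_mul, zero_mul] at this
    exact mul_ne_zero (mul_ne_zero (hX 0) (pow_ne_zero _ (hX 0))) hE this.symm
  have h2 : ∀ j, q j * X 0 = X j * q 0 := by
    intro j
    apply mul_right_cancel₀ (mul_ne_zero (pow_ne_zero 2 hq0) hg)
    linear_combination X 0 * h j - X j * h 0
  have h3 : (X 0 : PolyRing k n) ∣ X ⟨1, by omega⟩ * q 0 := ⟨_, by rw [← h2, mul_comm]⟩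
  have hp : Prime (X 0 : PolyRing k n) := MvPolynomial.X_prime
  obtain ⟨μ, hμ⟩ := (hp.dvd_or_dvd h3).resolve_left (by
    rw [MvPolynomial.X_dvd_X]
    simp [Fin.ext_iff])
  refine ⟨μ, fun h => hq0 (by rw [hμ, h, mul_zero]), fun j => ?_⟩
  apply mul_right_cancel₀ (hX 0)
  rw [h2, hμ]
  ring

lemma exists_complementMaps {k : Type} [Field k] {n : ℕ} (hn : 0 < n) {f g : PolyRing k n}
    (hf : Irreducible f) (hfd : f.IsHomogeneous 3) (hg : Irreducible g) (hgd : g.IsHomogeneous 3)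
    (h : IsoOver (PnFStruct k n f) (PnFStruct k n g)) :
    ∃ p G d e c c' μ ν, ComplementMaps f g p G d e c c' μ ν := by
  obtain ⟨σ, hσ⟩ := exists_ringEquiv_of_isoOver hfd (by norm_num) hgd (by norm_num) h
  have hσ' : ∀ c, σ.symm (awayScalar k n g c) = awayScalar k n f c := fun c => by
    rw [← hσ, RingEquiv.symm_apply_apply]
  obtain ⟨p, d, c, hc, hp, hpf, hpm⟩ := exists_polynomial_map hf.ne_zero hfd hg hgd σ hσ
  obtain ⟨G, e, c', hc', hG, hGg, hGm⟩ := exists_polynomial_map hg.ne_zero hgd hf hfd σ.symm hσ'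
  have aux : ∀ {f g : PolyRing k n} (hf : Irreducible f) (hfd : f ∈ grading k n 3)
      (hg : Irreducible g) (hgd : g ∈ grading k n 3)
      (σ : HomogeneousLocalization.Away (grading k n) f ≃+*
        HomogeneousLocalization.Away (grading k n) g)
      (p G : Fin (n + 1) → PolyRing k n) (c c' : k) (d e : ℕ), c ≠ 0 → c' ≠ 0 →
      bind₁ p f = C c * g ^ d → bind₁ G g = C c' * f ^ e →
      (∀ (s : ℕ) (M : PolyRing k n) (hM : M ∈ grading k n (s • 3)),
        awayFrac g hg.ne_zero (σ (HomogeneousLocalization.Away.mk (grading k n) hfd s M hM)) =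
          algebraMap _ (PolyFrac k n) (bind₁ p M) / algebraMap _ _ (bind₁ p f) ^ s) →
      (∀ (s : ℕ) (M : PolyRing k n) (hM : M ∈ grading k n (s • 3)),
        awayFrac f hf.ne_zero (σ.symm (HomogeneousLocalization.Away.mk (grading k n) hgd s M hM)) =
          algebraMap _ (PolyFrac k n) (bind₁ G M) / algebraMap _ _ (bind₁ G g) ^ s) →
      ∃ μ, μ ≠ 0 ∧ ∀ j, bind₁ p (G j) = X j * μ := by
    intro f g hf hfd hg hgd σ p G c c' d e hc hc' hpf hGg hpm hGm
    have hinj := IsFractionRing.injective (PolyRing k n) (PolyFrac k n)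
    have hpf0 : bind₁ p f ≠ 0 := by
      rw [hpf]; exact mul_ne_zero (by simpa using hc) (pow_ne_zero _ hg.ne_zero)
    have hGg0 : bind₁ G g ≠ 0 := by
      rw [hGg]; exact mul_ne_zero (by simpa using hc') (pow_ne_zero _ hf.ne_zero)
    have hpGg0 : bind₁ p (bind₁ G g) ≠ 0 := by
      rw [hGg, map_mul, map_pow, bind₁_C_right]
      exact mul_ne_zero (by simpa using hc') (pow_ne_zero _ hpf0)
    refine exists_factor_of_proportional hn (fun j => bind₁ p (G j)) g (bind₁ p (bind₁ G g))
      hg.ne_zero hpGg0 fun j => ?_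
    have hM : (X j * X 0 ^ 2 : PolyRing k n) ∈ grading k n (1 • 3) :=
      (isHomogeneous_X k j).mul ((isHomogeneous_X k 0).pow 2)
    obtain ⟨s, W, hW, hWe⟩ := HomogeneousLocalization.Away.mk_surjective _ hfd
      (σ.symm (HomogeneousLocalization.Away.mk (grading k n) hgd 1 _ hM))
    have h1 := hGm 1 _ hM
    have h2 := hpm s W hW
    rw [hWe, RingEquiv.apply_symm_apply, awayFrac_mk, div_eq_div_iff
      (pow_ne_zero _ (by simpa using hg.ne_zero)) (pow_ne_zero _ (by simpa using hpf0))] at h2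
    rw [← hWe, awayFrac_mk, div_eq_div_iff
      (pow_ne_zero _ (by simpa using hf.ne_zero)) (pow_ne_zero _ (by simpa using hGg0))] at h1
    simp only [← map_pow, ← map_mul] at h1 h2
    have h1 := hinj h1
    have h2 := hinj h2
    have h1 := congrArg (bind₁ p) h1
    simp only [map_mul, map_pow, bind₁_X_right, pow_one] at h1 h2
    apply mul_right_cancel₀ (pow_ne_zero s hpf0)
    linear_combination (-g) * h1 - (bind₁ p (bind₁ G g)) * h2
  obtain ⟨μ, hμ, hμ'⟩ := aux hf hfd hg hgd σ p G c c' d e hc hc' hpf hGg hpm hGm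
  obtain ⟨ν, hν, hν'⟩ := aux hg hgd hf hfd σ.symm G p c' c e d hc' hc hGg hpf hGm
    (by simpa using hpm)
  exact ⟨p, G, d, e, c, c', μ, ν, hp, hG, hc, hc', hμ, hν, hpf, hGg, hμ', hν'⟩

section LinearChange

variable {k : Type} [Field k] {n : ℕ}

/-- Two mutually inverse linear substitutions. -/
structure LinChange (L L' : Fin (n + 1) → PolyRing k n) : Prop where
  hom : ∀ i, (L i).IsHomogeneous 1
  hom' : ∀ i, (L' i).IsHomogeneous 1
  bind_left : ∀ i, bind₁ L (L' i) = X i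
  bind_right : ∀ i, bind₁ L' (L i) = X i

lemma LinChange.symm {L L' : Fin (n + 1) → PolyRing k n} (h : LinChange L L') :
    LinChange L' L :=
  ⟨h.hom', h.hom, h.bind_right, h.bind_left⟩

lemma LinChange.bind_bind {L L' : Fin (n + 1) → PolyRing k n} (h : LinChange L L')
    (F : PolyRing k n) : bind₁ L (bind₁ L' F) = F := by
  rw [bind₁_bind₁]
  simp only [h.bind_left]
  exact DFunLike.congr_fun (aeval_X_left (σ := Fin (n + 1)) (R := k)) F

lemma isHomogeneous_bind₁_one {L : Fin (n + 1) → PolyRing k n} (hL : ∀ i, (L i).IsHomogeneous 1)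
    {F : PolyRing k n} {d : ℕ} (hF : F.IsHomogeneous d) : (bind₁ L F).IsHomogeneous d := by
  simpa using isHomogeneous_bind₁ hF hL

lemma LinChange.trans {L L' M M' : Fin (n + 1) → PolyRing k n} (h : LinChange L L')
    (h' : LinChange M M') :
    LinChange (fun i => bind₁ M (L i)) (fun i => bind₁ L' (M' i)) where
  hom i := isHomogeneous_bind₁_one h'.hom (h.hom i)
  hom' i := isHomogeneous_bind₁_one h.hom' (h'.hom' i)
  bind_left i := by
    rw [← bind₁_bind₁ L M, h.bind_bind, h'.bind_left]
  bind_right i := by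
    rw [← bind₁_bind₁ M' L', h'.symm.bind_bind, h.bind_right]

/-- A linear substitution as a graded ring homomorphism. -/
def linGradedHom (L : Fin (n + 1) → PolyRing k n) (hL : ∀ i, (L i).IsHomogeneous 1) :
    grading k n →+*ᵍ grading k n where
  __ := (bind₁ L : PolyRing k n →+* PolyRing k n)
  map_mem hx := isHomogeneous_bind₁_one hL hx

lemma linGradedHom_irrelevant {L L' : Fin (n + 1) → PolyRing k n} (h : LinChange L L') :
    HomogeneousIdeal.irrelevant (grading k n) ≤
      (HomogeneousIdeal.irrelevant (grading k n)).map (linGradedHom L h.hom) := by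
  refine (HomogeneousIdeal.irrelevant_le _).mpr fun i hi x hx => ?_
  have h1 : x = linGradedHom L h.hom (bind₁ L' x) := (h.bind_bind x).symm
  rw [h1]
  refine Ideal.mem_map_of_mem _ ?_
  exact HomogeneousIdeal.mem_irrelevant_of_mem _ hi (isHomogeneous_bind₁_one h.hom' hx)

/-- The endomorphism of projective space induced by a linear substitution. -/
def linProj {L L' : Fin (n + 1) → PolyRing k n} (h : LinChange L L') :
    ProjSpace k n ⟶ ProjSpace k n :=
  Proj.map (linGradedHom L h.hom) (linGradedHom_irrelevant h)

lemma linProj_comp {L L' : Fin (n + 1) → PolyRing k n} (h : LinChange L L') :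
    linProj h ≫ linProj h.symm = 𝟙 _ := by
  rw [linProj, linProj, ← Proj.map_comp]
  convert Proj.map_id (𝒜 := grading k n)
  ext x : 1
  exact h.bind_bind x

lemma mem_zeroLocusSet_linProj {L L' : Fin (n + 1) → PolyRing k n} (h : LinChange L L')
    (F : PolyRing k n) (x : ProjSpace k n) :
    (linProj h).base x ∈ zeroLocusSet k n F ↔ x ∈ zeroLocusSet k n (bind₁ L F) :=
  Iff.rfl

lemma linProj_projStruct {L L' : Fin (n + 1) → PolyRing k n} (h : LinChange L L') :
    linProj h ≫ projStruct k n = projStruct k n := by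
  refine (Proj.mapAffineOpenCover _ (linGradedHom_irrelevant h)).openCover.hom_ext _ _ fun s => ?_
  have hs : 0 < s.1.1 := s.1.2
  have hms : (s.2.1 : PolyRing k n) ∈ grading k n s.1.1 := s.2.2
  have hms' : linGradedHom L h.hom (s.2.1 : PolyRing k n) ∈ grading k n s.1.1 :=
    (linGradedHom L h.hom).2 hms
  change Proj.awayι (grading k n) (linGradedHom L h.hom s.2.1) hms' hs ≫
      Proj.map (linGradedHom L h.hom) (linGradedHom_irrelevant h) ≫ projStruct k n =
    Proj.awayι (grading k n) (linGradedHom L h.hom s.2.1) hms' hs ≫ projStruct k n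
  rw [← Category.assoc, Proj.awayι_comp_map _ _ hs _ hms, Category.assoc,
    awayι_projStruct hms hs, awayι_projStruct hms' hs, ← Spec.map_comp, ← CommRingCat.ofHom_comp]
  congr 2
  ext c
  change Localization.mk (bind₁ L (C c)) _ = Localization.mk (C c) _
  rw [bind₁_C_right]
  congr 1
  exact Subtype.ext (map_one (bind₁ L))

/-- The automorphism of projective space induced by a linear change of coordinates. -/
def linIso {L L' : Fin (n + 1) → PolyRing k n} (h : LinChange L L') :
    ProjSpace k n ≅ ProjSpace k n where
  hom := linProj h
  inv := linProj h.symm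
  hom_inv_id := linProj_comp h
  inv_hom_id := linProj_comp h.symm

lemma linIso_image_zeroLocusSet {L L' : Fin (n + 1) → PolyRing k n} (h : LinChange L L')
    (F : PolyRing k n) :
    (linIso h).hom.base '' zeroLocusSet k n (bind₁ L F) = zeroLocusSet k n F := by
  ext y
  constructor
  · rintro ⟨x, hx, rfl⟩
    exact hx
  · intro hy
    refine ⟨(linIso h).inv.base y, ?_, ?_⟩
    · rw [← mem_zeroLocusSet_linProj h]
      change (linIso h).hom.base ((linIso h).inv.base y) ∈ _
      rw [← Scheme.Hom.comp_apply, (linIso h).inv_hom_id]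
      exact hy
    · rw [← Scheme.Hom.comp_apply, (linIso h).inv_hom_id]
      rfl

lemma IsHypersurface.comp_linIso {L L' : Fin (n + 1) → PolyRing k n} (h : LinChange L L')
    {F : PolyRing k n} {H : Scheme} {ι : H ⟶ ProjSpace k n}
    (hF : IsHypersurface (bind₁ L F) H ι) : IsHypersurface F H (ι ≫ (linIso h).hom) where
  isClosedImmersion := by
    have := hF.isClosedImmersion
    infer_instance
  reduced := hF.reduced
  range_eq := by
    rw [← linIso_image_zeroLocusSet h, ← hF.range_eq, ← Set.range_comp]
    rfl

lemma zeroLocusSet_C_mul {c : k} (hc : c ≠ 0) (F : PolyRing k n) :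
    zeroLocusSet k n (C c * F) = zeroLocusSet k n F := by
  have : IsUnit (C c : PolyRing k n) := (isUnit_iff_ne_zero.mpr hc).map C
  ext x
  exact Ideal.unit_mul_mem_iff_mem _ this

end LinearChange

section LinearChangeConstructions

variable {k : Type} [Field k] {n : ℕ}

lemma linChange_toMvPolynomial {M : Matrix (Fin (n + 1)) (Fin (n + 1)) k} (hM : IsUnit M) :
    LinChange M.toMvPolynomial M⁻¹.toMvPolynomial where
  hom := M.toMvPolynomial_isHomogeneous
  hom' := M⁻¹.toMvPolynomial_isHomogeneous
  bind_left i := by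
    rw [← Matrix.toMvPolynomial_mul,
      Matrix.nonsing_inv_mul _ ((Matrix.isUnit_iff_isUnit_det _).mp hM),
      Matrix.toMvPolynomial_one]
  bind_right i := by
    rw [← Matrix.toMvPolynomial_mul,
      Matrix.mul_nonsing_inv _ ((Matrix.isUnit_iff_isUnit_det _).mp hM),
      Matrix.toMvPolynomial_one]

lemma aeval_toMvPolynomial {m A : Type*} [Fintype m] [CommRing A] [Algebra k A]
    (M : Matrix m m k) (i : m) (v : m → A) :
    aeval v (M.toMvPolynomial i) = ∑ j, algebraMap k A (M i j) * v j := by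
  simp [Matrix.toMvPolynomial, aeval_monomial]

lemma exists_linearEquiv_of_linearIndependent {ι V : Type*} [AddCommGroup V] [Module k V]
    [FiniteDimensional k V] {v w : ι → V} (hv : LinearIndependent k v)
    (hw : LinearIndependent k w) : ∃ g : V ≃ₗ[k] V, ∀ i, g (v i) = w i := by
  obtain ⟨g, hg⟩ := Submodule.exists_linearEquiv_restrict_eq
    (hv.linearCombinationEquiv.symm.trans hw.linearCombinationEquiv)
  refine ⟨g, fun i => ?_⟩
  have hi : v i ∈ Submodule.span k (Set.range v) := Submodule.subset_span (Set.mem_range_self i)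
  have h1 : hv.linearCombinationEquiv.symm ⟨v i, hi⟩ = Finsupp.single i 1 := by
    rw [LinearEquiv.symm_apply_eq]
    exact Subtype.ext (by simp)
  have h2 := hg ⟨v i, hi⟩
  rw [LinearEquiv.trans_apply, h1] at h2
  rw [← h2]
  simp

lemma exists_matrix_of_linearIndependent {ι m : Type*} [Fintype m] [DecidableEq m] (e : ι ↪ m)
    {v : ι → m → k} (hv : LinearIndependent k v) :
    ∃ M : Matrix m m k, IsUnit M ∧ ∀ i j, M j (e i) = v i j := by
  have he : LinearIndependent k (fun i : ι => (Pi.single (e i) 1 : m → k)) :=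
    by simpa [Function.comp_def] using (Pi.basisFun k m).linearIndependent.comp e e.injective
  obtain ⟨g, hg⟩ := exists_linearEquiv_of_linearIndependent he hv
  refine ⟨LinearMap.toMatrix' g.toLinearMap, ?_, fun i j => ?_⟩
  · rw [Matrix.isUnit_iff_isUnit_det]
    rw [LinearMap.det_toMatrix']
    exact LinearEquiv.isUnit_det' g
  · rw [LinearMap.toMatrix'_apply]
    have := congrFun (hg i) j
    simpa [Pi.single_apply] using this

lemma exists_toMvPolynomial_eq {m : Type*} [Fintype m] {L : m → MvPolynomial m k}
    (hL : ∀ i, (L i).IsHomogeneous 1) : ∃ M : Matrix m m k, L = M.toMvPolynomial := by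
  classical
  refine ⟨fun i j => coeff (Finsupp.single j 1) (L i), ?_⟩
  funext i
  ext d
  change _ = coeff d (∑ j, monomial (Finsupp.single j 1) (coeff (Finsupp.single j 1) (L i)))
  rw [coeff_sum]
  by_cases hd : d.degree = 1
  · obtain ⟨j, rfl⟩ := (Finsupp.sum_eq_one_iff d).mp hd
    rw [Finset.sum_eq_single j]
    · simp
    · intro b _ hb
      rw [coeff_monomial, if_neg]
      intro h
      exact hb (Finsupp.single_left_injective one_ne_zero h)
    · simp
  · rw [(hL i).coeff_eq_zero hd, eq_comm]
    refine Finset.sum_eq_zero fun j _ => ?_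
    rw [coeff_monomial, if_neg]
    rintro rfl
    simp at hd

/-- Linearly independent linear forms define a linear change of coordinates. -/
lemma exists_linChange {L : Fin (n + 1) → PolyRing k n} (hL : ∀ i, (L i).IsHomogeneous 1)
    (hli : LinearIndependent k L) : ∃ L', LinChange L L' := by
  obtain ⟨M, rfl⟩ := exists_toMvPolynomial_eq hL
  refine ⟨_, linChange_toMvPolynomial (Matrix.linearIndependent_rows_iff_isUnit.mp ?_)⟩
  rw [Fintype.linearIndependent_iff] at hli ⊢
  intro c hc
  refine hli c ?_
  have : ∀ j, ∑ i, c i * M i j = 0 := fun j => by simpa [Matrix.row] using congrFun hc j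
  simp only [Matrix.toMvPolynomial, Finset.smul_sum, smul_monomial, smul_eq_mul]
  rw [Finset.sum_comm]
  refine Finset.sum_eq_zero fun j _ => ?_
  rw [← map_sum, this, map_zero]

end LinearChangeConstructions

section RationalityScheme

variable {k : Type} [Field k]

lemma isRationalSurface_of_isOpenImmersion {H W : Scheme} [Nonempty W] (s : H ⟶ SpecK k)
    (i : W ⟶ H) (j : W ⟶ ProjSpace k 2) [IsOpenImmersion i] [IsOpenImmersion j]
    (h : i ≫ s = j ≫ projStruct k 2) : IsRationalSurface k s := by
  obtain ⟨w⟩ := ‹Nonempty W›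
  refine ⟨i.opensRange, j.opensRange, ?_, ?_, i.isoOpensRange.symm ≪≫ j.isoOpensRange, ?_⟩
  · intro h0
    have : i.base w ∈ i.opensRange := ⟨w, rfl⟩
    rw [h0] at this
    exact this
  · intro h0
    have : j.base w ∈ j.opensRange := ⟨w, rfl⟩
    rw [h0] at this
    exact this
  · simp only [Iso.trans_hom, Iso.symm_hom, Category.assoc]
    rw [← Category.assoc j.isoOpensRange.hom, Scheme.Hom.isoOpensRange_hom_ι, ← h,
      Iso.inv_comp_eq, ← Category.assoc, Scheme.Hom.isoOpensRange_hom_ι]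

/-- A ring homomorphism which becomes bijective after inverting `u` induces, on spectra of
quotients by its kernel, an open immersion. -/
lemma isOpenImmersion_Spec_of_localization {A T : Type} [CommRing A] [CommRing T]
    (α : A →+* T) (hα : Function.Injective α) (u : A) (hu : IsUnit (α u))
    (hs : ∀ z : T, ∃ (N : ℕ) (y : A), z * α u ^ N = α y) :
    IsOpenImmersion (Spec.map (CommRingCat.ofHom α)) := by
  algebraize [α]
  have : IsLocalization.Away u T :=
    IsLocalization.Away.mk u hu hs fun a b hab => ⟨0, by rw [hα hab]⟩
  exact IsOpenImmersion.of_isLocalization (R := A) (S := T) u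

/-- The coordinate ring of the affine chart `x_0 ≠ 0`. -/
abbrev ChartRing (k : Type) [Field k] (n : ℕ) : Type :=
  HomogeneousLocalization.Away (grading k n) (X 0 : PolyRing k n)

lemma isRationalSurface_of_ringHom {f : PolyRing k 3} (hfd : f ∈ grading k 3 3)
    {H : Scheme} {ι : H ⟶ ProjSpace k 3} (hH : IsHypersurface f H ι)
    {T : Type} [CommRing T] [IsDomain T]
    (j : Spec (CommRingCat.of T) ⟶ ProjSpace k 2) [IsOpenImmersion j]
    (hX : (X 0 : PolyRing k 3) ∈ grading k 3 1)
    (α : ChartRing k 3 →+* T)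
    (hj : j ≫ projStruct k 2 =
      Spec.map (CommRingCat.ofHom (α.comp (awayScalar k 3 (X 0 : PolyRing k 3)))))
    (hker : ∀ y, α y = 0 ↔
      HomogeneousLocalization.Away.isLocalizationElem hX hfd ∣ y)
    (u : ChartRing k 3) (hu : IsUnit (α u))
    (hs : ∀ z : T, ∃ (N : ℕ) (y : _), z * α u ^ N = α y) :
    IsRationalSurface k (ι ≫ projStruct k 3) := by
  have := hH.isClosedImmersion
  have := hH.reduced
  let q : Spec (.of (ChartRing k 3)) ⟶ ProjSpace k 3 :=
    Proj.awayι (grading k 3) (X 0 : PolyRing k 3) hX one_pos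
  let w : ChartRing k 3 := HomogeneousLocalization.Away.isLocalizationElem hX hfd
  have hcl : IsClosedImmersion (Limits.pullback.snd ι q) := inferInstance
  obtain ⟨I, e, he⟩ : ∃ (I : Ideal (ChartRing k 3))
      (e : Limits.pullback ι q ≅ Spec (.of (ChartRing k 3 ⧸ I))),
      Limits.pullback.snd ι q = e.hom ≫ Spec.map (CommRingCat.ofHom (Ideal.Quotient.mk I)) :=
    (IsClosedImmersion.Spec_iff (R := .of (ChartRing k 3))).mp hcl
  have hred : IsReduced (Limits.pullback ι q) :=
    isReduced_of_isOpenImmersion (Limits.pullback.fst ι q)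
  have hI : I.IsRadical := by
    rw [Ideal.isRadical_iff_quotient_reduced]
    have : IsReduced (Spec (.of (ChartRing k 3 ⧸ I))) := isReduced_of_isOpenImmersion e.inv
    exact (affine_isReduced_iff (.of (ChartRing k 3 ⧸ I))).mp this
  have hrange : PrimeSpectrum.zeroLocus (I : Set (ChartRing k 3)) =
      PrimeSpectrum.zeroLocus {w} := by
    have h1 := Scheme.Pullback.range_snd ι q
    rw [he] at h1
    have h2 := range_comap_of_surjective _ (Ideal.Quotient.mk I)
      Ideal.Quotient.mk_surjective
    rw [Ideal.mk_ker] at h2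
    have h3 : Set.range (e.hom ≫ Spec.map (CommRingCat.ofHom (Ideal.Quotient.mk I))) =
        Set.range (PrimeSpectrum.comap (Ideal.Quotient.mk I)) := by
      rw [Scheme.Hom.comp_base, TopCat.coe_comp]
      exact (e.hom.homeomorph.surjective).range_comp _
    have h4 : (q ⁻¹' Set.range ι : Set (PrimeSpectrum (ChartRing k 3))) =
        PrimeSpectrum.zeroLocus {w} := by
      have h5 := Proj.awayι_preimage_basicOpen (grading k 3) hX one_pos hfd (by norm_num)
      ext x
      have h6 : q.base x ∈ Proj.basicOpen (grading k 3) f ↔ x ∈ PrimeSpectrum.basicOpen w :=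
        SetLike.ext_iff.mp h5 x
      have h7 : q.base x ∈ Set.range ι ↔ ¬ q.base x ∈ Proj.basicOpen (grading k 3) f := by
        have : Set.range ι = zeroLocusSet k 3 f := hH.range_eq
        rw [this]
        exact not_not.symm
      refine h7.trans ((not_congr h6).trans ?_)
      rw [PrimeSpectrum.mem_basicOpen, not_not, PrimeSpectrum.mem_zeroLocus,
        Set.singleton_subset_iff]
      rfl
    rw [← h2, ← h3, h1]
    exact h4
  have hprime : (RingHom.ker α).IsPrime := RingHom.ker_isPrime α
  have hIw : I = RingHom.ker α := by
    rw [← hI.radical, ← PrimeSpectrum.vanishingIdeal_zeroLocus_eq_radical, hrange,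
      ← PrimeSpectrum.zeroLocus_span, PrimeSpectrum.vanishingIdeal_zeroLocus_eq_radical]
    have : Ideal.span {w} = RingHom.ker α := by
      ext y
      rw [Ideal.mem_span_singleton, RingHom.mem_ker, hker]
    rw [this, hprime.radical]
  subst hIw
  have h1 := isOpenImmersion_Spec_of_localization α.kerLift α.kerLift_injective
    (Ideal.Quotient.mk _ u) hu (fun z => by
      obtain ⟨N, y, h⟩ := hs z
      exact ⟨N, Ideal.Quotient.mk _ y, h⟩)
  let i : Spec (.of T) ⟶ H :=
    (Spec.map (CommRingCat.ofHom α.kerLift) ≫ e.inv) ≫ Limits.pullback.fst ι q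
  refine isRationalSurface_of_isOpenImmersion (W := Spec (.of T)) _ i j ?_
  rw [hj]
  simp only [i, Category.assoc]
  rw [← Category.assoc (Limits.pullback.fst ι q), Limits.pullback.condition, he,
    Category.assoc, Category.assoc, awayι_projStruct hX one_pos, e.inv_hom_id_assoc]
  simp only [← Spec.map_comp, ← CommRingCat.ofHom_comp]
  rfl

end RationalityScheme

section RationalityCriterion

variable {k : Type} [Field k]

/-- The ring homomorphism from the coordinate ring of the chart `x_0 ≠ 0` given by evaluation
at a point with `x_0 = 1`. -/
def chartEval {n : ℕ} {T : Type} [CommRing T] (σ : k →+* T) (ψ : Fin (n + 1) → T)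
    (h0 : ψ 0 = 1) : ChartRing k n →+* T :=
  (IsLocalization.lift (M := Submonoid.powers (X 0 : PolyRing k n))
    (S := Localization.Away (X 0 : PolyRing k n)) (g := eval₂Hom σ ψ) (by
      rintro ⟨_, m, rfl⟩
      simp [h0])).comp (algebraMap _ (Localization.Away (X 0 : PolyRing k n)))

lemma chartEval_mk {n : ℕ} {T : Type} [CommRing T] (σ : k →+* T) (ψ : Fin (n + 1) → T)
    (h0 : ψ 0 = 1) (hX : (X 0 : PolyRing k n) ∈ grading k n 1) (m : ℕ) (F : PolyRing k n)
    (hF : F ∈ grading k n (m • 1)) :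
    chartEval σ ψ h0 (HomogeneousLocalization.Away.mk _ hX m F hF) = eval₂Hom σ ψ F := by
  rw [chartEval, RingHom.comp_apply, HomogeneousLocalization.algebraMap_apply,
    HomogeneousLocalization.Away.val_mk, Localization.mk_eq_mk']
  erw [IsLocalization.lift_mk'_spec]
  simp [h0]

lemma chartEval_awayScalar {n : ℕ} {T : Type} [CommRing T] (σ : k →+* T) (ψ : Fin (n + 1) → T)
    (h0 : ψ 0 = 1) (c : k) :
    chartEval σ ψ h0 (awayScalar k n (X 0) c) = σ c := by
  have hX : (X 0 : PolyRing k n) ∈ grading k n 1 := isHomogeneous_X _ _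
  have hC : (C c : PolyRing k n) ∈ grading k n (0 • 1) := by simp
  have : awayScalar k n (X 0 : PolyRing k n) c =
      HomogeneousLocalization.Away.mk _ hX 0 (C c) hC := by
    apply awayFrac_injective (X_ne_zero 0)
    rw [awayFrac_awayScalar, awayFrac_mk]
    simp
    rfl
  rw [this, chartEval_mk]
  simp

lemma exists_chartEval_eq {n : ℕ} {T : Type} [CommRing T] (σ : k →+* T) (ψ : Fin (n + 1) → T)
    (h0 : ψ 0 = 1) (F : PolyRing k n) : ∃ y, eval₂Hom σ ψ F = chartEval σ ψ h0 y := by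
  induction F using MvPolynomial.induction_on with
  | C c => exact ⟨_, by rw [chartEval_awayScalar σ ψ h0 c]; simp⟩
  | add p q hp hq =>
    obtain ⟨y, hy⟩ := hp
    obtain ⟨z, hz⟩ := hq
    exact ⟨y + z, by rw [map_add, map_add, hy, hz]⟩
  | mul_X p i hp =>
    obtain ⟨y, hy⟩ := hp
    have hX : (X 0 : PolyRing k n) ∈ grading k n 1 := isHomogeneous_X _ _
    refine ⟨y * HomogeneousLocalization.Away.mk _ hX 1 (X i)
      (by simpa using isHomogeneous_X _ _), ?_⟩
    rw [map_mul, map_mul, hy, chartEval_mk]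

lemma isLocalizationElem_dvd {f : PolyRing k 3} (hX : (X 0 : PolyRing k 3) ∈ grading k 3 1)
    (hfd : f ∈ grading k 3 3) (hf0 : f ≠ 0) (m : ℕ) (F : PolyRing k 3)
    (hF : F ∈ grading k 3 (m • 1)) (h : f ∣ F) :
    HomogeneousLocalization.Away.isLocalizationElem hX hfd ∣
      HomogeneousLocalization.Away.mk _ hX m F hF := by
  obtain ⟨G, rfl⟩ := h
  have hG : (G * X 0 ^ 3).IsHomogeneous m := by
    refine isHomogeneous_right_of_mul (m := 3) ?_ hfd hf0
    rw [← mul_assoc, add_comm 3 m]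
    refine IsHomogeneous.mul (by simpa using hF) ?_
    simpa using (isHomogeneous_X k (0 : Fin 4)).pow 3
  refine ⟨HomogeneousLocalization.Away.mk _ hX m (G * X 0 ^ 3) (by simpa using hG), ?_⟩
  apply awayFrac_injective (X_ne_zero 0)
  rw [map_mul, HomogeneousLocalization.Away.isLocalizationElem, awayFrac_mk, awayFrac_mk,
    awayFrac_mk]
  have : algebraMap (PolyRing k 3) (PolyFrac k 3) (X 0) ≠ 0 := by
    simp
  field_simp
  simp only [map_mul, map_pow]
  ring

lemma eval₂_awayScalar_mk {D : PolyRing k 2} (hD0 : D ≠ 0) {e : ℕ} (hD : D ∈ grading k 2 e)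
    {σ : Type} (P : σ → PolyRing k 2) (hP : ∀ i, P i ∈ grading k 2 (1 • e))
    {F : MvPolynomial σ k} {n : ℕ} (hF : F.IsHomogeneous n) :
    awayFrac D hD0 (eval₂Hom (awayScalar k 2 D)
      (fun i => HomogeneousLocalization.Away.mk _ hD 1 (P i) (hP i)) F) =
      algebraMap _ (PolyFrac k 2) (aeval P F) / algebraMap _ (PolyFrac k 2) D ^ n := by
  have h1 : awayFrac D hD0 (eval₂Hom (awayScalar k 2 D)
      (fun i => HomogeneousLocalization.Away.mk _ hD 1 (P i) (hP i)) F) =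
      aeval (fun i => algebraMap _ (PolyFrac k 2) (P i) *
        (algebraMap _ (PolyFrac k 2) D)⁻¹) F := by
    rw [← RingHom.comp_apply, MvPolynomial.aeval_def, ← coe_eval₂Hom]
    congr 1
    apply MvPolynomial.ringHom_ext
    · intro c
      simp [awayFrac_awayScalar]
    · intro i
      simp [awayFrac_mk, div_eq_mul_inv]
  rw [h1, aeval_mul_const_of_isHomogeneous hF, div_eq_mul_inv, inv_pow]
  congr 1
  have := MvPolynomial.aeval_algebraMap_apply (R := k) (PolyFrac k 2) P F
  exact this

lemma div_pow_eq_of_mul_eq {K : Type*} [Field K] {q a d y : K} (hd : d ≠ 0) {N m r l : ℕ}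
    (h : q * a ^ N * d ^ m = y * d ^ (r + l * N)) :
    q / d ^ r * (a / d ^ l) ^ N = y / d ^ m := by
  rw [div_pow, ← pow_mul, div_mul_div_comm, div_eq_div_iff (by positivity) (by positivity), h,
    pow_add]

lemma isRationalSurface_of_parametrization {f : PolyRing k 3} (hf0 : f ≠ 0)
    (hfd : f.IsHomogeneous 3)
    {H : Scheme} {ι : H ⟶ ProjSpace k 3} (hH : IsHypersurface f H ι)
    {D : PolyRing k 2} (hD0 : D ≠ 0) {e : ℕ} (he : 0 < e) (hD : D.IsHomogeneous e)
    (P : Fin (3 + 1) → PolyRing k 2) (hP : ∀ i, (P i).IsHomogeneous e) (hP0 : P 0 = D)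
    (hPf : aeval P f = 0)
    (hker : ∀ n (F : PolyRing k 3), F.IsHomogeneous n → aeval P F = 0 → f ∣ F)
    (a : PolyRing k 3) {l : ℕ} (ha : a.IsHomogeneous l) (haD : ∃ M, aeval P a ∣ D ^ M)
    (hgen : ∀ r (Q : PolyRing k 2), Q.IsHomogeneous (r * e) →
      ∃ (N m : ℕ) (y : PolyRing k 3), y.IsHomogeneous m ∧
      Q * aeval P a ^ N * D ^ m = aeval P y * D ^ (r + l * N)) :
    IsRationalSurface k (ι ≫ projStruct k 3) := by
  have hX : (X 0 : PolyRing k 3) ∈ grading k 3 1 := isHomogeneous_X _ _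
  have hD' : D ∈ grading k 2 e := hD
  have hP' : ∀ i, P i ∈ grading k 2 (1 • e) := fun i => by simpa using hP i
  let ψ : Fin (3 + 1) → HomogeneousLocalization.Away (grading k 2) D :=
    fun i => HomogeneousLocalization.Away.mk _ hD' 1 (P i) (hP' i)
  have hDK : algebraMap _ (PolyFrac k 2) D ≠ 0 := by simpa using hD0
  have key : ∀ {F : PolyRing k 3} {n : ℕ}, F.IsHomogeneous n → awayFrac D hD0
      (eval₂Hom (awayScalar k 2 D) ψ F) =
      algebraMap _ (PolyFrac k 2) (aeval P F) / algebraMap _ (PolyFrac k 2) D ^ n :=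
    fun hF => eval₂_awayScalar_mk hD0 hD' P hP' hF
  have h0 : ψ 0 = 1 := by
    apply awayFrac_injective hD0
    rw [map_one]
    simp only [ψ]
    rw [awayFrac_mk, hP0]
    simp [hDK]
  have hdom : IsDomain (HomogeneousLocalization.Away (grading k 2) D) :=
    (awayFrac_injective hD0).isDomain _
  have hzero : ∀ {F : PolyRing k 3} {n : ℕ}, F.IsHomogeneous n →
      (eval₂Hom (awayScalar k 2 D) ψ F = 0 ↔ aeval P F = 0) := by
    intro F n hF
    rw [← (awayFrac_injective hD0).eq_iff, key hF, map_zero, div_eq_zero_iff]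
    simp [hD0]
  let α := chartEval (awayScalar k 2 D) ψ h0
  have haX : a ∈ grading k 3 (l • 1) := by simpa using ha
  refine isRationalSurface_of_ringHom hfd hH (T := HomogeneousLocalization.Away (grading k 2) D)
    (Proj.awayι (grading k 2) D hD' he) hX α ?_ ?_
    (HomogeneousLocalization.Away.mk _ hX l a haX) ?_ ?_
  · rw [awayι_projStruct hD' he]
    congr 2
    ext c
    simp [α, chartEval_awayScalar]
  · intro y
    obtain ⟨n, F, hF, rfl⟩ := HomogeneousLocalization.Away.mk_surjective _ hX y
    have hF' : F.IsHomogeneous n := by simpa using hF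
    constructor
    · intro h
      refine isLocalizationElem_dvd hX hfd hf0 n F hF (hker n F hF' ?_)
      rw [← hzero hF']
      rw [← h]
      exact (chartEval_mk _ _ _ _ _ _ _).symm
    · rintro ⟨z, hz⟩
      rw [hz, map_mul]
      have : α (HomogeneousLocalization.Away.isLocalizationElem hX hfd) = 0 := by
        refine (chartEval_mk _ _ _ _ _ _ _).trans ?_
        rw [map_pow, (hzero hfd).mpr hPf]
        simp
      rw [this, zero_mul]
  · obtain ⟨M, c, hc⟩ := haD
    have h1 : α (HomogeneousLocalization.Away.mk _ hX l a haX) =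
        eval₂Hom (awayScalar k 2 D) ψ a := chartEval_mk _ _ _ _ _ _ _
    rw [h1]
    have haP : aeval P a ≠ 0 := by
      intro h
      rw [h, zero_mul] at hc
      exact pow_ne_zero M hD0 hc
    have hDc : (D ^ l * c).IsHomogeneous (M * e) := by
      refine isHomogeneous_right_of_mul (m := e * l) ?_ (ha.aeval P hP) haP
      have : aeval P a * (D ^ l * c) = D ^ (l + M) := by rw [pow_add, hc]; ring
      rw [this]
      have h2 := hD.pow (l + M)
      rwa [mul_add, mul_comm e M] at h2
    refine IsUnit.of_mul_eq_one
      (HomogeneousLocalization.Away.mk _ hD' M (D ^ l * c) (by simpa using hDc)) ?_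
    apply awayFrac_injective hD0
    rw [map_mul, key ha, awayFrac_mk, map_one, div_mul_div_comm, ← pow_add, ← map_mul,
      div_eq_one_iff_eq (pow_ne_zero _ hDK), ← map_pow]
    congr 1
    rw [pow_add, hc]
    ring
  · intro z
    obtain ⟨r, Q, hQ, rfl⟩ := HomogeneousLocalization.Away.mk_surjective _ hD' z
    have hQ' : Q.IsHomogeneous (r * e) := by simpa using hQ
    obtain ⟨N, m, y, hy, h⟩ := hgen r Q hQ'
    obtain ⟨y', hy'⟩ := exists_chartEval_eq (awayScalar k 2 D) ψ h0 y
    refine ⟨N, y', ?_⟩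
    have h1 : α (HomogeneousLocalization.Away.mk _ hX l a haX) =
        eval₂Hom (awayScalar k 2 D) ψ a := chartEval_mk _ _ _ _ _ _ _
    rw [← hy', h1]
    apply awayFrac_injective hD0
    rw [map_mul, map_pow, key ha, key hy, awayFrac_mk]
    have h2 := congrArg (algebraMap (PolyRing k 2) (PolyFrac k 2)) h
    simp only [map_mul, map_pow] at h2
    exact div_pow_eq_of_mul_eq hDK h2

end RationalityCriterion

section RationalForms

variable {k : Type} [Field k]

lemma eq_zero_of_dvd_of_isHomogeneous {σ : Type*} {f x : MvPolynomial σ k} {m n : ℕ}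
    (hf : f.IsHomogeneous m) (hx : x.IsHomogeneous n) (hnm : n < m) (h : f ∣ x) : x = 0 := by
  obtain ⟨y, rfl⟩ := h
  by_contra h0
  have h1 := totalDegree_mul_of_isDomain (left_ne_zero_of_mul h0) (right_ne_zero_of_mul h0)
  rw [hf.totalDegree (left_ne_zero_of_mul h0), hx.totalDegree h0] at h1
  omega

lemma dvd_of_aeval_eq_zero {f : PolyRing k 3} (hf : Prime f) {P : Fin (3 + 1) → PolyRing k 2}
    (δ : PolyRing k 2 →ₐ[k] PolyRing k 3) {c : PolyRing k 3} (hc : ¬ f ∣ c)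
    (h : ∀ i, f ∣ δ (P i) - X i * c) {F : PolyRing k 3} {n : ℕ} (hF : F.IsHomogeneous n)
    (h0 : aeval P F = 0) : f ∣ F := by
  let π := Ideal.Quotient.mkₐ k (Ideal.span {f})
  have hπ : ∀ x, π x = 0 ↔ f ∣ x := fun x =>
    Ideal.Quotient.eq_zero_iff_mem.trans Ideal.mem_span_singleton
  have h1 : ∀ i, π (δ (P i)) = π (X i) * π c := by
    intro i
    have := (hπ _).mpr (h i)
    rwa [map_sub, map_mul, sub_eq_zero] at this
  have h2 : π (δ (aeval P F)) = π F * π c ^ n := by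
    rw [← AlgHom.comp_apply, ← AlgHom.comp_apply, comp_aeval]
    simp only [AlgHom.comp_apply]
    simp only [h1]
    rw [aeval_mul_const_of_isHomogeneous hF]
    congr 1
    rw [← comp_aeval_apply, aeval_X_left_apply]
  rw [h0, map_zero, map_zero, ← map_pow, ← map_mul, eq_comm, hπ] at h2
  exact (hf.dvd_or_dvd h2).resolve_right fun h => hc (hf.dvd_of_dvd_pow h)

/-- A cubic of degree one in the last variable is rational. -/
lemma isRationalSurface_of_monoid {f : PolyRing k 3} (hf : Irreducible f)
    (hfd : f.IsHomogeneous 3) {H : Scheme} {ι : H ⟶ ProjSpace k 3} (hH : IsHypersurface f H ι)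
    {q r : PolyRing k 2} (hq0 : q ≠ 0) (hq : q.IsHomogeneous 2) (hr : r.IsHomogeneous 3)
    (hfqr : f = X 3 * rename Fin.castSucc q + rename Fin.castSucc r) :
    IsRationalSurface k (ι ≫ projStruct k 3) := by
  let P : Fin (3 + 1) → PolyRing k 2 := ![X 0 * q, X 1 * q, X 2 * q, -r]
  have hPc : ∀ j, P (Fin.castSucc j) = X j * q := by
    intro j; fin_cases j <;> rfl
  have hP : ∀ (F : PolyRing k 2) {n : ℕ}, F.IsHomogeneous n →
      aeval P (rename Fin.castSucc F) = F * q ^ n := by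
    intro F n hF
    rw [aeval_rename]
    have : P ∘ Fin.castSucc = fun j => X j * q := funext hPc
    rw [this, aeval_mul_const_of_isHomogeneous hF, aeval_X_left_apply]
  have hXq : ∀ j : Fin 3, (X j * q).IsHomogeneous 3 := fun j => (isHomogeneous_X k j).mul hq
  refine isRationalSurface_of_parametrization hf.ne_zero hfd hH (D := X 0 * q) (e := 3)
    (mul_ne_zero (X_ne_zero _) hq0) (by norm_num) (hXq 0) P ?_ rfl ?_ ?_
    (rename Fin.castSucc q) (l := 2) (hq.rename_isHomogeneous) ⟨3, ?_⟩ ?_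
  · intro i
    induction i using Fin.lastCases with
    | last => exact hr.neg
    | cast j => rw [hPc]; exact hXq j
  · rw [hfqr, map_add, map_mul, hP q hq, hP r hr, aeval_X]
    change -r * _ + _ = 0
    ring
  · intro n F hF h0
    refine dvd_of_aeval_eq_zero hf.prime (rename Fin.castSucc) (c := rename Fin.castSucc q)
      (fun h => ?_) (fun i => ?_) hF h0
    · have := eq_zero_of_dvd_of_isHomogeneous hfd hq.rename_isHomogeneous (by norm_num) h
      rw [← map_zero (rename Fin.castSucc)] at this
      exact hq0 (rename_injective _ (Fin.castSucc_injective 3) this)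
    · induction i using Fin.lastCases with
      | last =>
        refine ⟨-1, ?_⟩
        rw [hfqr]
        change rename Fin.castSucc (-r) - X 3 * _ = _
        rw [map_neg]
        ring
      | cast j => rw [hPc, map_mul, rename_X, sub_self]; exact dvd_zero _
  · rw [hP q hq]
    exact ⟨X 0 ^ 3, by ring⟩
  · intro n Q hQ
    refine ⟨n, n * 3, rename Fin.castSucc Q, hQ.rename_isHomogeneous, ?_⟩
    rw [hP Q hQ, hP q hq]
    ring

/-- Bihomogeneous polynomials in the two groups of variables `x_0, x_1` and `x_2, x_3`. -/
def IsBihomogeneous (F : PolyRing k 3) (m n : ℕ) : Prop :=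
  ∀ {A : Type} [CommRing A] [Algebra k A] (x y z w s t : A),
    aeval ![x * s, y * s, z * t, w * t] F = aeval ![x, y, z, w] F * s ^ m * t ^ n

lemma not_dvd_of_isBihomogeneous {f a b : PolyRing k 3} (hfd : f.IsHomogeneous 3)
    (ha0 : a ≠ 0) (hb0 : b ≠ 0) (ha : a.IsHomogeneous 3) (hab : IsBihomogeneous a 2 1)
    (hbb : IsBihomogeneous b 1 2) (hfab : f = a + b) : ¬ f ∣ a := by
  rintro ⟨u, hu⟩
  have hf0 : f ≠ 0 := by rintro rfl; exact ha0 (by simpa using hu)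
  have hu1 : u.IsHomogeneous 0 := isHomogeneous_right_of_mul (m := 3) (hu ▸ ha) hfd hf0
  obtain ⟨c, rfl⟩ : ∃ c, u = C c := ⟨_, totalDegree_eq_zero_iff_eq_C.mp (by
    by_cases h : u = 0
    · simp [h]
    · exact hu1.totalDegree h)⟩
  have hX : (X : Fin 4 → PolyRing k 3) = ![X 0, X 1, X 2, X 3] := by
    funext i; fin_cases i <;> rfl
  have e1 := hab (X 0 : PolyRing k 3) (X 1) (X 2) (X 3) 1 (X 0)
  have e2 := hbb (X 0 : PolyRing k 3) (X 1) (X 2) (X 3) 1 (X 0)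
  rw [← hX, aeval_X_left_apply] at e1 e2
  have e3 := congrArg (aeval ![X 0 * 1, X 1 * 1, X 2 * X 0, X 3 * (X 0 : PolyRing k 3)]) hu
  rw [hfab, map_mul, map_add, e1, e2, aeval_C] at e3
  rw [hfab] at hu
  have e4 : C c * (b * (X 0 * (X 0 - 1))) = 0 := by
    have h5 : (algebraMap k (PolyRing k 3)) c = C c := rfl
    rw [h5] at e3
    linear_combination (-1 : PolyRing k 3) * e3 + X 0 * hu
  have h6 : (X 0 - 1 : PolyRing k 3) ≠ 0 := by
    intro h
    have := congrArg (eval 0) h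
    simp at this
  have h7 : C c = (0 : PolyRing k 3) := by
    simpa [hb0, X_ne_zero, h6] using e4
  rw [h7, mul_zero] at hu
  exact ha0 hu

/-- A cubic which is the sum of nonzero forms of bidegrees `(2, 1)` and `(1, 2)` is rational. -/
lemma isRationalSurface_of_isBihomogeneous {f : PolyRing k 3} (hf : Irreducible f)
    (hfd : f.IsHomogeneous 3) {H : Scheme} {ι : H ⟶ ProjSpace k 3} (hH : IsHypersurface f H ι)
    {a b : PolyRing k 3} (ha0 : a ≠ 0) (hb0 : b ≠ 0) (ha : a.IsHomogeneous 3)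
    (hb : b.IsHomogeneous 3) (hab : IsBihomogeneous a 2 1) (hbb : IsBihomogeneous b 1 2)
    (hfab : f = a + b) :
    IsRationalSurface k (ι ≫ projStruct k 3) := by
  let v : Fin (3 + 1) → PolyRing k 2 := ![X 0, X 1, X 0, X 2]
  have hv : ∀ i, (v i).IsHomogeneous 1 := by
    intro i; fin_cases i <;> exact isHomogeneous_X _ _
  let a₀ := aeval v a
  let b₀ := aeval v b
  have ha₀ : a₀.IsHomogeneous 3 := ha.aeval v hv
  have hb₀ : b₀.IsHomogeneous 3 := hb.aeval v hv
  let u : Fin (2 + 1) → PolyRing k 3 := ![X 0 * X 2, X 1 * X 2, X 0 * X 3]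
  have hu : ∀ i, (u i).IsHomogeneous 2 := by
    intro i; fin_cases i <;> exact (isHomogeneous_X _ _).mul (isHomogeneous_X _ _)
  have hX : (![X 0, X 1, X 2, X 3] : Fin 4 → PolyRing k 3) = X := by
    funext i; fin_cases i <;> rfl
  have huv : (fun i => aeval u (v i)) =
      ![X 0 * X 2, X 1 * X 2, X 2 * X 0, X 3 * (X 0 : PolyRing k 3)] := by
    funext i; fin_cases i <;> simp [u, v] <;> ring
  have hua : aeval u a₀ = a * X 2 ^ 2 * X 0 ^ 1 := by
    rw [← AlgHom.comp_apply, comp_aeval, huv, hab, hX, aeval_X_left_apply]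
  have hub : aeval u b₀ = b * X 2 ^ 1 * X 0 ^ 2 := by
    rw [← AlgHom.comp_apply, comp_aeval, huv, hbb, hX, aeval_X_left_apply]
  have ha₀0 : a₀ ≠ 0 := by
    intro h
    rw [h, map_zero] at hua
    simp [ha0, X_ne_zero] at hua
  have hb₀0 : b₀ ≠ 0 := by
    intro h
    rw [h, map_zero] at hub
    simp [hb0, X_ne_zero] at hub
  let P : Fin (3 + 1) → PolyRing k 2 :=
    ![X 0 * (a₀ * b₀), X 1 * (a₀ * b₀), X 0 * -a₀ ^ 2, X 2 * -a₀ ^ 2]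
  have hPa : aeval P a = - (a₀ ^ 5 * b₀ ^ 2) := by
    rw [hab]
    change a₀ * _ * _ = _
    ring
  have hPb : aeval P b = a₀ ^ 5 * b₀ ^ 2 := by
    rw [hbb]
    change b₀ * _ * _ = _
    ring
  have hPu : ∀ (Q : PolyRing k 2) {n : ℕ}, Q.IsHomogeneous n →
      aeval P (aeval u Q) = Q * (-(X 0 * a₀ ^ 3 * b₀)) ^ n := by
    intro Q n hQ
    rw [← AlgHom.comp_apply, comp_aeval]
    have : (fun i => aeval P (u i)) = fun i => X i * (-(X 0 * a₀ ^ 3 * b₀)) := by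
      funext i; fin_cases i <;> simp [u, P] <;> ring
    rw [this, aeval_mul_const_of_isHomogeneous hQ, aeval_X_left_apply]
  have hab₀ : (a₀ * b₀).IsHomogeneous 6 := ha₀.mul hb₀
  have hna : ¬ f ∣ a := not_dvd_of_isBihomogeneous hfd ha0 hb0 ha hab hbb hfab
  have hnX : ∀ i, ¬ f ∣ X i := fun i h => X_ne_zero i
    (eq_zero_of_dvd_of_isHomogeneous hfd (isHomogeneous_X k i) (by norm_num) h)
  refine isRationalSurface_of_parametrization hf.ne_zero hfd hH (D := X 0 * (a₀ * b₀)) (e := 7)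
    (by simp [ha₀0, hb₀0, X_ne_zero]) (by norm_num) ((isHomogeneous_X k _).mul hab₀) P ?_ rfl
    ?_ ?_ (X 2 * (a * b)) (l := 7) ((isHomogeneous_X k _).mul (ha.mul hb)) ⟨12, ?_⟩ ?_
  · intro i
    fin_cases i
    · exact (isHomogeneous_X k _).mul hab₀
    · exact (isHomogeneous_X k _).mul hab₀
    · exact (isHomogeneous_X k _).mul (ha₀.pow 2).neg
    · exact (isHomogeneous_X k _).mul (ha₀.pow 2).neg
  · rw [hfab, map_add, hPa, hPb]
    ring
  · intro n F hF h0
    have hnb : ¬ f ∣ b := fun h => hna (by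
      have := dvd_sub_self_left.2 h
      rwa [hfab, add_sub_cancel_right, ← hfab] at this)
    refine dvd_of_aeval_eq_zero hf.prime (aeval u) (c := a * b * X 2 ^ 4 * X 0 ^ 3)
      (fun h => ?_) (fun i => ?_) hF h0
    · have hp := hf.prime
      rcases hp.dvd_or_dvd h with h | h
      · rcases hp.dvd_or_dvd h with h | h
        · exact (hp.dvd_or_dvd h).elim hna hnb
        · exact hnX _ (hp.dvd_of_dvd_pow h)
      · exact hnX _ (hp.dvd_of_dvd_pow h)
    · have hu0 : u 0 = X 0 * X 2 := rfl
      have hu1 : u 1 = X 1 * X 2 := rfl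
      have hu2 : u 2 = X 0 * X 3 := rfl
      fin_cases i
      · refine ⟨0, ?_⟩
        change aeval u (X 0 * (a₀ * b₀)) - X 0 * _ = _
        rw [map_mul, map_mul, hua, hub, aeval_X, hu0]
        ring
      · refine ⟨0, ?_⟩
        change aeval u (X 1 * (a₀ * b₀)) - X 1 * _ = _
        rw [map_mul, map_mul, hua, hub, aeval_X, hu1]
        ring
      · refine ⟨-(a * X 2 ^ 5 * X 0 ^ 3), ?_⟩
        change aeval u (X 0 * -a₀ ^ 2) - X 2 * _ = _
        rw [map_mul, map_neg, map_pow, hua, aeval_X, hu0, hfab]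
        ring
      · refine ⟨-(a * X 2 ^ 4 * X 0 ^ 3 * X 3), ?_⟩
        change aeval u (X 2 * -a₀ ^ 2) - X 3 * _ = _
        rw [map_mul, map_neg, map_pow, hua, aeval_X, hu2, hfab]
        ring
  · rw [map_mul, map_mul, hPa, hPb, aeval_X]
    refine ⟨b₀ ^ 8 * X 0 ^ 11, ?_⟩
    change (X 0 * (a₀ * b₀)) ^ 12 = (X 0 * -a₀ ^ 2) * _ * _
    ring
  · intro n Q hQ
    refine ⟨4 * n, 2 * (n * 7) + (3 + 3) * (3 * n), aeval u Q * (a * b) ^ (3 * n),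
      (hQ.aeval u hu).mul ((ha.mul hb).pow _), ?_⟩
    have hP2 : P 2 = X 0 * -a₀ ^ 2 := rfl
    rw [map_mul, map_mul, map_mul, map_pow, map_mul, hPu Q hQ, hPa, hPb, aeval_X, hP2]
    have h1 : (-(X 0 * a₀ ^ 3 * b₀)) ^ (n * 7) = (-(X 0 ^ 7 * a₀ ^ 21 * b₀ ^ 7)) ^ n := by
      rw [mul_comm n 7, pow_mul]; ring
    have h2 : (-(a₀ ^ 5 * b₀ ^ 2) * (a₀ ^ 5 * b₀ ^ 2)) ^ (3 * n) =
        (-(a₀ ^ 30 * b₀ ^ 12)) ^ n := by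
      rw [pow_mul]; ring
    have h3 : (X 0 * -a₀ ^ 2 * (-(a₀ ^ 5 * b₀ ^ 2) * (a₀ ^ 5 * b₀ ^ 2))) ^ (4 * n) =
        (X 0 ^ 4 * a₀ ^ 48 * b₀ ^ 16) ^ n := by
      rw [pow_mul]; ring
    have h4 : 2 * (n * 7) + (3 + 3) * (3 * n) = 32 * n := by ring
    have h5 : n + 7 * (4 * n) = 29 * n := by ring
    rw [h1, h2, h3, h4, h5, pow_mul, pow_mul, mul_assoc Q, ← mul_pow, ← mul_assoc, mul_assoc Q,
      ← mul_pow, mul_assoc Q, ← mul_pow]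
    refine congrArg (fun z => Q * z ^ n) ?_
    ring

end RationalForms

section Dimension

variable {k : Type*} [Field k]

/-- The ideal of polynomials vanishing at the origin. -/
abbrev originIdeal (k : Type*) [Field k] (m : ℕ) : Ideal (MvPolynomial (Fin m) k) :=
  RingHom.ker (aeval (R := k) (0 : Fin m → k))

instance (m : ℕ) : (originIdeal k m).IsPrime := RingHom.ker_isPrime _

lemma mem_originIdeal {m : ℕ} {p : MvPolynomial (Fin m) k} :
    p ∈ originIdeal k m ↔ constantCoeff p = 0 := by
  rw [RingHom.mem_ker]
  simp [aeval_zero]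

lemma le_originIdeal_height (m : ℕ) : (m : ℕ∞) ≤ (originIdeal k m).height := by
  let φ (j : ℕ) : MvPolynomial (Fin m) k →ₐ[k] MvPolynomial (Fin m) k :=
    aeval fun i => if i.1 < j then 0 else X i
  have hφ : ∀ j, (φ (j + 1)).comp (φ j) = φ (j + 1) := by
    intro j
    ext1 i
    simp only [φ, AlgHom.comp_apply, aeval_X]
    split_ifs <;> simp_all; omega
  have key : ∀ j, j ≤ m → (j : ℕ∞) ≤ (RingHom.ker (φ j)).height := by
    intro j
    induction j with
    | zero => simp
    | succ j ih =>
      intro hj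
      have hlt : RingHom.ker (φ j) < RingHom.ker (φ (j + 1)) := by
        refine lt_of_le_of_ne (fun x hx => ?_) fun h => ?_
        · rw [RingHom.mem_ker] at hx ⊢
          rw [← hφ, AlgHom.comp_apply, hx, map_zero]
        · have : (X ⟨j, hj⟩ : MvPolynomial (Fin m) k) ∈ RingHom.ker (φ (j + 1)) := by
            simp [φ]
          rw [← h] at this
          simp [φ, X_ne_zero] at this
      have h1 := Order.height_add_one_le (a := (⟨_, RingHom.ker_isPrime (φ j)⟩ : PrimeSpectrum _))
        (b := ⟨_, RingHom.ker_isPrime (φ (j + 1))⟩) hlt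
      rw [← PrimeSpectrum.height_eq_orderHeight, ← PrimeSpectrum.height_eq_orderHeight] at h1
      refine le_trans ?_ h1
      push_cast
      gcongr
      exact ih (by omega)
  refine (key m le_rfl).trans (Ideal.height_mono fun x hx => ?_)
  rw [RingHom.mem_ker] at hx ⊢
  have : (aeval (R := k) (0 : Fin m → k)).comp (φ m) = aeval (0 : Fin m → k) := by
    ext1 i
    simp [φ]
  rw [← this, AlgHom.comp_apply, hx, map_zero]

/-- Fewer equations than unknowns do not cut out the origin alone. -/
lemma exists_isPrime_lt_originIdeal {r m : ℕ} (hr : r < m)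
    (F : Fin r → MvPolynomial (Fin m) k) (hF : ∀ i, F i ∈ originIdeal k m) :
    ∃ 𝔭 : Ideal (MvPolynomial (Fin m) k), 𝔭.IsPrime ∧ (∀ i, F i ∈ 𝔭) ∧ 𝔭 < originIdeal k m := by
  have hle : Ideal.span (Set.range F) ≤ originIdeal k m := by
    rw [Ideal.span_le]
    rintro _ ⟨i, rfl⟩
    exact hF i
  obtain ⟨𝔭, h𝔭, hle'⟩ := Ideal.exists_minimalPrimes_le hle
  refine ⟨𝔭, h𝔭.1.1, fun i => h𝔭.1.2 (Ideal.subset_span ⟨i, rfl⟩), lt_of_le_of_ne hle' ?_⟩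
  rintro rfl
  have h1 := Ideal.height_le_card_of_mem_minimalPrimes_span (Set.finite_range F) h𝔭
  have h2 := (le_originIdeal_height (k := k) m).trans h1
  have h3 : (Set.range F).ncard ≤ r := by
    rw [← Set.image_univ]
    exact (Set.ncard_image_le Set.finite_univ).trans (by simp)
  have : m ≤ (Set.range F).ncard := by exact_mod_cast h2
  omega

lemma exists_common_zero_notMem [IsAlgClosed k] {σ : Type*} [Finite σ]
    {𝔭 : Ideal (MvPolynomial σ k)} [h𝔭 : 𝔭.IsPrime] {x : MvPolynomial σ k} (hx : x ∉ 𝔭) :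
    ∃ a : σ → k, (∀ p ∈ 𝔭, aeval a p = 0) ∧ aeval a x ≠ 0 := by
  by_contra! h
  refine hx ?_
  rw [← IsPrime.vanishingIdeal_zeroLocus (K := k) 𝔭]
  exact fun a ha => h a ha

lemma exists_common_zero [IsAlgClosed k] {σ : Type*} [Finite σ]
    {I : Ideal (MvPolynomial σ k)} (hI : I ≠ ⊤) :
    ∃ a : σ → k, ∀ p ∈ I, aeval a p = 0 := by
  obtain ⟨M, hM, hIM⟩ := I.exists_le_maximal hI
  obtain ⟨a, rfl⟩ := eq_vanishingIdeal_singleton_of_isMaximal k hM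
  exact ⟨a, fun p hp => (mem_vanishingIdeal_singleton_iff a p).1 (hIM hp)⟩

lemma exists_X_notMem_of_lt_originIdeal {m : ℕ} {𝔭 : Ideal (MvPolynomial (Fin m) k)}
    (h : 𝔭 < originIdeal k m) : ∃ i, X i ∉ 𝔭 := by
  by_contra! h0
  refine absurd h (not_lt_of_ge fun p hp => ?_)
  have h1 : Ideal.Quotient.mkₐ k 𝔭 = (Algebra.ofId k _).comp (aeval (0 : Fin m → k)) := by
    ext1 i
    simpa [Ideal.Quotient.eq_zero_iff_mem] using h0 i
  rw [← Ideal.Quotient.eq_zero_iff_mem, ← Ideal.Quotient.mkₐ_eq_mk k, h1, AlgHom.comp_apply,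
    RingHom.mem_ker.1 hp, map_zero]

lemma exists_ne_zero_common_zero [IsAlgClosed k] {r m : ℕ} (hr : r < m)
    (F : Fin r → MvPolynomial (Fin m) k) (hF : ∀ i, F i ∈ originIdeal k m) :
    ∃ a : Fin m → k, a ≠ 0 ∧ ∀ i, aeval a (F i) = 0 := by
  obtain ⟨𝔭, h𝔭, hF𝔭, hlt⟩ := exists_isPrime_lt_originIdeal hr F hF
  obtain ⟨i, hi⟩ := exists_X_notMem_of_lt_originIdeal hlt
  obtain ⟨a, ha, hai⟩ := exists_common_zero_notMem hi
  refine ⟨a, fun h => hai (by simp [h]), fun i => ha _ (hF𝔭 i)⟩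

end Dimension

section Line

/-- Restriction of a polynomial in four variables to the line spanned by `v` and `w`. -/
def lineEval {A : Type*} [CommRing A] (v w : Fin 4 → A) :
    MvPolynomial (Fin 4) A →ₐ[A] MvPolynomial (Fin 2) A :=
  aeval fun i => C (v i) * X 0 + C (w i) * X 1

lemma map_lineEval {A B : Type*} [CommRing A] [CommRing B] (φ : A →+* B) (v w : Fin 4 → A)
    (F : MvPolynomial (Fin 4) A) :
    map φ (lineEval v w F) = lineEval (φ ∘ v) (φ ∘ w) (map φ F) := by
  induction F using MvPolynomial.induction_on with
  | C a => simp [lineEval, algebraMap_eq]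
  | add p q hp hq => simp only [map_add, hp, hq]
  | mul_X p i hp => simp only [map_mul, hp]; simp [lineEval]

lemma lineEval_comb {A : Type*} [CommRing A] {v w : Fin 4 → A} {F : MvPolynomial (Fin 4) A}
    (h : lineEval v w F = 0) (α β γ δ : A) :
    lineEval (fun i => α * v i + β * w i) (fun i => γ * v i + δ * w i) F = 0 := by
  have : lineEval (fun i => α * v i + β * w i) (fun i => γ * v i + δ * w i) =
      (aeval ![C α * X 0 + C γ * X 1, C β * X 0 + C δ * X 1]).comp (lineEval v w) := by
    ext1 i
    simp [lineEval, algebraMap_eq]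
    ring
  rw [this, AlgHom.comp_apply, h, map_zero]

lemma isHomogeneous_lineEval {A : Type*} [CommRing A] (v w : Fin 4 → A)
    {F : MvPolynomial (Fin 4) A} {n : ℕ} (hF : F.IsHomogeneous n) :
    (lineEval v w F).IsHomogeneous n := by
  have := hF.aeval (n := 1) (fun i => (C (v i) * X 0 + C (w i) * X 1 : MvPolynomial (Fin 2) A))
    fun i => ((isHomogeneous_C_mul_X _ _).add (isHomogeneous_C_mul_X _ _))
  rwa [one_mul] at this

lemma exists_div_mem {L : Type*} [Field L] (V : ValuationSubring L) {n : ℕ} {u : Fin n → L}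
    (hu : u ≠ 0) : ∃ i, u i ≠ 0 ∧ ∀ j, u j / u i ∈ V := by
  obtain ⟨i₀, hi₀⟩ := Function.ne_iff.1 hu
  have : Nonempty (Fin n) := ⟨i₀⟩
  obtain ⟨i, hi⟩ := Finite.exists_max fun j => V.valuation (u j)
  have hui : u i ≠ 0 := by
    intro h
    have := hi i₀
    rw [h, map_zero, le_zero_iff, map_eq_zero] at this
    exact hi₀ this
  refine ⟨i, hui, fun j => ?_⟩
  rw [← V.valuation_le_one_iff, map_div₀]
  exact div_le_one_of_le₀ (hi j) zero_le

/-- A line over the fraction field of a valuation ring extends over the valuation ring. -/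
lemma exists_integral_line {L : Type*} [Field L] (V : ValuationSubring L) {v w : Fin 4 → L}
    (hv : v ≠ 0) (hw : ∀ c : L, w ≠ fun i => c * v i) {F : MvPolynomial (Fin 4) L}
    (h : lineEval v w F = 0) :
    ∃ (v' w' : Fin 4 → V) (i j : Fin 4), v' i = 1 ∧ v' j = 0 ∧ w' i = 0 ∧ w' j = 1 ∧
      lineEval (fun i => (v' i : L)) (fun i => (w' i : L)) F = 0 := by
  obtain ⟨i, hvi, hi⟩ := exists_div_mem V hv
  let w₁ : Fin 4 → L := fun j => w j - w i * (v j / v i)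
  have hw₁ : w₁ ≠ 0 := by
    intro h0
    refine hw (w i / v i) (funext fun j => ?_)
    have := congrFun h0 j
    simp only [w₁, Pi.zero_apply, sub_eq_zero] at this
    rw [this]
    ring
  obtain ⟨j, hwj, hj⟩ := exists_div_mem V hw₁
  have hwi : w₁ i = 0 := by simp [w₁, hvi]
  refine ⟨fun l => ⟨v l / v i, hi l⟩ - ⟨v j / v i, hi j⟩ * ⟨w₁ l / w₁ j, hj l⟩,
    fun l => ⟨w₁ l / w₁ j, hj l⟩, i, j, ?_, ?_, ?_, ?_, ?_⟩
  · ext; simp [hwi, hvi]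
  · ext; simp [hwj]
  · ext; simp [hwi]
  · ext; simp [hwj]
  · convert lineEval_comb h ((1 + v j / v i * w i / w₁ j) / v i) (- (v j / v i / w₁ j))
      (-(w i / v i / w₁ j)) (1 / w₁ j) using 2
    · congr 1 <;> funext l <;> simp only [w₁] at hwj ⊢ <;> push_cast <;> field_simp <;> ring

lemma exists_valuationSubring_notMem {k L : Type*} [Field k] [IsAlgClosed k] [Field L]
    [Algebra k L] {x : L} (hx : ∀ c : k, x ≠ algebraMap k L c) :
    ∃ V : ValuationSubring L, (∀ c : k, algebraMap k L c ∈ V) ∧ x ∉ V := by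
  let R : Subring L := (algebraMap k L).range
  have : IsIntegrallyClosedIn R L := by
    rw [Subring.isIntegrallyClosedIn_iff]
    intro y hy
    let : Algebra k R := (algebraMap k L).rangeRestrict.toAlgebra
    have : IsScalarTower k R L := IsScalarTower.of_algebraMap_eq fun _ => rfl
    have : Algebra.IsIntegral k R :=
      Algebra.isIntegral_of_surjective (algebraMap k L).rangeRestrict_surjective
    have hyk : IsIntegral k y := isIntegral_trans y hy
    have := minpoly.irreducible hyk
    exact minpoly.mem_range_of_degree_eq_one k y
      (IsAlgClosed.degree_eq_one_of_irreducible k this)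
  obtain ⟨V, hV, hxV⟩ := Subring.exists_le_valuationSubring_of_isIntegrallyClosedIn
    (R := R) (x := x) (by rintro ⟨c, rfl⟩; exact hx c rfl)
  exact ⟨V, fun c => hV ⟨c, rfl⟩, hxV⟩

/-- A line defined over an extension field specializes to a line over an algebraically closed
ground field. -/
lemma exists_line_of_field {k κ : Type*} [Field k] [IsAlgClosed k] [Field κ] [Algebra k κ]
    {f : MvPolynomial (Fin 4) k} {v w : Fin 4 → κ} {i j : Fin 4} (hvi : v i = 1) (hvj : v j = 0)
    (hwi : w i = 0) (hwj : w j = 1) (h : lineEval v w (map (algebraMap k κ) f) = 0) :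
    ∃ v' w' : Fin 4 → k, v' i = 1 ∧ v' j = 0 ∧ w' i = 0 ∧ w' j = 1 ∧ lineEval v' w' f = 0 := by
  let φ : MvPolynomial (Fin 4 ⊕ Fin 4) k →ₐ[k] κ := aeval (Sum.elim v w)
  obtain ⟨a, ha⟩ := exists_common_zero (k := k) (I := RingHom.ker φ) (RingHom.ker_ne_top _)
  have hX : ∀ s c, φ (X s) = algebraMap k κ c → a s = c := by
    intro s c hs
    have := ha (X s - C c) (by rw [RingHom.mem_ker, map_sub, hs]; simp [φ])
    simpa [sub_eq_zero] using this
  refine ⟨a ∘ Sum.inl, a ∘ Sum.inr, hX _ 1 (by simp [φ, hvi]), hX _ 0 (by simp [φ, hvj]),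
    hX _ 0 (by simp [φ, hwi]), hX _ 1 (by simp [φ, hwj]), ?_⟩
  let G := lineEval (fun i => (X (Sum.inl i) : MvPolynomial (Fin 4 ⊕ Fin 4) k))
    (fun i => X (Sum.inr i)) (map C f)
  have hG : map φ.toRingHom G = 0 := by
    rw [map_lineEval, map_map]
    convert h using 2
    · congr 1 <;> funext i <;> simp [φ]
    · rw [show φ.toRingHom.comp C = algebraMap k κ by ext; simp [φ]]
  have hG' : map (aeval a : _ →ₐ[k] k).toRingHom G = 0 := by
    ext d
    rw [coeff_map, coeff_zero]
    refine ha _ ?_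
    have := congrArg (coeff d) hG
    rwa [coeff_map, coeff_zero] at this
  rw [map_lineEval, map_map] at hG'
  convert hG' using 2
  · congr 1 <;> funext i <;> simp
  · rw [show ((aeval a : _ →ₐ[k] k).toRingHom.comp C) = RingHom.id k by ext; simp, map_id]

/-- The exponents of the binary cubic monomials. -/
def cubicExp (i : Fin 4) : Fin 2 →₀ ℕ :=
  Finsupp.single 0 (3 - (i : ℕ)) + Finsupp.single 1 (i : ℕ)

lemma monomial_cubicExp {A : Type*} [CommRing A] (i : Fin 4) (c : A) :
    monomial (cubicExp i) c = C c * X 0 ^ (3 - (i : ℕ)) * X 1 ^ (i : ℕ) := by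
  rw [cubicExp, monomial_add_single, C_mul_X_pow_eq_monomial]

lemma cubicExp_injective : Function.Injective cubicExp := by
  intro i j h
  have := DFunLike.congr_fun h 1
  simpa [cubicExp, Fin.val_inj] using this

lemma eq_zero_of_coeff_cubicExp {A : Type*} [CommRing A] {G : MvPolynomial (Fin 2) A}
    (hG : G.IsHomogeneous 3) (h : ∀ i, coeff (cubicExp i) G = 0) : G = 0 := by
  ext d
  by_contra hd
  rw [coeff_zero] at hd
  have h3 := hG hd
  rw [Finsupp.weight_apply, Finsupp.sum_fintype _ _ (by simp)] at h3
  simp only [Fin.sum_univ_two, Pi.one_apply, smul_eq_mul, mul_one] at h3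
  refine hd ?_
  have : d = cubicExp ⟨d 1, by omega⟩ := by
    ext i
    fin_cases i
    · simp [cubicExp]; omega
    · simp [cubicExp]
  rw [this, h]

/-- Every cubic surface over an algebraically closed field contains a line. -/
lemma exists_line {k : Type*} [Field k] [IsAlgClosed k] {f : MvPolynomial (Fin 4) k}
    (hf : f.IsHomogeneous 3) :
    ∃ (v w : Fin 4 → k) (i j : Fin 4), v i = 1 ∧ v j = 0 ∧ w i = 0 ∧ w j = 1 ∧
      lineEval v w f = 0 := by
  let R := MvPolynomial (Fin 5) k
  let v : Fin 4 → R := ![1, 0, X 0, X 2]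
  let w : Fin 4 → R := ![0, 1, X 1, X 3]
  let F := lineEval v w (map C f)
  have hF : F.IsHomogeneous 3 := isHomogeneous_lineEval _ _ (hf.map _)
  let f₀ : MvPolynomial (Fin 4) k := X 2 * X 0 ^ 2 + X 3 * X 1 ^ 2
  let F₀ := lineEval v w (map C f₀)
  have hF₀ : F₀ = ∑ i : Fin 4, monomial (cubicExp i) (X i.castSucc) := by
    simp only [monomial_cubicExp, Fin.sum_univ_four]
    simp [F₀, f₀, lineEval, v, w]
    ring
  have hF₀h : F₀.IsHomogeneous 3 := by
    refine isHomogeneous_lineEval _ _ (IsHomogeneous.map ?_ _)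
    exact ((isHomogeneous_X _ _).mul ((isHomogeneous_X _ _).pow 2)).add
      ((isHomogeneous_X _ _).mul ((isHomogeneous_X _ _).pow 2))
  have hF₀c : ∀ i, coeff (cubicExp i) F₀ = X i.castSucc := by
    intro i
    simp [hF₀, coeff_sum, coeff_monomial, cubicExp_injective.eq_iff]
  let E : Fin 4 → R := fun i => X i.castSucc + X 4 * coeff (cubicExp i) F
  obtain ⟨𝔭, h𝔭, hE, hlt⟩ := exists_isPrime_lt_originIdeal (by norm_num) E
    (fun i => by rw [mem_originIdeal]; simp [E])
  have hs : X 4 ∉ 𝔭 := by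
    intro hs
    obtain ⟨i, hi⟩ := exists_X_notMem_of_lt_originIdeal hlt
    refine hi ?_
    induction i using Fin.lastCases with
    | last => exact hs
    | cast i => exact (Ideal.add_mem_iff_left _ (𝔭.mul_mem_right _ hs)).1 (hE i)
  let L := FractionRing (R ⧸ 𝔭)
  let π : R →+* L := (algebraMap (R ⧸ 𝔭) L).comp (Ideal.Quotient.mk 𝔭)
  have hπ : ∀ x, π x = 0 ↔ x ∈ 𝔭 := fun x => by
    simp [π, Ideal.Quotient.eq_zero_iff_mem]
  let : Algebra k L := (π.comp C).toAlgebra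
  have hx : ∀ c : k, π (X 4) ≠ algebraMap k L c := by
    intro c hc
    have h1 : X 4 - C c ∈ 𝔭 := by
      rw [← hπ, map_sub, hc]
      simp [RingHom.algebraMap_toAlgebra]
    have h2 := hlt.le h1
    rw [mem_originIdeal] at h2
    have : c = 0 := by simpa using h2
    rw [this, C_0, sub_zero] at h1
    exact hs h1
  obtain ⟨V, hkV, hxV⟩ := exists_valuationSubring_notMem hx
  have hline : lineEval (π ∘ v) (π ∘ w)
      (map (algebraMap k L) f + C (π (X 4))⁻¹ * map (algebraMap k L) f₀) = 0 := by
    have h1 : map π (C (X 4) * F + F₀) = 0 := by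
      refine eq_zero_of_coeff_cubicExp ?_ fun i => ?_
      · have := ((isHomogeneous_C (Fin 2) (X 4 : R)).mul hF).add hF₀h
        exact this.map π
      · rw [coeff_map, coeff_add, coeff_C_mul, hF₀c, hπ, add_comm]
        exact hE i
    have hx0 : π (X 4) ≠ 0 := fun h => hs ((hπ _).1 h)
    have hπC : π.comp C = algebraMap k L := rfl
    rw [map_add, map_mul, map_C, map_lineEval, map_lineEval, map_map, map_map, hπC] at h1
    have h2 := congrArg (C (π (X 4))⁻¹ * ·) h1
    simp only [mul_add, mul_zero, ← mul_assoc, ← C_mul, inv_mul_cancel₀ hx0, C_1, one_mul] at h2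
    rw [map_add, map_mul, lineEval, aeval_C, algebraMap_eq]
    exact h2
  obtain ⟨v', w', i, j, hvi, hvj, hwi, hwj, h0⟩ := exists_integral_line V
    (fun h => by simpa [v] using congrFun h 0)
    (fun c h => by
      have h1 : c = 0 := by simpa [v, w, eq_comm] using congrFun h 0
      simpa [v, w, h1] using congrFun h 1) hline
  obtain ⟨ε, hε⟩ := V.mem_nonunits_iff_exists_mem_maximalIdeal.1
    (V.inv_mem_nonunits_iff.2 (Or.inr hxV))
  let ψ : k →+* V := (algebraMap k L).codRestrict V hkV
  have hψ : V.subtype.comp ψ = algebraMap k L := rfl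
  have h1 : lineEval v' w' (map ψ f + C ⟨_, ε⟩ * map ψ f₀) = 0 := by
    refine map_injective V.subtype Subtype.val_injective ?_
    rw [map_lineEval, map_zero, map_add, map_mul, map_C, map_map, map_map, hψ]
    exact h0
  let : Algebra k (IsLocalRing.ResidueField V) := ((IsLocalRing.residue V).comp ψ).toAlgebra
  have h2 := congrArg (map (IsLocalRing.residue V)) h1
  rw [map_lineEval, map_zero, map_add, map_mul, map_C, map_map, map_map,
    (IsLocalRing.residue_eq_zero_iff _).2 hε, C_0, zero_mul, add_zero] at h2
  obtain ⟨v₁, w₁, h⟩ := exists_line_of_field (i := i) (j := j) (by simp [hvi]) (by simp [hvj])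
    (by simp [hwi]) (by simp [hwj]) h2
  exact ⟨v₁, w₁, i, j, h⟩

end Line

section Singular

lemma derivation_aeval {k B σ : Type*} [Field k] [CommRing B] [Algebra k B] [Fintype σ]
    (D : Derivation k B B) (P : σ → B) (F : MvPolynomial σ k) :
    D (aeval P F) = ∑ j, aeval P (pderiv j F) * D (P j) := by
  classical
  induction F using MvPolynomial.induction_on with
  | C a => simp
  | add p q hp hq => simp only [map_add, hp, hq, add_mul, Finset.sum_add_distrib]
  | mul_X p i hp =>
    rw [map_mul, aeval_X, D.leibniz, hp]
    simp only [Derivation.leibniz, pderiv_X, smul_eq_mul, map_add, map_mul, aeval_X, add_mul,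
      Finset.sum_add_distrib, Finset.mul_sum]
    congr 1
    · rw [Finset.sum_eq_single i (fun j _ hj => by simp [Pi.single_eq_of_ne' hj]) (by simp)]
      simp
    · exact Finset.sum_congr rfl fun j _ => by ring

lemma aeval_single_one {k σ : Type*} [Field k] [Fintype σ] [DecidableEq σ] {G : MvPolynomial σ k}
    {n : ℕ} (hG : G.IsHomogeneous n) (j : σ) :
    aeval (Pi.single j (1 : k)) G = coeff (Finsupp.single j n) G := by
  have hmon : ∀ d ∈ G.support, coeff d G * ∏ i, (Pi.single j (1 : k) : σ → k) i ^ d i =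
      if d = Finsupp.single j n then coeff d G else 0 := by
    intro d hd
    split_ifs with h
    · subst h
      rw [Finset.prod_eq_one, mul_one]
      intro i _
      by_cases hij : i = j
      · subst hij; simp
      · simp [Finsupp.single_eq_of_ne hij]
    · have h1 := hG (mem_support_iff.1 hd)
      rw [Finsupp.weight_apply, Finsupp.sum_fintype _ _ (by simp)] at h1
      simp only [Pi.one_apply, smul_eq_mul, mul_one] at h1
      obtain ⟨i, hij, hdi⟩ : ∃ i, i ≠ j ∧ d i ≠ 0 := by
        by_contra! h0
        refine h (Finsupp.ext fun i => ?_)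
        by_cases hij : i = j
        · subst hij
          rw [Finset.sum_eq_single i (fun l _ hl => h0 l hl) (by simp)] at h1
          simp [h1]
        · rw [h0 i hij, Finsupp.single_eq_of_ne hij]
      rw [Finset.prod_eq_zero (Finset.mem_univ i), mul_zero]
      simp [hij, hdi]
  rw [aeval_eq_eval, eval_eq', Finset.sum_congr rfl hmon, Finset.sum_ite_eq']
  split_ifs with h
  · rfl
  · exact (notMem_support_iff.1 h).symm

/-- The point `a` is a zero of `f` and of all its partial derivatives. -/
def IsSingularAt {k σ : Type*} [Field k] (f : MvPolynomial σ k) (a : σ → k) : Prop :=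
  aeval a f = 0 ∧ ∀ i, aeval a (pderiv i f) = 0

/-- The affine cone over the hypersurface of `f` has no singular point outside the origin. -/
def IsSmoothForm {k σ : Type*} [Field k] (f : MvPolynomial σ k) : Prop :=
  ∀ a, IsSingularAt f a → a = 0

lemma IsSingularAt.of_bind₁ {k : Type*} [Field k] {σ τ : Type*} [Fintype σ] {f : MvPolynomial σ k}
    {L : σ → MvPolynomial τ k} {a : τ → k} (h : IsSingularAt f fun i => aeval a (L i)) :
    IsSingularAt (bind₁ L f) a := by
  refine ⟨?_, fun i => ?_⟩
  · rw [aeval_bind₁]; exact h.1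
  · rw [bind₁, derivation_aeval, map_sum]
    refine Finset.sum_eq_zero fun j _ => ?_
    rw [map_mul, ← bind₁, aeval_bind₁, h.2, zero_mul]

lemma coeff_eq_zero_of_isSingularAt {k : Type*} [Field k] {n m : ℕ} {j : Fin n}
    {F : MvPolynomial (Fin n) k} (hF : F.IsHomogeneous (m + 1))
    (h : IsSingularAt F (Pi.single j 1)) {d : Fin n →₀ ℕ} (hd : m ≤ d j) : coeff d F = 0 := by
  by_contra h0
  have h1 := hF h0
  rw [Finsupp.weight_apply, Finsupp.sum_fintype _ _ (by simp)] at h1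
  simp only [Pi.one_apply, smul_eq_mul, mul_one] at h1
  rw [← Finset.add_sum_erase _ _ (Finset.mem_univ j)] at h1
  rcases hd.eq_or_lt with hd | hd
  · have h2 : ∑ x ∈ Finset.univ.erase j, d x = 1 := by omega
    obtain ⟨i, hi, hi0⟩ := Finset.exists_ne_zero_of_sum_ne_zero (h2.trans_ne one_ne_zero)
    rw [← Finset.add_sum_erase _ _ hi] at h2
    have hdi : d i = 1 := by omega
    have h3 : ∑ x ∈ (Finset.univ.erase j).erase i, d x = 0 := by omega
    have hdl : ∀ l ∈ Finset.univ.erase j, l ≠ i → d l = 0 := fun l hl hli =>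
      Finset.sum_eq_zero_iff.1 h3 l (Finset.mem_erase.2 ⟨hli, hl⟩)
    have hij : i ≠ j := (Finset.mem_erase.1 hi).1
    have hd' : d = Finsupp.single j m + Finsupp.single i 1 := by
      ext l
      by_cases hl : l = j
      · subst hl; simp [hd, Finsupp.single_eq_of_ne hij.symm]
      · by_cases hli : l = i
        · subst hli; simp [hdi, Finsupp.single_eq_of_ne hij]
        · rw [hdl l (Finset.mem_erase.2 ⟨hl, Finset.mem_univ _⟩) hli]
          simp [Finsupp.single_eq_of_ne hl, Finsupp.single_eq_of_ne hli]
    have h3 := h.2 i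
    rw [aeval_single_one hF.pderiv, Nat.add_sub_cancel, coeff_pderiv, ← hd'] at h3
    simp [Finsupp.single_eq_of_ne hij, h0] at h3
  · have hd' : d = Finsupp.single j (m + 1) := by
      have h2 : ∑ x ∈ Finset.univ.erase j, d x = 0 := by omega
      ext l
      by_cases hl : l = j
      · subst hl; simp; omega
      · rw [Finsupp.single_eq_of_ne hl]
        exact Finset.sum_eq_zero_iff.1 h2 l (Finset.mem_erase.2 ⟨hl, Finset.mem_univ _⟩)
    have h3 := h.1
    rw [aeval_single_one hF, ← hd'] at h3
    exact h0 h3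

end Singular

section SingularCubics

variable {k : Type} [Field k]

/-- Every surface realizing `V(f)` is rational. -/
def IsRationalForm (f : PolyRing k 3) : Prop :=
  ∀ (H : Scheme) (ι : H ⟶ ProjSpace k 3), IsHypersurface f H ι →
    IsRationalSurface k (ι ≫ projStruct k 3)

lemma IsRationalForm.of_bind₁ {L L' : Fin (3 + 1) → PolyRing k 3} (h : LinChange L L')
    {f : PolyRing k 3} (hf : IsRationalForm (bind₁ L f)) : IsRationalForm f := by
  intro H ι hH
  rw [← h.symm.bind_bind f] at hH
  have h1 := hf _ _ (hH.comp_linIso h.symm)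
  rwa [Category.assoc, linIso, linProj_projStruct] at h1

lemma LinChange.irreducible {n : ℕ} {L L' : Fin (n + 1) → PolyRing k n} (h : LinChange L L')
    {f : PolyRing k n} (hf : Irreducible f) : Irreducible (bind₁ L f) := by
  let e : PolyRing k n ≃ₐ[k] PolyRing k n := AlgEquiv.ofAlgHom (bind₁ L) (bind₁ L')
    (AlgHom.ext h.bind_bind) (AlgHom.ext h.symm.bind_bind)
  exact (MulEquiv.irreducible_iff e.toMulEquiv).2 hf

lemma not_X_dvd {n : ℕ} {f : PolyRing k n} {m : ℕ} (hf : Irreducible f)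
    (hfd : f.IsHomogeneous m) (hm : m ≠ 1) (i : Fin (n + 1)) : ¬ X i ∣ f := by
  intro h
  have h1 : Associated (X i) f := (X_prime (R := k) (i := i)).irreducible.associated_of_dvd hf h
  obtain ⟨c, hc, rfl⟩ := exists_C_mul_of_associated h1
  exact hm (hfd.inj_right (isHomogeneous_C_mul_X c i) hf.ne_zero)

lemma exists_rename_castSucc {n : ℕ} {p : MvPolynomial (Fin (n + 1)) k}
    (h : ∀ d ∈ p.support, d (Fin.last n) = 0) :
    ∃ q : MvPolynomial (Fin n) k, rename Fin.castSucc q = p := by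
  refine exists_rename_eq_of_vars_subset_range p Fin.castSucc (Fin.castSucc_injective n) ?_
  intro i hi
  obtain ⟨d, hd, hid⟩ := (mem_vars_iff_mem_support _).1 hi
  induction i using Fin.lastCases with
  | last => exact absurd (h d hd) (by simpa using hid)
  | cast i => exact ⟨i, rfl⟩

lemma exists_monoid_form {n m : ℕ} {F : MvPolynomial (Fin (n + 1)) k}
    (hF : F.IsHomogeneous (m + 1)) (h : ∀ d ∈ F.support, d (Fin.last n) ≤ 1) :
    ∃ q r : MvPolynomial (Fin n) k, q.IsHomogeneous m ∧ r.IsHomogeneous (m + 1) ∧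
      F = X (Fin.last n) * rename Fin.castSucc q + rename Fin.castSucc r := by
  have hq : ∀ d, coeff d (F.divMonomial (Finsupp.single (Fin.last n) 1)) =
      coeff (Finsupp.single (Fin.last n) 1 + d) F := fun d => coeff_divMonomial _ _ _
  have hr : ∀ d, coeff d (F.modMonomial (Finsupp.single (Fin.last n) 1)) ≠ 0 →
      d (Fin.last n) = 0 ∧ coeff d F ≠ 0 := by
    intro d hd
    by_cases hle : Finsupp.single (Fin.last n) 1 ≤ d
    · exact absurd (coeff_modMonomial_of_le _ hle) hd
    · rw [coeff_modMonomial_of_not_le _ hle] at hd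
      rw [Finsupp.single_le_iff] at hle
      exact ⟨by omega, hd⟩
  obtain ⟨q, hq'⟩ := exists_rename_castSucc
    (p := F.divMonomial (Finsupp.single (Fin.last n) 1)) (by
      intro d hd
      rw [mem_support_iff, hq] at hd
      have := h _ (mem_support_iff.2 hd)
      simpa using this)
  obtain ⟨r, hr'⟩ := exists_rename_castSucc
    (p := F.modMonomial (Finsupp.single (Fin.last n) 1)) (by
      intro d hd
      exact (hr d (mem_support_iff.1 hd)).1)
  refine ⟨q, r, ?_, ?_, ?_⟩
  · rw [← IsHomogeneous.rename_isHomogeneous_iff (Fin.castSucc_injective n), hq']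
    intro d hd
    rw [hq] at hd
    have := hF hd
    rw [map_add, Finsupp.weight_single] at this
    simp only [Pi.one_apply, smul_eq_mul, mul_one] at this
    omega
  · rw [← IsHomogeneous.rename_isHomogeneous_iff (Fin.castSucc_injective n), hr']
    exact fun d hd => hF (hr d hd).2
  · rw [hq', hr', divMonomial_add_modMonomial_single]

lemma le_one_of_isSingularAt {n : ℕ} {j : Fin n} {F : MvPolynomial (Fin n) k}
    (hF : F.IsHomogeneous 3) (h : IsSingularAt F (Pi.single j 1)) :
    ∀ d ∈ F.support, d j ≤ 1 := by
  intro d hd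
  by_contra! h2
  exact mem_support_iff.1 hd (coeff_eq_zero_of_isSingularAt hF h h2)

lemma aeval_toMvPolynomial_single {m : Type*} [Fintype m] [DecidableEq m] (M : Matrix m m k)
    (i j : m) : aeval (Pi.single j 1 : m → k) (M.toMvPolynomial i) = M i j := by
  rw [_root_.aeval_toMvPolynomial, Finset.sum_eq_single j (fun l _ hl => by simp [hl]) (by simp)]
  simp

lemma IsSingularAt.exists_linChange {f : PolyRing k 3} (hf : Irreducible f)
    (hfd : f.IsHomogeneous 3) {a : Fin (3 + 1) → k} (ha : a ≠ 0) (h : IsSingularAt f a) :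
    IsRationalForm f ∨ ∃ (L L' : Fin (3 + 1) → PolyRing k 3) (C : PolyRing k 2),
      LinChange L L' ∧ C.IsHomogeneous 3 ∧ bind₁ L f = rename Fin.castSucc C := by
  obtain ⟨M, hM, hMa⟩ := exists_matrix_of_linearIndependent (k := k)
    (⟨fun _ : Fin 1 => (3 : Fin (3 + 1)), Function.injective_of_subsingleton _⟩)
    (v := fun _ => a) (linearIndependent_unique_iff.2 ha)
  have hL := linChange_toMvPolynomial hM
  have hs : IsSingularAt (bind₁ M.toMvPolynomial f) (Pi.single 3 1) := by
    refine IsSingularAt.of_bind₁ ?_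
    simp only [aeval_toMvPolynomial_single]
    convert h using 1
    exact funext fun j => hMa 0 j
  have hFd := isHomogeneous_bind₁_one hL.hom hfd
  obtain ⟨q, r, hq, hr, hqr⟩ := exists_monoid_form hFd (le_one_of_isSingularAt hFd hs)
  by_cases hq0 : q = 0
  · right
    refine ⟨_, _, r, hL, hr, ?_⟩
    rw [hqr, hq0]
    simp
  · left
    refine IsRationalForm.of_bind₁ hL fun H ι hH => ?_
    exact isRationalSurface_of_monoid (hL.irreducible hf) hFd hH hq0 hq hr hqr

lemma aeval_mem_supported {σ τ : Type*} {s : Set τ} {P : σ → MvPolynomial τ k}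
    (hP : ∀ i, P i ∈ supported k s) (F : MvPolynomial σ k) : aeval P F ∈ supported k s := by
  induction F using MvPolynomial.induction_on with
  | C a => simpa [algebraMap_eq] using (supported k s).algebraMap_mem a
  | add p q hp hq => rw [map_add]; exact add_mem hp hq
  | mul_X p i hp => rw [map_mul, aeval_X]; exact mul_mem hp (hP i)

lemma eq_zero_of_mem_supported {σ : Type*} {s : Set σ} {F : MvPolynomial σ k}
    (hF : F ∈ supported k s) {d : σ →₀ ℕ} (hd : d ∈ F.support) {i : σ} (hi : i ∉ s) :
    d i = 0 := by
  by_contra h0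
  exact hi (mem_supported.1 hF ((mem_vars_iff_mem_support _).2 ⟨d, hd, by simpa using h0⟩))

lemma toMvPolynomial_mem_supported {m : Type*} [Fintype m] [DecidableEq m] {M : Matrix m m k}
    {i : m} {s : Set m} (h : ∀ j ∉ s, M i j = 0) : M.toMvPolynomial i ∈ supported k s := by
  classical
  rw [Matrix.toMvPolynomial]
  refine sum_mem fun j _ => ?_
  by_cases hj : j ∈ s
  · rw [← C_mul_X_eq_monomial]
    exact mul_mem ((supported k s).algebraMap_mem _) (X_mem_supported.2 hj)
  · rw [h j hj, monomial_zero]; exact zero_mem _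

lemma aeval_mem_supported_of_mem {σ τ : Type*} {s : Set σ} {t : Set τ}
    {P : σ → MvPolynomial τ k} (hP : ∀ i ∈ s, P i ∈ supported k t) {F : MvPolynomial σ k}
    (hF : F ∈ supported k s) : aeval P F ∈ supported k t := by
  rw [supported_eq_range_rename] at hF
  obtain ⟨G, rfl⟩ := hF
  change aeval P (rename _ G) ∈ _
  rw [aeval_rename]
  exact aeval_mem_supported (fun i : s => hP i i.2) G

lemma constantCoeff_of_isHomogeneous {σ : Type*} {F : MvPolynomial σ k} {n : ℕ}
    (hF : F.IsHomogeneous n) (hn : n ≠ 0) : constantCoeff F = 0 := by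
  rw [constantCoeff_eq]
  by_contra h
  have := hF h
  simp at this
  exact hn this.symm

lemma not_mem_supported_pair [IsAlgClosed k] {F : PolyRing k 3} (hF : Irreducible F)
    (hFd : F.IsHomogeneous 3) : F ∉ supported k ({0, 1} : Set (Fin (3 + 1))) := by
  intro hs
  obtain ⟨a, ha, h0⟩ := exists_ne_zero_common_zero (k := k) (r := 1) (m := 2) (by norm_num)
    (fun _ => aeval ![X 0, X 1, 0, 0] F) (fun _ => by
      rw [mem_originIdeal]
      have := hFd.aeval (n := 1) (![X 0, X 1, 0, 0] : Fin (3 + 1) → MvPolynomial (Fin 2) k) (by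
        intro i
        fin_cases i
        · exact isHomogeneous_X _ _
        · exact isHomogeneous_X _ _
        · exact isHomogeneous_zero _ _ _
        · exact isHomogeneous_zero _ _ _)
      exact constantCoeff_of_isHomogeneous this (by norm_num))
  have h1 : aeval ![a 0, a 1, 0, 0] F = 0 := by
    refine Eq.trans ?_ (h0 0)
    rw [← AlgHom.comp_apply]
    refine congrArg (fun φ : PolyRing k 3 →ₐ[k] k => φ F) ?_
    ext i
    fin_cases i <;> simp
  obtain ⟨M, hM, hMv⟩ := exists_matrix_of_linearIndependent (k := k)
    (⟨(![0, 2, 3] : Fin 3 → Fin (3 + 1)), by decide⟩)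
    (v := ![![a 0, a 1, 0, 0], Pi.single 2 1, Pi.single 3 1]) (by
      rw [Fintype.linearIndependent_iff]
      intro c hc
      have h2 : c 1 = 0 := by simpa [Fin.sum_univ_three] using congrFun hc 2
      have h3 : c 2 = 0 := by simpa [Fin.sum_univ_three] using congrFun hc 3
      have h0 : c 0 = 0 := by
        by_contra hc0
        refine ha (funext fun i => ?_)
        fin_cases i
        · simpa [Fin.sum_univ_three, h2, h3, hc0] using congrFun hc 0
        · simpa [Fin.sum_univ_three, h2, h3, hc0] using congrFun hc 1
      intro i
      fin_cases i
      · exact h0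
      · exact h2
      · exact h3)
  have hL := linChange_toMvPolynomial hM
  have hFd' := isHomogeneous_bind₁_one hL.hom hFd
  have hM2 : ∀ j, M j 2 = (Pi.single 2 1 : Fin (3 + 1) → k) j := fun j => hMv 1 j
  have hM3 : ∀ j, M j 3 = (Pi.single 3 1 : Fin (3 + 1) → k) j := fun j => hMv 2 j
  have hs' : bind₁ M.toMvPolynomial F ∈ supported k ({0, 1} : Set (Fin (3 + 1))) := by
    refine aeval_mem_supported_of_mem (fun i hi => toMvPolynomial_mem_supported fun j hj => ?_) hs
    rcases hi with rfl | rfl <;> fin_cases j <;> simp_all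
  refine not_X_dvd (hL.irreducible hF) hFd' (by norm_num) 1 ?_
  rw [← Ideal.mem_span_singleton, ← Set.image_singleton, mem_ideal_span_X_image]
  intro d hd
  refine ⟨1, rfl, fun h1d => ?_⟩
  have hd2 := eq_zero_of_mem_supported hs' hd (i := 2) (by simp)
  have hd3 := eq_zero_of_mem_supported hs' hd (i := 3) (by simp)
  have hdeg := hFd' (mem_support_iff.1 hd)
  rw [Finsupp.weight_apply, Finsupp.sum_fintype _ _ (by simp), Fin.sum_univ_four] at hdeg
  simp [h1d, hd2, hd3] at hdeg
  have hd' : d = Finsupp.single 0 3 := by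
    ext i
    fin_cases i <;> simp [hdeg, h1d, hd2, hd3]
  rw [hd', mem_support_iff, ← aeval_single_one hFd', aeval_bind₁] at hd
  simp only [aeval_toMvPolynomial_single] at hd
  refine hd ?_
  convert h1 using 2
  exact congrArg _ (funext fun j => hMv 0 j)

lemma isRationalForm_of_rename [IsAlgClosed k] {C : PolyRing k 2}
    (hf : Irreducible (rename Fin.castSucc C : PolyRing k 3)) (hC : C.IsHomogeneous 3)
    {a : Fin (2 + 1) → k} (ha : a ≠ 0) (h : IsSingularAt C a) :
    IsRationalForm (rename Fin.castSucc C) := by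
  have hfd : (rename Fin.castSucc C : PolyRing k 3).IsHomogeneous 3 :=
    hC.rename_isHomogeneous
  obtain ⟨M, hM, hMv⟩ := exists_matrix_of_linearIndependent (k := k)
    (⟨(![2, 3] : Fin 2 → Fin (3 + 1)), by decide⟩)
    (v := ![Pi.single 3 1, Fin.snoc a 0]) (by
      rw [LinearIndependent.pair_iff]
      intro s t hst
      have hs : s = 0 := by simpa [Fin.snoc] using congrFun hst 3
      refine ⟨hs, ?_⟩
      by_contra ht
      refine ha (funext fun i => ?_)
      have := congrFun hst i.castSucc
      simpa [hs, ht] using this)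
  have hL := linChange_toMvPolynomial hM
  have hM2 : ∀ j, M j 2 = (Pi.single 3 1 : Fin (3 + 1) → k) j := fun j => hMv 0 j
  have hM3 : ∀ j : Fin 3, M j.castSucc 3 = a j := fun j => by
    simpa using hMv 1 j.castSucc
  have hbind : bind₁ M.toMvPolynomial (rename Fin.castSucc C) =
      bind₁ (fun i : Fin 3 => M.toMvPolynomial i.castSucc) C := by
    rw [bind₁_rename]; rfl
  have hs' : bind₁ M.toMvPolynomial (rename Fin.castSucc C) ∈
      supported k ({0, 1, 3} : Set (Fin (3 + 1))) := by
    rw [hbind]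
    refine aeval_mem_supported (fun i => toMvPolynomial_mem_supported fun j hj => ?_) C
    have : j = 2 := by fin_cases j <;> simp_all
    rw [this, hM2]
    exact Pi.single_eq_of_ne (Fin.castSucc_lt_last i).ne _
  have hsing : IsSingularAt (bind₁ M.toMvPolynomial (rename Fin.castSucc C)) (Pi.single 3 1) := by
    rw [hbind]
    refine IsSingularAt.of_bind₁ ?_
    simp only [aeval_toMvPolynomial_single, hM3]
    exact h
  have hFd := isHomogeneous_bind₁_one hL.hom hfd
  have hle := le_one_of_isSingularAt hFd hsing
  obtain ⟨q, r, hq, hr, hqr⟩ := exists_monoid_form hFd hle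
  refine IsRationalForm.of_bind₁ hL fun H ι hH => ?_
  refine isRationalSurface_of_monoid (hL.irreducible hf) hFd hH ?_ hq hr hqr
  rintro rfl
  rw [map_zero, mul_zero, zero_add] at hqr
  refine not_mem_supported_pair (hL.irreducible hf) hFd ?_
  rw [mem_supported]
  intro i hi
  have h1 := mem_supported.1 hs' hi
  have h2 : i ≠ 3 := by
    rintro rfl
    rw [hqr, Finset.mem_coe] at hi
    obtain ⟨j, -, hj⟩ := Finset.mem_image.1 (vars_rename _ _ hi)
    exact (Fin.castSucc_lt_last j).ne hj
  simpa [h2] using h1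

end SingularCubics

section SmoothCubics

variable {k : Type} [Field k]

lemma IsSmoothForm.comp_linChange {n : ℕ} {L L' : Fin (n + 1) → PolyRing k n} (h : LinChange L L')
    {f : PolyRing k n} (hf : IsSmoothForm f) : IsSmoothForm (bind₁ L f) := by
  intro a ha
  have hba : ∀ i, aeval (fun j => aeval a (L j)) (L' i) = a i := fun i => by
    rw [← aeval_bind₁, h.bind_left, aeval_X]
  have h1 : IsSingularAt f fun i => aeval a (L i) := by
    rw [← h.symm.bind_bind f]
    refine IsSingularAt.of_bind₁ ?_
    simp only [hba]
    exact ha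
  funext i
  rw [← hba i, hf _ h1, aeval_zero, constantCoeff_of_isHomogeneous (h.hom' i) one_ne_zero]
  simp

lemma mem_span_of_aeval_eq_zero {σ : Type*} {I : Ideal (MvPolynomial σ k)}
    {P : σ → MvPolynomial σ k} (hP : ∀ i, P i - X i ∈ I) {F : MvPolynomial σ k}
    (hF : aeval P F = 0) : F ∈ I := by
  have h : (Ideal.Quotient.mkₐ k I).comp (aeval P) = Ideal.Quotient.mkₐ k I := by
    ext i
    simpa using Ideal.Quotient.eq.2 (hP i)
  have h1 := DFunLike.congr_fun h F
  rw [AlgHom.comp_apply, hF, map_zero] at h1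
  exact Ideal.Quotient.eq_zero_iff_mem.1 h1.symm

lemma mem_span_X_pair {s : Set (Fin (3 + 1))} {F : PolyRing k 3}
    {P : Fin (3 + 1) → PolyRing k 3} (hP : ∀ i, i ∈ s ∧ P i = 0 ∨ P i = X i)
    (hF : aeval P F = 0) : F ∈ Ideal.span (X '' s) := by
  refine mem_span_of_aeval_eq_zero (P := P) (fun i => ?_) hF
  rcases hP i with ⟨hi, h⟩ | h
  · rw [h, zero_sub, neg_mem_iff]
    exact Ideal.subset_span ⟨i, hi, rfl⟩
  · rw [h, sub_self]; exact zero_mem _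

lemma isSingularAt_of_le_one {n : ℕ} {j : Fin n} {F : MvPolynomial (Fin n) k}
    (hF : F.IsHomogeneous 3) (h : ∀ d ∈ F.support, d j ≤ 1) :
    IsSingularAt F (Pi.single j 1) := by
  have h0 : ∀ d : Fin n →₀ ℕ, 2 ≤ d j → coeff d F = 0 := by
    intro d hd
    by_contra hc
    have := h d (mem_support_iff.2 hc)
    omega
  refine ⟨?_, fun i => ?_⟩
  · rw [aeval_single_one hF, h0]
    simp
  · rw [aeval_single_one hF.pderiv, coeff_pderiv, h0, zero_mul]
    simp

lemma isBihomogeneous_of_support {m n : ℕ} {F : PolyRing k 3}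
    (h : ∀ d ∈ F.support, d 0 + d 1 = m ∧ d 2 + d 3 = n) : IsBihomogeneous F m n := by
  intro A _ _ x y z w s t
  simp only [aeval_def, eval₂_eq', Finset.sum_mul]
  refine Finset.sum_congr rfl fun d hd => ?_
  obtain ⟨h1, h2⟩ := h d hd
  rw [Fin.prod_univ_four, Fin.prod_univ_four, ← h1, ← h2]
  simp only [Matrix.cons_val_zero, Matrix.cons_val_one, Matrix.cons_val]
  ring

lemma isRationalForm_of_skew_lines {F : PolyRing k 3} (hF : Irreducible F)
    (hFd : F.IsHomogeneous 3) (hs : IsSmoothForm F)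
    (h01 : F ∈ Ideal.span (X '' ({0, 1} : Set (Fin (3 + 1)))))
    (h23 : F ∈ Ideal.span (X '' ({2, 3} : Set (Fin (3 + 1))))) : IsRationalForm F := by
  classical
  rw [mem_ideal_span_X_image] at h01 h23
  have hd : ∀ d ∈ F.support, (d 0 + d 1 = 2 ∧ d 2 + d 3 = 1) ∨ (d 0 + d 1 = 1 ∧ d 2 + d 3 = 2) := by
    intro d hd
    have h1 : d 0 ≠ 0 ∨ d 1 ≠ 0 := by simpa using h01 d hd
    have h2 : d 2 ≠ 0 ∨ d 3 ≠ 0 := by simpa using h23 d hd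
    have hdeg := hFd (mem_support_iff.1 hd)
    rw [Finsupp.weight_apply, Finsupp.sum_fintype _ _ (by simp), Fin.sum_univ_four] at hdeg
    simp only [Pi.one_apply, smul_eq_mul, mul_one] at hdeg
    omega
  let part (p : (Fin (3 + 1) →₀ ℕ) → Prop) : PolyRing k 3 :=
    ∑ d ∈ F.support with p d, monomial d (coeff d F)
  have hpart : ∀ p d, coeff d (part p) = if p d then coeff d F else 0 := by
    intro p d
    simp only [part, coeff_sum, coeff_monomial]
    rw [Finset.sum_ite_eq']
    by_cases hp : p d <;> simp [hp]
    exact fun h => h.symm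
  have hpd : ∀ p, (part p).IsHomogeneous 3 := by
    intro p d hd
    rw [hpart] at hd
    exact hFd fun h0 => hd (by simp [h0])
  have hsupp : ∀ p, ∀ d ∈ (part p).support, p d ∧ d ∈ F.support := by
    intro p d hd
    rw [mem_support_iff, hpart] at hd
    by_cases hp : p d
    · exact ⟨hp, by simpa [hp] using hd⟩
    · simp [hp] at hd
  have hsum : F = part (fun d => d 0 + d 1 = 2) + part (fun d => d 0 + d 1 = 1) := by
    ext d
    rw [coeff_add, hpart, hpart]
    by_cases h0 : coeff d F = 0
    · simp [h0]
    · rcases hd d (mem_support_iff.2 h0) with h | h <;> simp [h]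
  have ha2 : ∀ d ∈ (part (fun d => d 0 + d 1 = 2)).support, d 0 + d 1 = 2 ∧ d 2 + d 3 = 1 := by
    intro d hdp
    obtain ⟨h1, h2⟩ := hsupp _ d hdp
    have := hd d h2
    omega
  have hb2 : ∀ d ∈ (part (fun d => d 0 + d 1 = 1)).support, d 0 + d 1 = 1 ∧ d 2 + d 3 = 2 := by
    intro d hdp
    obtain ⟨h1, h2⟩ := hsupp _ d hdp
    have := hd d h2
    omega
  have hsing : ∀ j, ¬ ∀ d ∈ F.support, d j ≤ 1 := by
    intro j hj
    have := congrFun (hs _ (isSingularAt_of_le_one hFd hj)) j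
    simp at this
  intro H ι hH
  refine isRationalSurface_of_isBihomogeneous hF hFd hH ?_ ?_ (hpd _) (hpd _)
    (isBihomogeneous_of_support ha2) (isBihomogeneous_of_support hb2) hsum
  · intro h0
    rw [h0, zero_add] at hsum
    refine hsing 0 fun d hdF => ?_
    rw [hsum] at hdF
    have := hb2 d hdF
    omega
  · intro h0
    rw [h0, add_zero] at hsum
    refine hsing 2 fun d hdF => ?_
    rw [hsum] at hdF
    have := ha2 d hdF
    omega

lemma exists_X_mul_add_X_mul {n m : ℕ} {i j : Fin (n + 1)} {F : PolyRing k n}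
    (hF : F.IsHomogeneous (m + 1)) (h : F ∈ Ideal.span (X '' ({i, j} : Set (Fin (n + 1))))) :
    ∃ A B : PolyRing k n, A.IsHomogeneous m ∧ B.IsHomogeneous m ∧ F = X i * A + X j * B := by
  rw [Set.image_pair, Ideal.mem_span_pair] at h
  obtain ⟨a, b, hab⟩ := h
  refine ⟨homogeneousComponent m a, homogeneousComponent m b,
    homogeneousComponent_isHomogeneous _ _, homogeneousComponent_isHomogeneous _ _, ?_⟩
  have h1 : F = (gradeHom (Fin (n + 1)) k F).coeff (m + 1) := by
    rw [gradeHom_of_isHomogeneous hF]; simp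
  have hX : ∀ l, gradeHom (Fin (n + 1)) k (X l) = Polynomial.C (X l) * Polynomial.X := fun l => by
    rw [gradeHom, aeval_X]
  rw [h1, ← hab, map_add, map_mul, map_mul, hX, hX, Polynomial.coeff_add, ← mul_assoc, ← mul_assoc,
    Polynomial.coeff_mul_X, Polynomial.coeff_mul_X, Polynomial.coeff_mul_C, Polynomial.coeff_mul_C,
    coeff_gradeHom, coeff_gradeHom]
  ring

end SmoothCubics

section SecondLine

variable {k : Type} [Field k]

lemma lineEval_zero {A : Type*} [CommRing A] {F : MvPolynomial (Fin 4) A} {n : ℕ}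
    (hF : F.IsHomogeneous n) (hn : n ≠ 0) : lineEval (0 : Fin 4 → A) 0 F = 0 := by
  have h : lineEval (0 : Fin 4 → A) 0 = aeval (0 : Fin 4 → MvPolynomial (Fin 2) A) := by
    ext1 i
    simp [lineEval]
  have h0 : constantCoeff F = 0 := by
    rw [constantCoeff_eq]
    by_contra h
    have := hF h
    simp at this
    exact hn this.symm
  rw [h, aeval_zero, h0, map_zero]

lemma eval_lineEval {A : Type*} [CommRing A] (v w : Fin 4 → A) (F : MvPolynomial (Fin 4) A)
    (s t : A) : aeval ![s, t] (lineEval v w F) = aeval (fun i => s * v i + t * w i) F := by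
  rw [← AlgHom.comp_apply]
  refine congrArg (fun φ : MvPolynomial (Fin 4) A →ₐ[A] A => φ F) ?_
  ext i
  simp [lineEval, mul_comm]

lemma exists_second_line [IsAlgClosed k] {A B : PolyRing k 3} (hA : A.IsHomogeneous 2)
    (hB : B.IsHomogeneous 2) : ∃ a : Fin 5 → k, a ≠ 0 ∧
      X 0 * lineEval ![a 0, 0, a 1, a 3] ![0, a 0, a 2, a 4] A +
        X 1 * lineEval ![a 0, 0, a 1, a 3] ![0, a 0, a 2, a 4] B = 0 := by
  let v : Fin 4 → MvPolynomial (Fin 5) k := ![X 0, 0, X 1, X 3]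
  let w : Fin 4 → MvPolynomial (Fin 5) k := ![0, X 0, X 2, X 4]
  let G : MvPolynomial (Fin 2) (MvPolynomial (Fin 5) k) :=
    X 0 * lineEval v w (map C A) + X 1 * lineEval v w (map C B)
  have hmap : ∀ a : Fin 5 → k, map (eval a) G =
      X 0 * lineEval ![a 0, 0, a 1, a 3] ![0, a 0, a 2, a 4] A +
        X 1 * lineEval ![a 0, 0, a 1, a 3] ![0, a 0, a 2, a 4] B := by
    intro a
    have hC : (eval a).comp C = RingHom.id k := by ext; simp
    have hv : (eval a) ∘ v = ![a 0, 0, a 1, a 3] := by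
      funext i; fin_cases i <;> simp [v]
    have hw : (eval a) ∘ w = ![0, a 0, a 2, a 4] := by
      funext i; fin_cases i <;> simp [w]
    simp only [G, map_add, map_mul, map_X, map_lineEval, map_map, hC, map_id, hv, hw]
  have hhom : ∀ a : Fin 5 → k, (map (eval a) G).IsHomogeneous 3 := by
    intro a
    rw [hmap]
    exact ((isHomogeneous_X _ _).mul (isHomogeneous_lineEval _ _ hA)).add
      ((isHomogeneous_X _ _).mul (isHomogeneous_lineEval _ _ hB))
  obtain ⟨a, ha, h⟩ := exists_ne_zero_common_zero (k := k) (r := 4) (m := 5) (by norm_num)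
    (fun i => coeff (cubicExp i) G) (fun i => by
      have h0 : map (eval (0 : Fin 5 → k)) G = 0 := by
        have hz : ![(0 : k), 0, 0, 0] = 0 := by ext i; fin_cases i <;> rfl
        rw [hmap]
        simp only [Pi.zero_apply, hz, lineEval_zero hA two_ne_zero, lineEval_zero hB two_ne_zero,
          mul_zero, add_zero]
      rw [mem_originIdeal, ← eval_zero, ← coeff_map, h0, coeff_zero])
  refine ⟨a, ha, ?_⟩
  rw [← hmap]
  refine eq_zero_of_coeff_cubicExp (hhom a) fun i => ?_
  rw [coeff_map]
  exact h i

/-- If the second line degenerates, the surface is singular at a point of the first line. -/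
lemma ne_zero_of_isSmoothForm [IsAlgClosed k] {F A B : PolyRing k 3} (hA : A.IsHomogeneous 2)
    (hB : B.IsHomogeneous 2) (hF : F = X 0 * A + X 1 * B) (hs : IsSmoothForm F)
    {x p₀ q₀ p₁ q₁ : k} (h0 : x ≠ 0 ∨ p₀ ≠ 0 ∨ q₀ ≠ 0 ∨ p₁ ≠ 0 ∨ q₁ ≠ 0)
    (h : X 0 * lineEval ![x, 0, p₀, p₁] ![0, x, q₀, q₁] A +
        X 1 * lineEval ![x, 0, p₀, p₁] ![0, x, q₀, q₁] B = 0) : x ≠ 0 := by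
  rintro rfl
  have hAB : ∀ r₀ r₁ : k, aeval ![0, 0, r₀, r₁] A = 0 → aeval ![0, 0, r₀, r₁] B = 0 →
      r₀ = 0 ∧ r₁ = 0 := by
    intro r₀ r₁ h1 h2
    have hsing : IsSingularAt F ![0, 0, r₀, r₁] := by
      rw [hF]
      rw [aeval_eq_eval] at h1 h2
      refine ⟨by simp, fun i => ?_⟩
      fin_cases i <;> simp [Derivation.leibniz, pderiv_X, h1, h2]
    have := hs _ hsing
    exact ⟨congrFun this 2, congrFun this 3⟩
  have hst : ∀ s t : k, s * aeval ![0, 0, s * p₀ + t * q₀, s * p₁ + t * q₁] A +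
      t * aeval ![0, 0, s * p₀ + t * q₀, s * p₁ + t * q₁] B = 0 := by
    intro s t
    have h1 := congrArg (aeval ![s, t]) h
    have hv : (fun i => s * (![0, 0, p₀, p₁] : Fin 4 → k) i + t * (![0, 0, q₀, q₁] : Fin 4 → k) i) =
        ![0, 0, s * p₀ + t * q₀, s * p₁ + t * q₁] := by
      funext i; fin_cases i <;> simp
    rw [map_add, map_mul, map_mul, eval_lineEval, eval_lineEval, hv, aeval_X, aeval_X,
      map_zero] at h1
    exact h1
  by_cases hD : p₀ * q₁ = p₁ * q₀
  · have hp : aeval ![0, 0, p₀, p₁] A = 0 := by simpa using hst 1 0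
    have hq : aeval ![0, 0, q₀, q₁] B = 0 := by simpa using hst 0 1
    have hpq : aeval ![0, 0, p₀ + q₀, p₁ + q₁] A + aeval ![0, 0, p₀ + q₀, p₁ + q₁] B = 0 := by
      simpa using hst 1 1
    by_cases hp0 : p₀ = 0 ∧ p₁ = 0
    · obtain ⟨rfl, rfl⟩ := hp0
      rw [zero_add, zero_add, hq, add_zero] at hpq
      obtain ⟨rfl, rfl⟩ := hAB _ _ hpq hq
      simp at h0
    by_cases hq0 : q₀ = 0 ∧ q₁ = 0
    · obtain ⟨rfl, rfl⟩ := hq0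
      rw [add_zero, add_zero, hp, zero_add] at hpq
      exact hp0 (hAB _ _ hp hpq)
    obtain ⟨c, hc0, hc1⟩ : ∃ c, q₀ = p₀ * c ∧ q₁ = p₁ * c := by
      by_cases h0 : p₀ = 0
      · have h1 : p₁ ≠ 0 := fun h1 => hp0 ⟨h0, h1⟩
        refine ⟨q₁ / p₁, ?_, by field_simp⟩
        rw [h0, zero_mul] at hD ⊢
        simpa [h1] using hD.symm
      · exact ⟨q₀ / p₀, by field_simp, by field_simp; linear_combination hD⟩
    have hc : c ≠ 0 := by
      rintro rfl
      exact hq0 ⟨by simpa using hc0, by simpa using hc1⟩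
    have h1 := aeval_mul_const_of_isHomogeneous hB (![0, 0, p₀, p₁] : Fin 4 → k) c
    have hv : (fun i => (![0, 0, p₀, p₁] : Fin 4 → k) i * c) = ![0, 0, q₀, q₁] := by
      rw [hc0, hc1]
      funext i; fin_cases i <;> simp
    rw [hv, hq] at h1
    exact hp0 (hAB _ _ hp (by simpa [hc] using h1.symm))
  · have hX : ¬ (X 1 : MvPolynomial (Fin 2) k) ∣ X 0 := by
      rw [X_dvd_X]
      simp
    obtain ⟨l, hl⟩ : X 1 ∣ lineEval ![0, 0, p₀, p₁] ![0, 0, q₀, q₁] A := by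
      refine ((X_prime (R := k) (i := (1 : Fin 2))).dvd_or_dvd ?_).resolve_left hX
      exact ⟨-lineEval ![0, 0, p₀, p₁] ![0, 0, q₀, q₁] B, by linear_combination h⟩
    have hl' : lineEval ![0, 0, p₀, p₁] ![0, 0, q₀, q₁] B = -(X 0 * l) := by
      refine mul_left_cancel₀ (X_ne_zero (R := k) (1 : Fin 2)) ?_
      rw [hl] at h
      linear_combination h
    have hl1 : l.IsHomogeneous 1 := isHomogeneous_right_of_mul (m := 1) (n := 1)
      (hl ▸ isHomogeneous_lineEval _ _ hA) (isHomogeneous_X _ _) (X_ne_zero _)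
    obtain ⟨a, ha, hal⟩ := exists_ne_zero_common_zero (k := k) (r := 1) (m := 2) (by norm_num)
      (fun _ => l) (fun _ => mem_originIdeal.2 (constantCoeff_of_isHomogeneous hl1 one_ne_zero))
    have hv : (fun i => a 0 * (![0, 0, p₀, p₁] : Fin 4 → k) i +
        a 1 * (![0, 0, q₀, q₁] : Fin 4 → k) i) =
        ![0, 0, a 0 * p₀ + a 1 * q₀, a 0 * p₁ + a 1 * q₁] := by
      funext i; fin_cases i <;> simp
    have ha' : ![a 0, a 1] = a := by ext i; fin_cases i <;> rfl
    have h1 : aeval ![0, 0, a 0 * p₀ + a 1 * q₀, a 0 * p₁ + a 1 * q₁] A = 0 := by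
      rw [← hv, ← eval_lineEval, hl, map_mul, ha', hal 0, mul_zero]
    have h2 : aeval ![0, 0, a 0 * p₀ + a 1 * q₀, a 0 * p₁ + a 1 * q₁] B = 0 := by
      rw [← hv, ← eval_lineEval, hl', map_neg, map_mul, ha', hal 0, mul_zero, neg_zero]
    obtain ⟨h3, h4⟩ := hAB _ _ h1 h2
    refine ha (funext fun i => ?_)
    have hD' := sub_ne_zero.2 hD
    fin_cases i
    · refine (mul_eq_zero.1 ?_).resolve_right hD'
      change a 0 * _ = 0
      linear_combination q₁ * h3 - q₀ * h4
    · refine (mul_eq_zero.1 ?_).resolve_right hD'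
      change a 1 * _ = 0
      linear_combination p₀ * h4 - p₁ * h3

/-- A smooth cubic surface over an algebraically closed field is rational. -/
lemma IsSmoothForm.isRationalForm [IsAlgClosed k] {f : PolyRing k 3} (hf : Irreducible f)
    (hfd : f.IsHomogeneous 3) (hs : IsSmoothForm f) : IsRationalForm f := by
  obtain ⟨v, w, i, j, hvi, hvj, hwi, hwj, hvw⟩ := exists_line hfd
  obtain ⟨M, hM, hMv⟩ := exists_matrix_of_linearIndependent (k := k)
    (⟨(![2, 3] : Fin 2 → Fin (3 + 1)), by decide⟩) (v := ![v, w]) (by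
      rw [LinearIndependent.pair_iff]
      intro s t hst
      exact ⟨by simpa [hvi, hwi] using congrFun hst i, by simpa [hvj, hwj] using congrFun hst j⟩)
  have hL := linChange_toMvPolynomial hM
  have hFd := isHomogeneous_bind₁_one hL.hom hfd
  have hFs := hs.comp_linChange hL
  have hFi := hL.irreducible hf
  refine IsRationalForm.of_bind₁ hL ?_
  have hspan : bind₁ M.toMvPolynomial f ∈ Ideal.span (X '' ({0, 1} : Set (Fin (3 + 1)))) := by
    refine mem_span_X_pair (P := ![0, 0, X 2, X 3]) (fun i => by fin_cases i <;> simp) ?_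
    have h1 : aeval (![0, 0, X 2, X 3] : Fin (3 + 1) → PolyRing k 3)
        (bind₁ M.toMvPolynomial f) = rename ![2, 3] (lineEval v w f) := by
      rw [aeval_bind₁, ← AlgHom.comp_apply]
      refine congrArg (fun φ : PolyRing k 3 →ₐ[k] PolyRing k 3 => φ f) ?_
      ext1 i
      have h2 : M i 2 = v i := hMv 0 i
      have h3 : M i 3 = w i := hMv 1 i
      rw [aeval_X, _root_.aeval_toMvPolynomial, Fin.sum_univ_four]
      simp [lineEval, h2, h3, algebraMap_eq]
    rw [h1, hvw, map_zero]
  obtain ⟨A, B, hA, hB, hAB⟩ := exists_X_mul_add_X_mul hFd hspan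
  obtain ⟨a, ha, hline⟩ := exists_second_line hA hB
  have ha0 : a 0 ≠ 0 := by
    refine ne_zero_of_isSmoothForm hA hB hAB hFs ?_ hline
    contrapose! ha
    funext i
    fin_cases i <;> simp [ha]
  obtain ⟨N, hN, hNv⟩ := exists_matrix_of_linearIndependent (k := k)
    (Function.Embedding.refl (Fin (3 + 1)))
    (v := ![![a 0, 0, a 1, a 3], ![0, a 0, a 2, a 4], Pi.single 2 1, Pi.single 3 1]) (by
      rw [Fintype.linearIndependent_iff]
      intro c hc
      have h0 : c 0 = 0 := by simpa [Fin.sum_univ_four, ha0] using congrFun hc 0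
      have h1 : c 1 = 0 := by simpa [Fin.sum_univ_four, ha0] using congrFun hc 1
      have h2 : c 2 = 0 := by simpa [Fin.sum_univ_four, h0, h1] using congrFun hc 2
      have h3 : c 3 = 0 := by simpa [Fin.sum_univ_four, h0, h1] using congrFun hc 3
      intro i
      fin_cases i
      exacts [h0, h1, h2, h3])
  have hL' := linChange_toMvPolynomial hN
  refine IsRationalForm.of_bind₁ hL' ?_
  have hN0 : ∀ i, N i 0 = (![a 0, 0, a 1, a 3] : Fin 4 → k) i := hNv 0
  have hN1 : ∀ i, N i 1 = (![0, a 0, a 2, a 4] : Fin 4 → k) i := hNv 1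
  have hN2 : ∀ i, N i 2 = (Pi.single 2 1 : Fin 4 → k) i := hNv 2
  have hN3 : ∀ i, N i 3 = (Pi.single 3 1 : Fin 4 → k) i := hNv 3
  refine isRationalForm_of_skew_lines (hL'.irreducible hFi)
    (isHomogeneous_bind₁_one hL'.hom hFd) (hFs.comp_linChange hL') ?_ ?_
  · refine mem_span_X_pair (P := ![0, 0, X 2, X 3]) (fun i => by fin_cases i <;> simp) ?_
    have hP : (fun i => aeval (![0, 0, X 2, X 3] : Fin 4 → PolyRing k 3) (N.toMvPolynomial i)) =
        ![0, 0, X 2, X 3] := by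
      funext i
      rw [_root_.aeval_toMvPolynomial, Fin.sum_univ_four, hN2, hN3]
      fin_cases i <;> simp
    rw [aeval_bind₁, hP, hAB]
    simp
  · refine mem_span_X_pair (P := ![X 0, X 1, 0, 0]) (fun i => by fin_cases i <;> simp) ?_
    have h1 : (fun i => aeval (![X 0, X 1, 0, 0] : Fin 4 → PolyRing k 3) (N.toMvPolynomial i)) =
        fun i => rename ![0, 1] (C ((![a 0, 0, a 1, a 3] : Fin 4 → k) i) * X 0 +
          C ((![0, a 0, a 2, a 4] : Fin 4 → k) i) * X 1 : MvPolynomial (Fin 2) k) := by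
      funext i
      rw [_root_.aeval_toMvPolynomial, Fin.sum_univ_four, hN0, hN1]
      simp [algebraMap_eq]
    have h2 : ∀ G : PolyRing k 3, aeval (fun i => rename ![0, 1]
        (C ((![a 0, 0, a 1, a 3] : Fin 4 → k) i) * X 0 +
          C ((![0, a 0, a 2, a 4] : Fin 4 → k) i) * X 1 : MvPolynomial (Fin 2) k)) G =
        (rename ![0, 1] (lineEval ![a 0, 0, a 1, a 3] ![0, a 0, a 2, a 4] G) : PolyRing k 3) := by
      intro G
      rw [lineEval, ← AlgHom.comp_apply]
      refine congrArg (fun φ : PolyRing k 3 →ₐ[k] PolyRing k 3 => φ G) ?_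
      ext1 i
      simp
    rw [aeval_bind₁, h1, h2, hAB, map_add, map_mul, map_mul]
    have h3 : ∀ i, lineEval (![a 0, 0, a 1, a 3] : Fin 4 → k) ![0, a 0, a 2, a 4] (X i) =
        C ((![a 0, 0, a 1, a 3] : Fin 4 → k) i) * X 0 +
          C ((![0, a 0, a 2, a 4] : Fin 4 → k) i) * X 1 := by
      intro i; simp [lineEval]
    have h4 : lineEval ![a 0, 0, a 1, a 3] ![0, a 0, a 2, a 4] (X 0) *
          lineEval ![a 0, 0, a 1, a 3] ![0, a 0, a 2, a 4] A +
        lineEval ![a 0, 0, a 1, a 3] ![0, a 0, a 2, a 4] (X 1) *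
          lineEval ![a 0, 0, a 1, a 3] ![0, a 0, a 2, a 4] B = 0 := by
      rw [h3, h3]
      simp only [Matrix.cons_val_zero, Matrix.cons_val_one, map_zero, zero_mul, add_zero, zero_add]
      linear_combination C (a 0) * hline
    rw [h4, map_zero]

/-- An irreducible cubic surface is rational or a cone over a smooth plane cubic. -/
lemma isRationalForm_or_exists_smooth_cone [IsAlgClosed k] {f : PolyRing k 3} (hf : Irreducible f)
    (hfd : f.IsHomogeneous 3) :
    IsRationalForm f ∨ ∃ (L L' : Fin (3 + 1) → PolyRing k 3) (C : PolyRing k 2),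
      LinChange L L' ∧ C.IsHomogeneous 3 ∧ IsSmoothForm C ∧ bind₁ L f = rename Fin.castSucc C := by
  by_cases hs : IsSmoothForm f
  · exact Or.inl (hs.isRationalForm hf hfd)
  · simp only [IsSmoothForm, not_forall] at hs
    obtain ⟨a, ha, ha0⟩ := hs
    rcases ha.exists_linChange hf hfd ha0 with h | ⟨L, L', C, hL, hC, hfC⟩
    · exact Or.inl h
    · by_cases hCs : IsSmoothForm C
      · exact Or.inr ⟨L, L', C, hL, hC, hCs, hfC⟩
      · left
        simp only [IsSmoothForm, not_forall] at hCs
        obtain ⟨b, hb, hb0⟩ := hCs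
        refine IsRationalForm.of_bind₁ hL ?_
        rw [hfC]
        exact isRationalForm_of_rename (hfC ▸ hL.irreducible hf) hC hb0 hb

end SecondLine

section TripleProduct

variable {A : Type*} [CommRing A]

/-- The determinant of three vectors of length three. -/
def det3 (u v w : Fin 3 → A) : A :=
  u 0 * (v 1 * w 2 - v 2 * w 1) - u 1 * (v 0 * w 2 - v 2 * w 0) + u 2 * (v 0 * w 1 - v 1 * w 0)

/-- The cross product. -/
def cross3 (u v : Fin 3 → A) (i : Fin 3) : A := u (i + 1) * v (i + 2) - u (i + 2) * v (i + 1)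

lemma det3_self_left (u v : Fin 3 → A) : det3 u u v = 0 := by simp only [det3]; ring

lemma det3_self_right (u v : Fin 3 → A) : det3 u v v = 0 := by simp only [det3]; ring

lemma det3_swap (u v w : Fin 3 → A) : det3 u w v = -det3 u v w := by simp only [det3]; ring

lemma det3_smul (s : A) (u v w : Fin 3 → A) : det3 u (fun i => s * v i) w = s * det3 u v w := by
  simp only [det3]; ring

lemma det3_sum {ι : Type*} (s : Finset ι) (c : ι → A) (u : Fin 3 → A) (v : ι → Fin 3 → A)
    (w : Fin 3 → A) :
    det3 u (fun i => ∑ a ∈ s, c a * v a i) w = ∑ a ∈ s, c a * det3 u (v a) w := by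
  simp only [det3, Finset.mul_sum, Finset.sum_mul, ← Finset.sum_sub_distrib,
    ← Finset.sum_add_distrib]
  exact Finset.sum_congr rfl fun a _ => by ring

lemma mul_det3 (c u v w : Fin 3 → A) (i : Fin 3) :
    c i * det3 u v w = (∑ j, c j * u j) * cross3 v w i + (∑ j, c j * v j) * cross3 w u i +
      (∑ j, c j * w j) * cross3 u v i := by
  simp only [det3, cross3, Fin.sum_univ_three]
  fin_cases i
  · simp only [Fin.zero_eta, Fin.isValue, zero_add]; ring
  · simp only [Fin.mk_one, Fin.isValue, Fin.reduceAdd]; ring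
  · simp only [Fin.reduceFinMk, Fin.isValue, Fin.reduceAdd]; ring

lemma sum_cross3_mul (u v w : Fin 3 → A) : ∑ j, cross3 u v j * w j = det3 u v w := by
  simp only [det3, cross3, Fin.sum_univ_three, Fin.isValue, zero_add, Fin.reduceAdd]; ring

lemma cross3_eq_zero [IsDomain A] {u v w z : Fin 3 → A} (hw : det3 u v w = 0)
    (hz : det3 u v z = 0) (h : det3 u w z ≠ 0) (i : Fin 3) : cross3 u v i = 0 := by
  have h1 := mul_det3 (cross3 u v) u w z i
  have h2 : det3 u v u = 0 := by simp only [det3]; ring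
  rw [sum_cross3_mul, sum_cross3_mul, sum_cross3_mul, hw, hz, h2] at h1
  simpa [h] using h1

lemma mul_eq_mul_of_cross3_eq_zero {u v : Fin 3 → A} (h : ∀ i, cross3 u v i = 0) (i j : Fin 3) :
    u i * v j = u j * v i := by
  have h0 := h 0
  have h1 := h 1
  have h2 := h 2
  simp only [cross3, Fin.isValue, zero_add, Fin.reduceAdd] at h0 h1 h2
  fin_cases i <;> fin_cases j <;> simp only [Fin.zero_eta, Fin.mk_one, Fin.reduceFinMk] <;>
    first
    | rfl
    | linear_combination h0
    | linear_combination h1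
    | linear_combination h2
    | linear_combination -h0
    | linear_combination -h1
    | linear_combination -h2

lemma dvd_of_forall_dvd_mul {ι : Type*} [IsDomain A] [UniqueFactorizationMonoid A] {P : ι → A}
    (hP : CoprimeFamily P) {x : A} (hx : x ≠ 0) : ∀ {y : A}, (∀ j, x ∣ P j * y) → x ∣ y := by
  induction x using UniqueFactorizationMonoid.induction_on_prime with
  | h₁ => exact absurd rfl hx
  | h₂ x hu => exact fun _ => hu.dvd
  | h₃ a q ha hq ih =>
    intro y h
    obtain ⟨j, hj⟩ := hP q hq
    obtain ⟨y', rfl⟩ := (hq.dvd_or_dvd (dvd_trans (dvd_mul_right q a) (h j))).resolve_left hj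
    refine mul_dvd_mul_left q (ih ha fun i => ?_)
    have := h i
    rwa [mul_left_comm, mul_dvd_mul_iff_left hq.ne_zero] at this

/-- A vector parallel to a coprime family is divisible by it. -/
lemma dvd_of_cross3_eq_zero [IsDomain A] [UniqueFactorizationMonoid A] {P v : Fin 3 → A}
    (hP : CoprimeFamily P) (hP0 : P ≠ 0) (h : ∀ i, cross3 P v i = 0) (i : Fin 3) : P i ∣ v i := by
  have h1 := mul_eq_mul_of_cross3_eq_zero h
  by_cases hi : P i = 0
  · obtain ⟨j, hj⟩ := Function.ne_iff.1 hP0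
    have := h1 i j
    rw [hi, zero_mul, eq_comm, mul_eq_zero] at this
    rw [this.resolve_left hj]
    exact dvd_zero _
  · exact dvd_of_forall_dvd_mul hP hi fun j => ⟨v j, by rw [h1 i j]⟩

lemma dvd_of_det3_eq_zero [IsDomain A] [UniqueFactorizationMonoid A] {P v w z : Fin 3 → A}
    (hP : CoprimeFamily P) (hw : det3 P v w = 0) (hz : det3 P v z = 0) (h : det3 P w z ≠ 0)
    (i : Fin 3) : P i ∣ v i :=
  dvd_of_cross3_eq_zero hP (by rintro rfl; exact h (by simp [det3])) (cross3_eq_zero hw hz h) i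

end TripleProduct

section Shift

variable {k : Type*} [Field k] {n : ℕ}

/-- The translation `F(x) ↦ F(x + T v)`. -/
def shift (v : Fin n → k) : MvPolynomial (Fin n) k →ₐ[k] Polynomial (MvPolynomial (Fin n) k) :=
  (finSuccEquiv k n).toAlgHom.comp (aeval fun i => X i.succ + C (v i) * X 0)

lemma shift_X (v : Fin n → k) (i : Fin n) :
    shift v (X i) = Polynomial.C (X i) + Polynomial.C (C (v i)) * Polynomial.X := by
  simp [shift, finSuccEquiv_apply]

lemma isHomogeneous_coeff_shift (v : Fin n → k) {F : MvPolynomial (Fin n) k} {m : ℕ}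
    (hF : F.IsHomogeneous m) {i j : ℕ} (h : i + j = m) :
    ((shift v F).coeff i).IsHomogeneous j := by
  have := hF.aeval (n := 1) (fun i => (X i.succ + C (v i) * X 0 : MvPolynomial (Fin (n + 1)) k))
    fun i => (isHomogeneous_X _ _).add (isHomogeneous_C_mul_X _ _)
  rw [one_mul] at this
  exact this.finSuccEquiv_coeff_isHomogeneous i j h

lemma coeff_shift_eq_zero (v : Fin n → k) {F : MvPolynomial (Fin n) k} {m : ℕ}
    (hF : F.IsHomogeneous m) {i : ℕ} (h : m < i) : (shift v F).coeff i = 0 := by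
  have := hF.aeval (n := 1) (fun i => (X i.succ + C (v i) * X 0 : MvPolynomial (Fin (n + 1)) k))
    fun i => (isHomogeneous_X _ _).add (isHomogeneous_C_mul_X _ _)
  rw [one_mul] at this
  by_contra h0
  have h1 := totalDegree_coeff_finSuccEquiv_add_le _ i h0
  exact absurd (h1.trans this.totalDegree_le) (by omega)

lemma coeff_zero_shift (v : Fin n → k) (F : MvPolynomial (Fin n) k) : (shift v F).coeff 0 = F := by
  have : ((Polynomial.aeval (0 : MvPolynomial (Fin n) k)).restrictScalars k).comp (shift v) =
      AlgHom.id k _ := by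
    ext1 i
    simp [shift_X]
  rw [Polynomial.coeff_zero_eq_aeval_zero]
  exact DFunLike.congr_fun this F

/-- First-order Taylor expansion. -/
lemma exists_taylor {B σ : Type*} [CommRing B] [Algebra k B] [Fintype σ] (u w : σ → B) (ε : B)
    (F : MvPolynomial σ k) : ∃ r, aeval (fun i => u i + ε * w i) F =
      aeval u F + ε * ∑ i, aeval u (pderiv i F) * w i + ε ^ 2 * r := by
  classical
  induction F using MvPolynomial.induction_on with
  | C a => exact ⟨0, by simp⟩
  | add p q hp hq =>
    obtain ⟨r, hr⟩ := hp
    obtain ⟨s, hs⟩ := hq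
    refine ⟨r + s, ?_⟩
    simp only [map_add, hr, hs, add_mul, Finset.sum_add_distrib]
    ring
  | mul_X p j hp =>
    obtain ⟨r, hr⟩ := hp
    have h1 : ∑ i, aeval u (pderiv i (p * X j)) * w i =
        aeval u p * w j + u j * ∑ i, aeval u (pderiv i p) * w i := by
      simp only [Derivation.leibniz, pderiv_X, smul_eq_mul, map_add, map_mul, aeval_X, add_mul,
        Finset.sum_add_distrib, Finset.mul_sum]
      congr 1
      · rw [Finset.sum_eq_single j (fun i _ hi => by simp [Pi.single_eq_of_ne' hi]) (by simp)]
        simp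
      · exact Finset.sum_congr rfl fun i _ => by ring
    rw [map_mul, map_mul, aeval_X, aeval_X, hr, h1]
    exact ⟨(∑ i, aeval u (pderiv i p) * w i) * w j + r * (u j + ε * w j), by ring⟩

lemma exists_shift_eq (v : Fin n → k) {F : MvPolynomial (Fin n) k} {q : ℕ} (hq : 0 < q)
    (h : ∀ j, 0 < j → j < q → (shift v F).coeff j = 0) :
    ∃ w : Polynomial (MvPolynomial (Fin n) k), w.coeff 0 = (shift v F).coeff q ∧
      shift v F = Polynomial.C F + Polynomial.X ^ q * w := by
  obtain ⟨w, hw⟩ : Polynomial.X ^ q ∣ shift v F - Polynomial.C F := by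
    rw [Polynomial.X_pow_dvd_iff]
    intro j hj
    rcases Nat.eq_zero_or_pos j with rfl | hj0
    · simp [coeff_zero_shift]
    · simp [h j hj0 hj, Polynomial.coeff_C, hj0.ne']
  refine ⟨w, ?_, by rw [← hw]; ring⟩
  have h1 := congrArg (fun z => z.coeff q) hw
  simp only [Polynomial.coeff_sub, Polynomial.coeff_C, hq.ne', if_false, sub_zero] at h1
  rw [h1, mul_comm, Polynomial.coeff_mul_X_pow', if_pos le_rfl, Nat.sub_self]

/-- The chain rule for the lowest nonconstant coefficient of a translation. -/
lemma coeff_shift_aeval {σ : Type*} [Fintype σ] (v : Fin n → k) {P : σ → MvPolynomial (Fin n) k}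
    {q : ℕ} (hq : 0 < q) (h : ∀ i j, 0 < j → j < q → (shift v (P i)).coeff j = 0)
    (F : MvPolynomial σ k) :
    (shift v (aeval P F)).coeff q = ∑ i, aeval P (pderiv i F) * (shift v (P i)).coeff q := by
  choose w hw0 hw using fun i => exists_shift_eq v hq (h i)
  obtain ⟨r, hr⟩ := exists_taylor (fun i => Polynomial.C (P i)) w (Polynomial.X ^ q) F
  have hC : ∀ G : MvPolynomial σ k, aeval (fun i => Polynomial.C (P i)) G =
      Polynomial.C (aeval P G) := by
    intro G
    have : aeval (fun i => Polynomial.C (P i)) =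
        (Polynomial.CAlgHom (R := k) (A := MvPolynomial (Fin n) k)).comp (aeval P) := by
      ext1 i; simp
    rw [this]; rfl
  have h1 : shift v (aeval P F) = aeval (fun i => shift v (P i)) F := by
    rw [← AlgHom.comp_apply, comp_aeval]
  rw [h1, show (fun i => shift v (P i)) = fun i => Polynomial.C (P i) + Polynomial.X ^ q * w i from
    funext hw, hr, hC]
  simp only [hC, Polynomial.coeff_add, Polynomial.coeff_C, hq.ne', if_false, zero_add]
  rw [← pow_mul, mul_comm (Polynomial.X ^ (q * 2)), Polynomial.coeff_mul_X_pow',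
    if_neg (by omega), add_zero, mul_comm (Polynomial.X ^ q), Polynomial.coeff_mul_X_pow',
    if_pos le_rfl, Nat.sub_self, Polynomial.finsetSum_coeff]
  simp [hw0]

end Shift

section CubicMap

variable {k : Type} [Field k] {n : ℕ}

/-- A polynomial map `P` pulling the smooth plane cubic `E` back to a multiple of a power of the
irreducible cubic `g`. -/
structure CubicMap (E : PolyRing k 2) (g : MvPolynomial (Fin n) k)
    (P : Fin 3 → MvPolynomial (Fin n) k) (d : ℕ) (c : k) : Prop where
  hom_E : E.IsHomogeneous 3
  smooth : IsSmoothForm E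
  irr : Irreducible g
  hom_g : g.IsHomogeneous 3
  hom_P : ∀ i, (P i).IsHomogeneous d
  coprime : CoprimeFamily P
  pos : 0 < d
  c_ne : c ≠ 0
  aeval_eq : aeval P E = C c * g ^ d

namespace CubicMap

variable {E : PolyRing k 2} {g : MvPolynomial (Fin n) k} {P : Fin 3 → MvPolynomial (Fin n) k}
  {d : ℕ} {c : k}

lemma exists_not_dvd [IsAlgClosed k] (h : CubicMap E g P d c) :
    ∃ i, ¬ g ∣ aeval P (pderiv i E) := by
  by_contra! h0
  have hg := h.irr.prime
  have := (Ideal.span_singleton_prime hg.ne_zero).2 hg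
  set φ := (Ideal.Quotient.mkₐ k (Ideal.span {g})).comp (aeval P)
  have hφ : ∀ F, F ∈ RingHom.ker φ ↔ g ∣ aeval P F := fun F => by
    rw [RingHom.mem_ker, ← Ideal.mem_span_singleton, ← Ideal.Quotient.eq_zero_iff_mem]; rfl
  obtain ⟨i, hi⟩ := h.coprime g hg
  have hX : X i ∉ RingHom.ker φ := by rwa [hφ, aeval_X]
  have : (RingHom.ker φ).IsPrime := RingHom.ker_isPrime φ
  obtain ⟨a, ha, hai⟩ := exists_common_zero_notMem hX
  have hE : g ∣ aeval P E := by
    rw [h.aeval_eq]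
    exact dvd_mul_of_dvd_right (dvd_pow_self _ h.pos.ne') _
  have := h.smooth a ⟨ha _ ((hφ _).2 hE), fun j => ha _ ((hφ _).2 (h0 j))⟩
  simp [this] at hai

lemma sum_pderiv_mul (h : CubicMap E g P d c) :
    ∑ j, aeval P (pderiv j E) * P j = 3 * (C c * g ^ d) := by
  have := congrArg (aeval P) h.hom_E.sum_X_mul_pderiv
  simp only [map_sum, map_mul, aeval_X, nsmul_eq_mul, map_natCast, h.aeval_eq] at this
  simpa [mul_comm] using this

lemma sum_pderiv_mul_pderiv (h : CubicMap E g P d c) (a : Fin n) :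
    ∑ j, aeval P (pderiv j E) * pderiv a (P j) = C (c * d) * g ^ (d - 1) * pderiv a g := by
  rw [← derivation_aeval, h.aeval_eq, Derivation.leibniz, Derivation.leibniz_pow]
  simp
  ring

lemma pow_dvd_det3 [IsAlgClosed k] (h : CubicMap E g P d c) {m : ℕ} (hm : m ≤ d)
    {v w : Fin 3 → MvPolynomial (Fin n) k} (hv : g ^ m ∣ ∑ j, aeval P (pderiv j E) * v j)
    (hw : g ^ m ∣ ∑ j, aeval P (pderiv j E) * w j) : g ^ m ∣ det3 P v w := by
  obtain ⟨i, hi⟩ := h.exists_not_dvd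
  refine h.irr.prime.pow_dvd_of_dvd_mul_left m hi ?_
  rw [mul_det3 (fun j => aeval P (pderiv j E)) P v w i, h.sum_pderiv_mul]
  exact dvd_add (dvd_add (dvd_mul_of_dvd_left (dvd_mul_of_dvd_right (dvd_mul_of_dvd_right
    (pow_dvd_pow g hm) _) _) _) (hv.mul_right _)) (hw.mul_right _)

lemma pow_dvd_det3_pderiv [IsAlgClosed k] (h : CubicMap E g P d c) (a b : Fin n) :
    g ^ (d - 1) ∣ det3 P (fun j => pderiv a (P j)) fun j => pderiv b (P j) := by
  apply h.pow_dvd_det3 (Nat.sub_le _ _) <;> rw [h.sum_pderiv_mul_pderiv, mul_right_comm] <;>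
    exact dvd_mul_left _ _

lemma pow_dvd_det3_of_cast_eq_zero [IsAlgClosed k] (h : CubicMap E g P d c) (hd : (d : k) = 0)
    (a b : Fin n) : g ^ d ∣ det3 P (fun j => pderiv a (P j)) fun j => pderiv b (P j) := by
  apply h.pow_dvd_det3 le_rfl <;> rw [h.sum_pderiv_mul_pderiv, hd] <;> simp

lemma pow_dvd_det3_of_dvd [IsAlgClosed k] (h : CubicMap E g P d c) {y : Fin 3 → k} (hy : y ≠ 0)
    (hP : ∀ i j, g ∣ C (y i) * P j - C (y j) * P i) (a b : Fin n) :
    g ^ d ∣ det3 P (fun j => pderiv a (P j)) fun j => pderiv b (P j) := by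
  obtain ⟨l, hl⟩ : ∃ l, y l ≠ 0 := Function.ne_iff.1 hy
  obtain ⟨i, hi⟩ := h.exists_not_dvd
  choose m hm using hP l
  have hC : (C (y l)⁻¹ * C (y l) : MvPolynomial (Fin n) k) = 1 := by
    rw [← C_mul, inv_mul_cancel₀ hl, C_1]
  have hPj : ∀ j, P j = C (y l)⁻¹ * (C (y j) * P l + g * m j) := fun j => by
    rw [← hm]; linear_combination -P j * hC
  have hD : ∀ a j, pderiv a (P j) = C (y l)⁻¹ * (C (y j) * pderiv a (P l) +
      m j * pderiv a g + g * pderiv a (m j)) := fun a j => by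
    conv_lhs => rw [hPj j]
    simp only [Derivation.leibniz, map_add, pderiv_C, smul_eq_mul]
    ring
  have hcross : ∀ a, ∃ r, cross3 P (fun j => pderiv a (P j)) i = C (y l)⁻¹ ^ 2 * P l *
      (C (y (i + 1)) * m (i + 2) - C (y (i + 2)) * m (i + 1)) * pderiv a g + g * r := fun a => by
    refine ⟨C (y l)⁻¹ ^ 2 * (P l * (C (y (i + 1)) * pderiv a (m (i + 2)) -
      C (y (i + 2)) * pderiv a (m (i + 1))) +
      m (i + 1) * (C (y (i + 2)) * pderiv a (P l) + m (i + 2) * pderiv a g +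
        g * pderiv a (m (i + 2))) -
      m (i + 2) * (C (y (i + 1)) * pderiv a (P l) + m (i + 1) * pderiv a g +
        g * pderiv a (m (i + 1)))), ?_⟩
    rw [cross3, hD a (i + 2), hD a (i + 1)]
    linear_combination C (y l)⁻¹ * (C (y (i + 2)) * pderiv a (P l) + m (i + 2) * pderiv a g +
        g * pderiv a (m (i + 2))) * hPj (i + 1) -
      C (y l)⁻¹ * (C (y (i + 1)) * pderiv a (P l) + m (i + 1) * pderiv a g +
        g * pderiv a (m (i + 1))) * hPj (i + 2)
  have key : g ∣ pderiv a g * cross3 (fun j => pderiv b (P j)) P i +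
      pderiv b g * cross3 P (fun j => pderiv a (P j)) i := by
    obtain ⟨r, hr⟩ := hcross a
    obtain ⟨s, hs⟩ := hcross b
    refine ⟨pderiv b g * r - pderiv a g * s, ?_⟩
    rw [hr, show cross3 (fun j => pderiv b (P j)) P i = -cross3 P (fun j => pderiv b (P j)) i by
      simp only [cross3]; ring, hs]
    ring
  refine h.irr.prime.pow_dvd_of_dvd_mul_left d hi ?_
  rw [mul_det3 (fun j => aeval P (pderiv j E)) P _ _ i, h.sum_pderiv_mul, h.sum_pderiv_mul_pderiv,
    h.sum_pderiv_mul_pderiv]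
  obtain ⟨r, hr⟩ := key
  obtain ⟨e, rfl⟩ := Nat.exists_eq_succ_of_ne_zero h.pos.ne'
  refine ⟨3 * C c * cross3 (fun j => pderiv a (P j)) (fun j => pderiv b (P j)) i +
    C (c * (e.succ : ℕ)) * r, ?_⟩
  rw [Nat.succ_sub_one, pow_succ]
  linear_combination C (c * (e.succ : ℕ)) * g ^ e * hr

end CubicMap
end CubicMap

section CubicMap

variable {k : Type} [Field k] {n : ℕ}

lemma quadratic_alternating {t : Fin n → Fin n → k}
    (h : ∀ x : Fin n → k, ∑ a, x a * ∑ c, t a c * x c = 0) :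
    (∀ a, t a a = 0) ∧ ∀ a c, t c a = -t a c := by
  have h1 : ∀ a, t a a = 0 := fun a => by
    simpa [Pi.single_apply] using h (Pi.single a 1)
  refine ⟨h1, fun a c => ?_⟩
  have := h (Pi.single a 1 + Pi.single c 1)
  simp [Pi.single_apply, mul_add, add_mul, Finset.sum_add_distrib, h1] at this
  linear_combination this

namespace CubicMap

variable {E : PolyRing k 2} {g : MvPolynomial (Fin n) k} {P : Fin 3 → MvPolynomial (Fin n) k}
  {d : ℕ} {c : k}

lemma sum_X_mul_det3 (h : CubicMap E g P d c) (u : Fin 3 → MvPolynomial (Fin n) k) :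
    ∑ a, X a * det3 P u (fun j => pderiv a (P j)) = 0 := by
  have h1 := det3_sum Finset.univ (fun a : Fin n => (X a : MvPolynomial (Fin n) k)) P
    (fun a j => pderiv a (P j)) u
  have h2 : ∀ j, ∑ a, X a * pderiv a (P j) = d * P j := fun j => by
    rw [(h.hom_P j).sum_X_mul_pderiv, nsmul_eq_mul]
  simp only [h2, det3_smul, det3_self_left, mul_zero] at h1
  simp only [det3_swap P _ u, mul_neg, Finset.sum_neg_distrib] at h1 ⊢
  simpa using h1.symm

lemma exists_alternating [IsAlgClosed k] (h : CubicMap E g P d c) :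
    ∃ t : Fin n → Fin n → Fin n → k, (∀ a b, det3 P (fun j => pderiv a (P j))
      (fun j => pderiv b (P j)) = g ^ (d - 1) * ∑ c, C (t a b c) * X c) ∧
      (∀ a c, t a a c = 0) ∧ (∀ a b c, t b a c = -t a b c) ∧ (∀ a b, t a b a = 0) ∧
      ∀ a b c, t c b a = -t a b c := by
  choose θ hθ using h.pow_dvd_det3_pderiv
  have hg0 := pow_ne_zero (d - 1) h.irr.ne_zero
  have hhom : ∀ a b, (θ a b).IsHomogeneous 1 := fun a b => by
    refine isHomogeneous_right_of_mul (m := 3 * (d - 1)) ?_ (h.hom_g.pow _) hg0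
    rw [← hθ, show 3 * (d - 1) + 1 = d + ((d - 1) + (d - 1)) by have := h.pos; omega]
    have hD : ∀ a i, (pderiv a (P i)).IsHomogeneous (d - 1) := fun a i => (h.hom_P i).pderiv
    have hm : ∀ i j, (pderiv a (P i) * pderiv b (P j) -
        pderiv a (P j) * pderiv b (P i)).IsHomogeneous ((d - 1) + (d - 1)) := fun i j =>
      ((hD _ _).mul (hD _ _)).sub ((hD _ _).mul (hD _ _))
    exact (((h.hom_P _).mul (hm _ _)).sub ((h.hom_P _).mul (hm _ _))).add
      ((h.hom_P _).mul (hm _ _))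
  have ht : ∀ a b, ∃ t : Fin n → k, θ a b = ∑ c, C (t c) * X c := fun a b => by
    obtain ⟨M, hM⟩ := exists_toMvPolynomial_eq (L := fun _ : Fin n => θ a b) fun _ => hhom a b
    refine ⟨M a, (congrFun hM a).trans (Finset.sum_congr rfl fun c _ => ?_)⟩
    rw [C_mul_X_eq_monomial]
  choose t ht using ht
  refine ⟨t, fun a b => by rw [hθ, ht], ?_⟩
  have h1 : ∀ a, θ a a = 0 := fun a => by
    have := hθ a a
    rw [det3_self_right, eq_comm, mul_eq_zero] at this
    exact this.resolve_left hg0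
  have h2 : ∀ a b, θ b a = -θ a b := fun a b => by
    have := hθ b a
    rw [det3_swap, hθ, ← mul_neg] at this
    exact (mul_left_cancel₀ hg0 this).symm
  have h3 : ∀ b, ∑ a, X a * θ a b = 0 := fun b => by
    have := h.sum_X_mul_det3 fun j => pderiv b (P j)
    simp only [hθ, h2 _ b, mul_left_comm (X _) (g ^ _), ← Finset.mul_sum] at this
    simpa using (mul_eq_zero.1 this).resolve_left hg0
  have hco : ∀ a b e, t a b e = aeval (Pi.single e 1 : Fin n → k) (θ a b) := fun a b e => by
    simp [ht, Pi.single_apply]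
  have hq := fun b => quadratic_alternating (t := fun a c => t a b c) fun x => by
    have := congrArg (aeval x) (h3 b)
    simpa [ht] using this
  exact ⟨fun a c => by simp [hco, h1], fun a b c => by simp [hco, h2 a b],
    fun a b => (hq b).1 a, fun a b c => (hq b).2 a c⟩

end CubicMap
end CubicMap

section CubicMap

variable {k : Type} [Field k] {n : ℕ}

lemma coeff_one_shift (v : Fin n → k) (F : MvPolynomial (Fin n) k) :
    (shift v F).coeff 1 = ∑ a, C (v a) * pderiv a F := by
  have := coeff_shift_aeval v one_pos (P := X) (fun i j h1 h2 => absurd h1 (by omega)) F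
  rw [aeval_X_left, AlgHom.id_apply] at this
  refine this.trans (Finset.sum_congr rfl fun a _ => ?_)
  rw [AlgHom.id_apply, mul_comm, shift_X]
  simp [Polynomial.coeff_C]

lemma isHomogeneous_det3 {P u v : Fin 3 → MvPolynomial (Fin n) k} {d i j : ℕ}
    (hP : ∀ a, (P a).IsHomogeneous d) (hu : ∀ a, (u a).IsHomogeneous i)
    (hv : ∀ a, (v a).IsHomogeneous j) : (det3 P u v).IsHomogeneous (d + (i + j)) := by
  have hm : ∀ a b, (u a * v b - u b * v a).IsHomogeneous (i + j) := fun a b =>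
    ((hu _).mul (hv _)).sub ((hu _).mul (hv _))
  exact (((hP _).mul (hm _ _)).sub ((hP _).mul (hm _ _))).add ((hP _).mul (hm _ _))

namespace CubicMap

variable {E : PolyRing k 2} {g : MvPolynomial (Fin n) k} {P : Fin 3 → MvPolynomial (Fin n) k}
  {d : ℕ} {c : k}

lemma not_pow_dvd_det3 (h : CubicMap E g P d c) {a b : Fin n}
    (hab : det3 P (fun j => pderiv a (P j)) (fun j => pderiv b (P j)) ≠ 0) :
    ¬ g ^ d ∣ det3 P (fun j => pderiv a (P j)) fun j => pderiv b (P j) := fun h0 =>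
  hab (eq_zero_of_dvd_of_isHomogeneous (h.hom_g.pow d) (isHomogeneous_det3 h.hom_P
    (fun i => (h.hom_P i).pderiv) fun i => (h.hom_P i).pderiv) (by have := h.pos; omega) h0)

lemma cast_ne_zero [IsAlgClosed k] (h : CubicMap E g P d c) {a b : Fin n}
    (hab : det3 P (fun j => pderiv a (P j)) (fun j => pderiv b (P j)) ≠ 0) : (d : k) ≠ 0 :=
  fun hd => h.not_pow_dvd_det3 hab (h.pow_dvd_det3_of_cast_eq_zero hd a b)

/-- A direction along which `P` is infinitesimally constant is a direction of translation
invariance of `P` and `g`. -/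
lemma coeff_shift [IsAlgClosed k] (h : CubicMap E g P d c) {a b : Fin n}
    (hab : det3 P (fun j => pderiv a (P j)) (fun j => pderiv b (P j)) ≠ 0) {v : Fin n → k}
    (hv : ∀ e, det3 P (fun j => ∑ i, C (v i) * pderiv i (P j)) (fun j => pderiv e (P j)) = 0)
    {q : ℕ} (hq : 0 < q) : (∀ i, (shift v (P i)).coeff q = 0) ∧ (shift v g).coeff q = 0 := by
  have hg0 := pow_ne_zero (d - 1) h.irr.ne_zero
  induction q using Nat.strong_induction_on with | _ q ih =>
  have hP : ∀ i j, 0 < j → j < q → (shift v (P i)).coeff j = 0 := fun i j h1 h2 =>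
    (ih j h2 h1).1 i
  have hg : ∀ _ : Fin 1, ∀ j, 0 < j → j < q → (shift v g).coeff j = 0 := fun _ j h1 h2 =>
    (ih j h2 h1).2
  have hpow : (shift v (aeval P E)).coeff q =
      C (c * d) * g ^ (d - 1) * (shift v g).coeff q := by
    have := coeff_shift_aeval v hq hg (X 0 ^ d)
    rw [h.aeval_eq, map_mul, show (C c : MvPolynomial (Fin n) k) = algebraMap k _ c from rfl,
      AlgHom.commutes]
    simp [Polynomial.algebraMap_apply] at this ⊢
    rw [this]
    ring
  have hsum := (coeff_shift_aeval v hq hP E).symm.trans hpow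
  have hδ : ∀ i, (shift v (P i)).coeff q = 0 := by
    rcases lt_or_ge d q with hdq | hqd
    · exact fun i => coeff_shift_eq_zero v (h.hom_P i) hdq
    have hhom : ∀ i, ((shift v (P i)).coeff q).IsHomogeneous (d - q) := fun i =>
      isHomogeneous_coeff_shift v (h.hom_P i) (by omega)
    have hdet : ∀ e, det3 P (fun i => (shift v (P i)).coeff q) (fun j => pderiv e (P j)) = 0 := by
      have hdvd : ∀ e, g ^ (d - 1) ∣
          det3 P (fun i => (shift v (P i)).coeff q) (fun j => pderiv e (P j)) := fun e => by
        refine h.pow_dvd_det3 (Nat.sub_le _ _) (hsum.symm ▸ ?_)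
          ((h.sum_pderiv_mul_pderiv e).symm ▸ ?_) <;>
          exact dvd_mul_of_dvd_left (dvd_mul_left _ _) _
      have hdh : ∀ e, (det3 P (fun i => (shift v (P i)).coeff q)
          (fun j => pderiv e (P j))).IsHomogeneous (d + ((d - q) + (d - 1))) := fun e =>
        isHomogeneous_det3 h.hom_P hhom fun i => (h.hom_P i).pderiv
      rcases (show q = 1 ∨ q = 2 ∨ 3 ≤ q by omega) with rfl | rfl | hq3
      · simpa only [coeff_one_shift] using hv
      · choose β hβ using hdvd
        have hβ0 : ∀ e, (β e).IsHomogeneous 0 := fun e => by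
          refine isHomogeneous_right_of_mul (m := 3 * (d - 1)) ?_ (h.hom_g.pow _) hg0
          rw [← hβ]
          convert hdh e using 1
          omega
        have hs := h.sum_X_mul_det3 fun i => (shift v (P i)).coeff 2
        simp only [hβ, mul_left_comm (X _) (g ^ _), ← Finset.mul_sum] at hs
        replace hs := (mul_eq_zero.1 hs).resolve_left hg0
        intro e
        have hβC : ∀ e, β e = C (coeff 0 (β e)) := fun e =>
          totalDegree_eq_zero_iff_eq_C.1 ((totalDegree_zero_iff_isHomogeneous _).2 (hβ0 e))
        have := congrArg (aeval (Pi.single e 1 : Fin n → k)) hs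
        have hβe : coeff 0 (β e) = 0 := by
          simp only [map_sum, map_mul, aeval_X] at this
          rw [Finset.sum_eq_single e (fun i _ hi => by simp [hi]) (by simp), hβC] at this
          simpa using this
        rw [hβ, hβC, hβe, C_0, mul_zero]
      · exact fun e => eq_zero_of_dvd_of_isHomogeneous (h.hom_g.pow _) (hdh e) (by omega) (hdvd e)
    exact fun i => eq_zero_of_dvd_of_isHomogeneous (h.hom_P i) (hhom i) (by omega)
      (dvd_of_det3_eq_zero h.coprime (hdet a) (hdet b) hab i)
  refine ⟨hδ, ?_⟩
  simp only [hδ, mul_zero, Finset.sum_const_zero] at hsum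
  have hcd : (C (c * d) : MvPolynomial (Fin n) k) ≠ 0 := by
    rw [Ne, C_eq_zero]
    exact mul_ne_zero h.c_ne (h.cast_ne_zero hab)
  exact (mul_eq_zero.1 hsum.symm).resolve_left (mul_ne_zero hcd hg0)

end CubicMap
end CubicMap

section CubicMap

variable {k : Type} [Field k]

lemma exists_contraction_eq_zero {t : Fin 4 → Fin 4 → Fin 4 → k} (h0 : ∃ a b c, t a b c ≠ 0)
    (h1 : ∀ a c, t a a c = 0) (h2 : ∀ a b c, t b a c = -t a b c) (h3 : ∀ a b, t a b a = 0)
    (h4 : ∀ a b c, t c b a = -t a b c) :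
    ∃ v : Fin 4 → k, v ≠ 0 ∧ ∀ b c, ∑ a, v a * t a b c = 0 := by
  have h5 : ∀ a b, t b a a = 0 := fun a b => by rw [h2, h3, neg_zero]
  have h6 : ∀ a b c, t a c b = -t a b c := fun a b c => by rw [h2, h4, h2 b, neg_neg]
  refine ⟨![t 1 2 3, -t 0 2 3, t 0 1 3, -t 0 1 2], fun hv => ?_, fun b c => ?_⟩
  · have e0 : t 1 2 3 = 0 := congrFun hv 0
    have e1 : t 0 2 3 = 0 := neg_eq_zero.1 (congrFun hv 1)
    have e2 : t 0 1 3 = 0 := congrFun hv 2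
    have e3 : t 0 1 2 = 0 := neg_eq_zero.1 (congrFun hv 3)
    obtain ⟨a, b, c, h⟩ := h0
    apply h
    clear h hv
    fin_cases a <;> fin_cases b <;> fin_cases c <;> grind
  · simp only [Fin.sum_univ_four, Matrix.cons_val]
    fin_cases b <;> fin_cases c <;> grind

lemma alternating_fin3 {t : Fin 3 → Fin 3 → Fin 3 → k}
    (h1 : ∀ a c, t a a c = 0) (h2 : ∀ a b c, t b a c = -t a b c) (h3 : ∀ a b, t a b a = 0)
    (h4 : ∀ a b c, t c b a = -t a b c) {B : Type*} [CommRing B] [Algebra k B]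
    (u w : Fin 3 → B) (b : Fin 3) :
    ∑ a, w a * ∑ c, algebraMap k B (t a b c) * u c = algebraMap k B (t 0 1 2) * cross3 u w b := by
  have h5 : ∀ a b, t b a a = 0 := fun a b => by rw [h2, h3, neg_zero]
  have h6 : ∀ a b c, t a c b = -t a b c := fun a b c => by rw [h2, h4, h2 b, neg_neg]
  have e1 : t 1 2 0 = t 0 1 2 := by rw [h6, h2, neg_neg]
  have e2 : t 2 0 1 = t 0 1 2 := by rw [h2, h6, neg_neg]
  have e3 : t 1 0 2 = -t 0 1 2 := h2 ..
  have e4 : t 0 2 1 = -t 0 1 2 := h6 ..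
  have e5 : t 2 1 0 = -t 0 1 2 := h4 ..
  fin_cases b <;> simp [Fin.sum_univ_three, h1, h3, h5, cross3, e1, e2, e3, e4, e5] <;> ring

lemma alternating_fin3_ne_zero {t : Fin 3 → Fin 3 → Fin 3 → k} (h0 : ∃ a b c, t a b c ≠ 0)
    (h1 : ∀ a c, t a a c = 0) (h2 : ∀ a b c, t b a c = -t a b c) (h3 : ∀ a b, t a b a = 0)
    (h4 : ∀ a b c, t c b a = -t a b c) : t 0 1 2 ≠ 0 := by
  have h5 : ∀ a b, t b a a = 0 := fun a b => by rw [h2, h3, neg_zero]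
  have h6 : ∀ a b c, t a c b = -t a b c := fun a b c => by rw [h2, h4, h2 b, neg_neg]
  intro e
  obtain ⟨a, b, c, h⟩ := h0
  apply h
  clear h
  fin_cases a <;> fin_cases b <;> fin_cases c <;> grind

namespace CubicMap

lemma exists_contraction [IsAlgClosed k] {E : PolyRing k 2} {g : MvPolynomial (Fin 3) k}
    {P : Fin 3 → MvPolynomial (Fin 3) k} {d : ℕ} {c : k} (h : CubicMap E g P d c)
    (hab : ∃ a b, det3 P (fun j => pderiv a (P j)) (fun j => pderiv b (P j)) ≠ 0) :
    ∃ κ : k, κ ≠ 0 ∧ ∀ (Q δ : Fin 3 → PolyRing k 3) (b : Fin 3),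
      ∑ a, δ a * aeval Q (det3 P (fun j => pderiv a (P j)) (fun j => pderiv b (P j))) =
        aeval Q g ^ (d - 1) * (C κ * cross3 Q δ b) := by
  obtain ⟨t, ht, h1, h2, h3, h4⟩ := h.exists_alternating
  refine ⟨t 0 1 2, alternating_fin3_ne_zero ?_ h1 h2 h3 h4, fun Q δ b => ?_⟩
  · by_contra! h0
    obtain ⟨a, b, hab⟩ := hab
    exact hab (by simp [ht, h0])
  · have := alternating_fin3 h1 h2 h3 h4 Q δ b
    rw [MvPolynomial.algebraMap_eq] at this
    rw [← this, Finset.mul_sum]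
    refine Finset.sum_congr rfl fun a _ => ?_
    simp [ht, algebraMap_eq]
    ring

/-- In four variables, the data of a nonconstant cubic map are invariant under translation in some
direction. -/
lemma exists_direction [IsAlgClosed k] {E : PolyRing k 2} {g : PolyRing k 3}
    {P : Fin 3 → PolyRing k 3} {d : ℕ} {c : k} (h : CubicMap E g P d c)
    (hab : ∃ a b, det3 P (fun j => pderiv a (P j)) (fun j => pderiv b (P j)) ≠ 0) :
    ∃ v : Fin 4 → k, v ≠ 0 ∧ ∀ q, 0 < q →
      (∀ i, (shift v (P i)).coeff q = 0) ∧ (shift v g).coeff q = 0 := by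
  obtain ⟨a, b, hab⟩ := hab
  obtain ⟨t, ht, h1, h2, h3, h4⟩ := h.exists_alternating
  obtain ⟨v, hv0, hv⟩ := exists_contraction_eq_zero (t := t) (by
    by_contra! h0
    exact hab (by simp [ht, h0])) h1 h2 h3 h4
  refine ⟨v, hv0, fun q hq => h.coeff_shift hab (fun e => ?_) hq⟩
  have := det3_sum Finset.univ (fun i => (C (v i) : PolyRing k 3)) P
    (fun i j => pderiv i (P j)) fun j => pderiv e (P j)
  rw [this]
  simp only [ht, mul_left_comm (C _) (g ^ _), ← Finset.mul_sum]
  refine mul_eq_zero_of_right _ ?_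
  simp only [Finset.mul_sum]
  rw [Finset.sum_comm]
  refine Finset.sum_eq_zero fun c _ => ?_
  simp only [← mul_assoc, ← C_mul, ← Finset.sum_mul, ← map_sum, hv, C_0, zero_mul]

end CubicMap
end CubicMap

section Nondegenerate

variable {k : Type} [Field k]

lemma exists_C_mul_pow_of_dvd {n : ℕ} {g x : MvPolynomial (Fin n) k} (hg : Irreducible g) {c : k}
    (hc : c ≠ 0) {N : ℕ} (h : x ∣ C c * g ^ N) : ∃ m b, b ≠ 0 ∧ x = C b * g ^ m := by
  have h0 : C c * g ^ N ≠ 0 := mul_ne_zero (by rwa [Ne, C_eq_zero]) (pow_ne_zero _ hg.ne_zero)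
  obtain ⟨m, hm⟩ := associated_pow_of_forall_prime hg (ne_zero_of_dvd_ne_zero h0 h)
    fun q hq hqx => by
      rcases hq.dvd_or_dvd (hqx.trans h) with h1 | h1
      · exact absurd (isUnit_of_dvd_unit h1 ((Ne.isUnit hc).map C)) hq.not_isUnit
      · exact hq.dvd_of_dvd_pow h1
  obtain ⟨b, hb, e⟩ := exists_C_mul_of_associated hm
  exact ⟨m, b, hb, e⟩

/-- Removing the common factor of a polynomial map pulling a cubic back to a multiple of a power
of an irreducible cubic. -/
lemma exists_primitive {n : ℕ} {F : MvPolynomial (Fin 3) k} {g : MvPolynomial (Fin n) k}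
    (hF : F.IsHomogeneous 3) (hg : Irreducible g) (hgd : g.IsHomogeneous 3)
    {w : Fin 3 → MvPolynomial (Fin n) k} {N : ℕ} (hw : ∀ i, (w i).IsHomogeneous N) {c : k}
    (hc : c ≠ 0) (h : aeval w F = C c * g ^ N) :
    ∃ (u : Fin 3 → MvPolynomial (Fin n) k) (D m : ℕ) (b b' : k), b ≠ 0 ∧ b' ≠ 0 ∧
      (∀ i, w i = C b' * g ^ m * u i) ∧ CoprimeFamily u ∧ (∀ i, (u i).IsHomogeneous D) ∧
      aeval u F = C b * g ^ D := by
  have h0 : C c * g ^ N ≠ 0 := mul_ne_zero (by rwa [Ne, C_eq_zero]) (pow_ne_zero _ hg.ne_zero)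
  have hw0 : w ≠ 0 := by
    rintro rfl
    refine h0 (h.symm.trans ?_)
    have := aeval_mul_const_of_isHomogeneous hF (0 : Fin 3 → MvPolynomial (Fin n) k) 0
    simp only [Pi.zero_apply, zero_mul] at this
    exact this.trans (by simp)
  obtain ⟨a, u, ha, hu, hcop⟩ := exists_coprimeFamily w hw0
  have h1 : aeval u F * a ^ 3 = C c * g ^ N := by
    rw [← aeval_mul_const_of_isHomogeneous hF, ← h]
    simp only [mul_comm, ← hu]
  obtain ⟨m, b', hb', rfl⟩ := exists_C_mul_pow_of_dvd hg hc (h1 ▸ dvd_mul_of_dvd_right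
    (dvd_pow_self a three_ne_zero) _)
  obtain ⟨D, b, hb, hD⟩ := exists_C_mul_pow_of_dvd hg hc (h1 ▸ dvd_mul_right _ _)
  refine ⟨u, D, m, b, b', hb, hb', hu, hcop, ?_, hD⟩
  have hmD : N = D + 3 * m := by
    have e1 : aeval u F * (C b' * g ^ m) ^ 3 = C (b * b' ^ 3) * g ^ (D + 3 * m) := by
      rw [hD, C_mul, C_pow]; ring
    rw [h1] at e1
    have hbb : (b * b' ^ 3) ≠ 0 := mul_ne_zero hb (pow_ne_zero _ hb')
    have e2 : (C c * g ^ N).IsHomogeneous (0 + 3 * N) := (isHomogeneous_C _ _).mul (hgd.pow N)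
    have e3 : (C (b * b' ^ 3) * g ^ (D + 3 * m)).IsHomogeneous (0 + 3 * (D + 3 * m)) :=
      (isHomogeneous_C _ _).mul (hgd.pow _)
    have := (e1 ▸ e2).inj_right e3 (e1 ▸ h0)
    omega
  have hdeg : (C b' * g ^ m).IsHomogeneous (3 * m) := by
    simpa using (isHomogeneous_C _ b').mul (hgd.pow m)
  exact fun i => isHomogeneous_right_of_mul (m := 3 * m) (by
    rw [← hu, add_comm, ← hmD]; exact hw i) hdeg ha

lemma exists_orthogonal {A : Type*} [CommRing A] [IsDomain A] {ι : Type*} {v : Fin 3 → A}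
    (hv : v ≠ 0) {w : ι → Fin 3 → A} (h : ∀ a b, det3 v (w a) (w b) = 0) :
    ∃ y : Fin 3 → A, y ≠ 0 ∧ ∑ i, y i * v i = 0 ∧ ∀ a, ∑ i, y i * w a i = 0 := by
  by_cases h0 : ∀ a i, cross3 v (w a) i = 0
  · obtain ⟨y, hy, hyv⟩ : ∃ y : Fin 3 → A, y ≠ 0 ∧ ∑ i, y i * v i = 0 := by
      by_cases h1 : v 0 = 0 ∧ v 1 = 0
      · exact ⟨![1, 0, 0], fun h => one_ne_zero (congrFun h 0), by
          simp [Fin.sum_univ_three, h1]⟩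
      · refine ⟨![v 1, -v 0, 0], fun h => h1 ⟨?_, congrFun h 0⟩, ?_⟩
        · exact neg_eq_zero.1 (congrFun h 1)
        · simp [Fin.sum_univ_three]; ring
    refine ⟨y, hy, hyv, fun a => ?_⟩
    obtain ⟨j, hj⟩ := Function.ne_iff.1 hv
    have h1 : v j * ∑ i, y i * w a i = w a j * ∑ i, y i * v i := by
      rw [Finset.mul_sum, Finset.mul_sum]
      refine Finset.sum_congr rfl fun i _ => ?_
      linear_combination y i * mul_eq_mul_of_cross3_eq_zero (h0 a) j i
    rw [hyv, mul_zero] at h1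
    exact (mul_eq_zero.1 h1).resolve_left hj
  · push Not at h0
    obtain ⟨a, i, hi⟩ := h0
    refine ⟨cross3 v (w a), fun h => hi (congrFun h i), ?_, fun b => ?_⟩
    · rw [sum_cross3_mul]; simp only [det3]; ring
    · rw [sum_cross3_mul, h]

/-- The map underlying an isomorphism of complements is dominant, so no three of its components
are functionally dependent to second order. -/
lemma ComplementMaps.exists_det3_ne_zero {f g : PolyRing k 3} {p G : Fin (3 + 1) → PolyRing k 3}
    {d e : ℕ} {c c' : k} {μ ν : PolyRing k 3} (h : ComplementMaps f g p G d e c c' μ ν)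
    (hp : (fun i : Fin 3 => p i.castSucc) ≠ 0) :
    ∃ a b, det3 (fun i => p i.castSucc) (fun i => pderiv a (p i.castSucc))
      (fun i => pderiv b (p i.castSucc)) ≠ 0 := by
  by_contra! hdet
  obtain ⟨y, hy, hy0, hyD⟩ := exists_orthogonal hp hdet
  let M : Matrix (Fin 4) (Fin 4) (PolyRing k 3) :=
    Matrix.of (Fin.cons p fun a : Fin 3 => fun j => pderiv a.succ (p j))
  have hsnoc : ∀ r : Fin 4 → PolyRing k 3,
      ∑ j, r j * (Fin.snoc y 0 : Fin 4 → PolyRing k 3) j = ∑ i, y i * r i.castSucc := fun r => by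
    rw [Fin.sum_univ_castSucc, Fin.snoc_last, mul_zero, add_zero]
    exact Finset.sum_congr rfl fun i _ => by rw [Fin.snoc_castSucc, mul_comm]
  have hM : ∃ v ≠ 0, M.mulVec v = 0 := by
    refine ⟨Fin.snoc y 0, fun h0 => hy ?_, ?_⟩
    · funext i
      simpa using congrFun h0 i.castSucc
    · funext i
      refine Fin.cases ?_ (fun i => ?_) i
      · exact (hsnoc _).trans hy0
      · exact (hsnoc _).trans (hyD i.succ)
  rw [Matrix.exists_mulVec_eq_zero_iff, ← Matrix.exists_vecMul_eq_zero_iff] at hM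
  obtain ⟨w, hw, hwM⟩ := hM
  have hw' : ∀ j, w 0 * p j + ∑ a : Fin 3, w a.succ * pderiv a.succ (p j) = 0 := fun j => by
    simpa [Matrix.vecMul, dotProduct, Fin.sum_univ_succ, M] using congrFun hwM j
  have hE : ∀ i, ∑ j, aeval p (pderiv j (G i)) * p j = (e : PolyRing k 3) * (X i * μ) := fun i => by
    have := congrArg (aeval p) (h.hom_G i).sum_X_mul_pderiv
    simp only [map_sum, map_mul, aeval_X, nsmul_eq_mul, map_natCast] at this
    rw [← h.p_G i]
    refine Eq.trans ?_ this
    exact Finset.sum_congr rfl fun j _ => mul_comm _ _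
  have hD : ∀ i a, ∑ j, aeval p (pderiv j (G i)) * pderiv a (p j) =
      pderiv a (X i) * μ + X i * pderiv a μ := fun i a => by
    rw [← derivation_aeval, show aeval p (G i) = X i * μ from h.p_G i, Derivation.leibniz]
    simp only [smul_eq_mul]
    ring
  have key : ∀ i, w 0 * ((e : PolyRing k 3) * (X i * μ)) + ∑ a : Fin 3, w a.succ *
      (pderiv a.succ (X i) * μ + X i * pderiv a.succ μ) = 0 := fun i => by
    have h1 : ∑ j, aeval p (pderiv j (G i)) *
        (w 0 * p j + ∑ a : Fin 3, w a.succ * pderiv a.succ (p j)) = 0 := by simp [hw']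
    simp only [mul_add, Finset.sum_add_distrib, Finset.mul_sum] at h1
    rw [Finset.sum_comm] at h1
    simp only [mul_left_comm (aeval p _) (w _), ← Finset.mul_sum, hE, hD] at h1
    exact h1
  have hR : w 0 * ((e : PolyRing k 3) * μ) + ∑ a : Fin 3, w a.succ * pderiv a.succ μ = 0 := by
    have h1 := key 0
    simp only [pderiv_X, Pi.single_apply] at h1
    have h2 : X 0 * (w 0 * ((e : PolyRing k 3) * μ) +
        ∑ a : Fin 3, w a.succ * pderiv a.succ μ) = 0 := by
      rw [← h1, mul_add, Finset.mul_sum]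
      congr 1
      · ring
      · exact Finset.sum_congr rfl fun a _ => by simp [(Fin.succ_ne_zero a).symm]; ring
    exact (mul_eq_zero.1 h2).resolve_left (X_ne_zero 0)
  have hwa : ∀ a : Fin 3, w a.succ = 0 := fun a => by
    have h1 := key a.succ
    have h2 : w a.succ * μ + X a.succ *
        (w 0 * ((e : PolyRing k 3) * μ) +
        ∑ a : Fin 3, w a.succ * pderiv a.succ μ) = 0 := by
      rw [← h1, mul_add, Finset.mul_sum]
      simp only [mul_add, Finset.sum_add_distrib]
      rw [Finset.sum_eq_single (a := a) (f := fun i : Fin 3 => w i.succ *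
        (pderiv i.succ (X a.succ) * μ)) (fun b _ hb => by
          simp [pderiv_X_of_ne ((Fin.succ_injective _).ne hb.symm)]) (by simp)]
      simp only [pderiv_X_self, mul_left_comm (X a.succ) (w _)]
      ring
    rw [hR, mul_zero, add_zero] at h2
    exact (mul_eq_zero.1 h2).resolve_right h.μ_ne
  apply hw
  funext i
  refine Fin.cases ?_ hwa i
  obtain ⟨j, hj⟩ := Function.ne_iff.1 hp
  have := hw' j.castSucc
  simp only [hwa, zero_mul, Finset.sum_const_zero, add_zero] at this
  exact (mul_eq_zero.1 this).resolve_right hj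

end Nondegenerate

section PlaneReduction

variable {k : Type} [Field k]

lemma det3_leibniz {A : Type*} [CommRing A] (h s t : A) (P u v : Fin 3 → A) :
    det3 (fun i => h * P i) (fun i => h * u i + P i * s) (fun i => h * v i + P i * t) =
      h ^ 3 * det3 P u v := by
  simp only [det3]; ring

lemma ComplementMaps.exists_cubicMap {E : PolyRing k 2} (hE : E.IsHomogeneous 3)
    (hEs : IsSmoothForm E) {g : PolyRing k 3} (hg : Irreducible g) (hgd : g.IsHomogeneous 3)
    {p G : Fin (3 + 1) → PolyRing k 3} {d e : ℕ} {c c' : k} {μ ν : PolyRing k 3}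
    (h : ComplementMaps (rename Fin.castSucc E) g p G d e c c' μ ν) :
    ∃ (P : Fin 3 → PolyRing k 3) (D m : ℕ) (b b' : k), b' ≠ 0 ∧
      (∀ i : Fin 3, p i.castSucc = C b' * g ^ m * P i) ∧ CubicMap E g P D b ∧
      ∃ a b, det3 P (fun i => pderiv a (P i)) (fun i => pderiv b (P i)) ≠ 0 := by
  have hpE : aeval (fun i : Fin 3 => p i.castSucc) E = C c * g ^ d := by
    rw [← h.p_f, bind₁, aeval_rename]; rfl
  obtain ⟨P, D, m, b, b', hb, hb', hP, hcop, hD, hPE⟩ :=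
    exists_primitive hE hg hgd (fun i : Fin 3 => h.hom_p i.castSucc) h.c_ne hpE
  have hp0 : (fun i : Fin 3 => p i.castSucc) ≠ 0 := fun h0 => by
    refine mul_ne_zero (C_eq_zero.not.2 h.c_ne) (pow_ne_zero d hg.ne_zero) (hpE.symm.trans ?_)
    rw [h0]
    have := aeval_mul_const_of_isHomogeneous hE (0 : Fin 3 → PolyRing k 3) 0
    simp only [Pi.zero_apply, zero_mul] at this
    exact this.trans (by simp)
  obtain ⟨a, a', hdet⟩ := h.exists_det3_ne_zero hp0
  have hdet' : det3 P (fun i => pderiv a (P i)) (fun i => pderiv a' (P i)) ≠ 0 := fun h0 => by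
    apply hdet
    simp only [hP, Derivation.leibniz (D := pderiv _) (C b' * g ^ m) (P _), smul_eq_mul]
    rw [det3_leibniz, h0, mul_zero]
  have hDpos : 0 < D := by
    by_contra! hD0
    obtain rfl : D = 0 := by omega
    refine hdet' ?_
    have : ∀ i, pderiv a (P i) = 0 := fun i => by
      rw [totalDegree_eq_zero_iff_eq_C.1 ((totalDegree_zero_iff_isHomogeneous _).2 (hD i)),
        pderiv_C]
    simp [this, det3]
  exact ⟨P, D, m, b, b', hb', hP, ⟨hE, hEs, hg, hgd, hD, hcop, hDpos, hb, hPE⟩, a, a', hdet'⟩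

lemma exists_rename_of_coeff_shift {n : ℕ} {F : MvPolynomial (Fin (n + 1)) k}
    (h : ∀ q, 0 < q → (shift (Pi.single (Fin.last n) 1) F).coeff q = 0) :
    ∃ F' : MvPolynomial (Fin n) k, F = rename Fin.castSucc F' := by
  have h1 : shift (Pi.single (Fin.last n) 1) F = Polynomial.C F := by
    ext1 q
    rcases Nat.eq_zero_or_pos q with rfl | hq
    · simp [coeff_zero_shift]
    · rw [h q hq, Polynomial.coeff_C, if_neg hq.ne']
  have h2 : ((Polynomial.aeval (-X (Fin.last n) : MvPolynomial (Fin (n + 1)) k)).restrictScalars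
      k).comp (shift (Pi.single (Fin.last n) 1)) =
      (rename Fin.castSucc).comp (aeval (Fin.snoc X 0 : Fin (n + 1) → MvPolynomial (Fin n) k)) := by
    ext1 i
    induction i using Fin.lastCases with
    | last => simp [shift_X]
    | cast i => simp [shift_X, (Fin.castSucc_lt_last i).ne]
  refine ⟨aeval (Fin.snoc X 0) F, ?_⟩
  have h3 := DFunLike.congr_fun h2 F
  simp only [AlgHom.comp_apply, h1] at h3
  rw [← h3]
  simp

lemma shift_bind₁ {n : ℕ} (M : Matrix (Fin n) (Fin n) k) (j : Fin n) (F : MvPolynomial (Fin n) k) :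
    shift (Pi.single j 1) (bind₁ M.toMvPolynomial F) =
      (shift (fun i => M i j) F).map (bind₁ M.toMvPolynomial).toRingHom := by
  have : (shift (Pi.single j 1)).comp (bind₁ M.toMvPolynomial) =
      (Polynomial.mapAlgHom (bind₁ M.toMvPolynomial)).comp (shift fun i => M i j) := by
    ext1 i
    have h1 := aeval_toMvPolynomial M i fun l => shift (Pi.single j (1 : k)) (X l)
    have h2 : shift (Pi.single j 1) (M.toMvPolynomial i) =
        aeval (fun l => shift (Pi.single j (1 : k)) (X l)) (M.toMvPolynomial i) := by
      conv_lhs => rw [aeval_unique (shift (Pi.single j (1 : k)))]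
      rfl
    have h3 := aeval_toMvPolynomial M i (X : Fin n → MvPolynomial (Fin n) k)
    rw [aeval_X_left, AlgHom.id_apply] at h3
    rw [AlgHom.comp_apply, bind₁_X_right, h2, h1, AlgHom.comp_apply, shift_X]
    simp only [shift_X, mul_add, Finset.sum_add_distrib, Polynomial.coe_mapAlgHom,
      Polynomial.map_add, Polynomial.map_mul, Polynomial.map_C, Polynomial.map_X]
    congr 1
    · simp [h3, Polynomial.algebraMap_apply]
    · rw [Finset.sum_eq_single j (fun l _ hl => by simp [Pi.single_eq_of_ne hl]) (by simp)]
      simp [Polynomial.algebraMap_apply]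
  exact DFunLike.congr_fun this F

lemma CoprimeFamily.of_map {ι R S : Type*} [CommRing R] [IsDomain R] [CommRing S] [IsDomain S]
    [UniqueFactorizationMonoid S] {v : ι → R} (φ : R →+* S) [IsLocalHom φ]
    (hφ : Function.Injective φ) (h : CoprimeFamily fun i => φ (v i)) : CoprimeFamily v :=
  fun q hq => by
    obtain ⟨r, hr, hrq⟩ := WfDvdMonoid.exists_irreducible_factor
      (fun hu => hq.not_isUnit (isUnit_of_map_unit φ q hu)) ((map_ne_zero_iff φ hφ).2 hq.ne_zero)
    obtain ⟨i, hi⟩ := h r hr.prime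
    exact ⟨i, fun hqi => hi (hrq.trans (map_dvd φ hqi))⟩

/-- Cubic map data descend along a split injection. -/
lemma CubicMap.of_map {n m : ℕ} {E : PolyRing k 2} {g : MvPolynomial (Fin n) k}
    {P : Fin 3 → MvPolynomial (Fin n) k} {D : ℕ} {b : k}
    (φ : MvPolynomial (Fin n) k →ₐ[k] MvPolynomial (Fin m) k)
    (ψ : MvPolynomial (Fin m) k →ₐ[k] MvPolynomial (Fin n) k) (hψ : ∀ F, ψ (φ F) = F)
    (h : CubicMap E (φ g) (fun i => φ (P i)) D b) (hg : g.IsHomogeneous 3)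
    (hP : ∀ i, (P i).IsHomogeneous D) : CubicMap E g P D b := by
  have hloc : IsLocalHom φ := isLocalHom_of_leftInverse ψ hψ
  have hinj : Function.Injective φ := Function.LeftInverse.injective hψ
  have hloc' : IsLocalHom φ.toRingHom := ⟨hloc.map_nonunit⟩
  refine ⟨h.hom_E, h.smooth, h.irr.of_map, hg, hP, CoprimeFamily.of_map φ.toRingHom hinj h.coprime,
    h.pos, h.c_ne, hinj ?_⟩
  have := h.aeval_eq
  rw [map_mul, map_pow, ← algebraMap_eq, AlgHom.commutes, algebraMap_eq, ← this,
    ← AlgHom.comp_apply, comp_aeval]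

lemma det3_pderiv_aeval {n m : ℕ} {P : Fin 3 → MvPolynomial (Fin n) k}
    (h : ∀ a b, det3 P (fun i => pderiv a (P i)) (fun i => pderiv b (P i)) = 0)
    (w : Fin n → MvPolynomial (Fin m) k) (a b : Fin m) :
    det3 (fun i => aeval w (P i)) (fun i => pderiv a (aeval w (P i)))
      (fun i => pderiv b (aeval w (P i))) = 0 := by
  have h' : ∀ a b, det3 (fun i => aeval w (P i)) (fun i => aeval w (pderiv a (P i)))
      (fun i => aeval w (pderiv b (P i))) = 0 := fun a b => by
    have := congrArg (aeval w) (h a b)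
    simpa only [det3, map_add, map_sub, map_mul, map_zero] using this
  simp only [derivation_aeval, mul_comm (aeval w (pderiv _ _))]
  rw [det3_sum]
  refine Finset.sum_eq_zero fun i _ => ?_
  rw [det3_swap, det3_sum, Finset.sum_eq_zero fun j _ => ?_, neg_zero, mul_zero]
  rw [h', mul_zero]

lemma ComplementMaps.comp_linChange {n : ℕ} {f g : PolyRing k n} {p G : Fin (n + 1) → PolyRing k n}
    {d e : ℕ} {c c' : k} {μ ν : PolyRing k n} (h : ComplementMaps f g p G d e c c' μ ν)
    {L L' : Fin (n + 1) → PolyRing k n} (hL : LinChange L L') :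
    ComplementMaps f (bind₁ L g) (fun i => bind₁ L (p i)) (fun i => bind₁ G (L' i)) d e c c'
      (bind₁ L μ) ν where
  hom_p i := isHomogeneous_bind₁_one hL.hom (h.hom_p i)
  hom_G i := by simpa using isHomogeneous_bind₁ (hL.hom' i) h.hom_G
  c_ne := h.c_ne
  c'_ne := h.c'_ne
  μ_ne h0 := h.μ_ne (by rw [← hL.symm.bind_bind μ, h0, map_zero])
  ν_ne := h.ν_ne
  p_f := by rw [← bind₁_bind₁, h.p_f, map_mul, map_pow, bind₁_C_right]
  G_g := by rw [← bind₁_bind₁, hL.symm.bind_bind, h.G_g]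
  p_G j := by
    have h1 : ∀ i, bind₁ L (bind₁ p (G i)) = L i * bind₁ L μ := fun i => by
      rw [h.p_G, map_mul, bind₁_X_right]
    have h2 := aeval_mul_const_of_isHomogeneous (hL.hom' j) L (bind₁ L μ)
    rw [pow_one, show aeval L (L' j) = X j from hL.bind_left j] at h2
    rw [bind₁_bind₁]
    simp only [← bind₁_bind₁, h1]
    exact h2
  G_p j := by rw [← bind₁_bind₁, hL.symm.bind_bind, h.G_p]

/-- The data of a nondegenerate cubic map become data in the plane after a linear change. -/
lemma CubicMap.exists_plane_form [IsAlgClosed k] {E : PolyRing k 2} {g : PolyRing k 3}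
    {P : Fin 3 → PolyRing k 3} {D : ℕ} {b : k} (h : CubicMap E g P D b)
    (hdet : ∃ a a', det3 P (fun i => pderiv a (P i)) (fun i => pderiv a' (P i)) ≠ 0) :
    ∃ (L L' : Fin (3 + 1) → PolyRing k 3) (g₂ : PolyRing k 2) (P₂ : Fin 3 → PolyRing k 2),
      LinChange L L' ∧ bind₁ L g = rename Fin.castSucc g₂ ∧
      (∀ i, bind₁ L (P i) = rename Fin.castSucc (P₂ i)) ∧ CubicMap E g₂ P₂ D b ∧
      ∃ a a', det3 P₂ (fun i => pderiv a (P₂ i)) (fun i => pderiv a' (P₂ i)) ≠ 0 := by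
  obtain ⟨v, hv, hshift⟩ := h.exists_direction hdet
  obtain ⟨M, hM, hMv⟩ := exists_matrix_of_linearIndependent (ι := Fin 1) (m := Fin (3 + 1))
    ⟨fun _ => Fin.last 3, fun _ _ _ => Subsingleton.elim _ _⟩ (v := fun _ => v)
    (linearIndependent_unique_iff.2 hv)
  have hL := linChange_toMvPolynomial hM
  set L := M.toMvPolynomial
  set L' := M⁻¹.toMvPolynomial
  have hMv' : (fun i => M i (Fin.last 3)) = v := funext fun i => hMv 0 i
  have hren : ∀ F : PolyRing k 3, (∀ q, 0 < q → (shift v F).coeff q = 0) →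
      ∃ F₂ : PolyRing k 2, bind₁ L F = rename Fin.castSucc F₂ := fun F hF =>
    exists_rename_of_coeff_shift fun q hq => by
      rw [shift_bind₁, hMv', Polynomial.coeff_map, hF q hq, map_zero]
  obtain ⟨g₂, hg₂⟩ := hren g fun q hq => (hshift q hq).2
  choose P₂ hP₂ using fun i => hren (P i) fun q hq => (hshift q hq).1 i
  let φ : PolyRing k 2 →ₐ[k] PolyRing k 3 := (bind₁ L').comp (rename Fin.castSucc)
  let ψ : PolyRing k 3 →ₐ[k] PolyRing k 2 := (aeval (Fin.snoc X 0)).comp (bind₁ L)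
  have hψ : ∀ F, ψ (φ F) = F := fun F => by
    simp only [φ, ψ, AlgHom.comp_apply, hL.bind_bind, aeval_rename]
    have : (Fin.snoc X 0 : Fin (2 + 1 + 1) → PolyRing k 2) ∘ Fin.castSucc = X := by
      funext i; simp
    rw [this, aeval_X_left, AlgHom.id_apply]
  have hφg : φ g₂ = g := by simp only [φ, AlgHom.comp_apply, ← hg₂, hL.symm.bind_bind]
  have hφP : ∀ i, φ (P₂ i) = P i := fun i => by
    simp only [φ, AlgHom.comp_apply, ← hP₂, hL.symm.bind_bind]
  have hcub : CubicMap E (φ g₂) (fun i => φ (P₂ i)) D b := by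
    rw [hφg, show (fun i => φ (P₂ i)) = P from funext hφP]; exact h
  refine ⟨L, L', g₂, P₂, hL, hg₂, hP₂, hcub.of_map φ ψ hψ ?_ fun i => ?_, ?_⟩
  · rw [← IsHomogeneous.rename_isHomogeneous_iff (Fin.castSucc_injective _), ← hg₂]
    exact isHomogeneous_bind₁_one hL.hom h.hom_g
  · rw [← IsHomogeneous.rename_isHomogeneous_iff (Fin.castSucc_injective _), ← hP₂]
    exact isHomogeneous_bind₁_one hL.hom (h.hom_P i)
  · by_contra! h0
    obtain ⟨a, a', ha⟩ := hdet
    have h1 := det3_pderiv_aeval h0 (fun i => L' i.castSucc) a a'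
    have h2 : ∀ i, aeval (fun i => L' i.castSucc) (P₂ i) = P i := fun i => by
      rw [← hφP]
      simp only [φ, AlgHom.comp_apply, bind₁, aeval_rename]
      rfl
    simp only [h2] at h1
    exact ha h1

lemma exists_eq_X_mul {σ ι : Type*} {s : ι → σ} {a b : ι} (hab : s a ≠ s b)
    {q : ι → MvPolynomial σ k} (h : ∀ i j, X (s i) * q j = X (s j) * q i) :
    ∃ μ, ∀ j, q j = X (s j) * μ := by
  have hX : Prime (X (s a) : MvPolynomial σ k) := X_prime
  obtain ⟨μ, hμ⟩ := (hX.dvd_or_dvd ⟨_, (h a b).symm⟩).resolve_left fun h1 =>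
    hab (by simpa using h1)
  refine ⟨μ, fun j => mul_left_cancel₀ (X_ne_zero (s a)) ?_⟩
  rw [h a j, hμ]
  ring

/-- A polynomial map inverted by `P` up to factors does not involve the last variable. -/
lemma CubicMap.exists_rename [IsAlgClosed k] {E g : PolyRing k 2} {P : Fin 3 → PolyRing k 2}
    {D : ℕ} {b : k} (h : CubicMap E g P D b)
    (hdet : ∃ a a', det3 P (fun i => pderiv a (P i)) (fun i => pderiv a' (P i)) ≠ 0)
    {Q : Fin 3 → PolyRing k 3} {D' : ℕ} (hQ : ∀ i, (Q i).IsHomogeneous D') (hcop : CoprimeFamily Q)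
    (hg0 : aeval Q g ≠ 0) {ν : PolyRing k 2}
    (hν : ∀ i, aeval Q (P i) = rename Fin.castSucc (X i * ν)) :
    ∃ Q₂ : Fin 3 → PolyRing k 2, ∀ i, Q i = rename Fin.castSucc (Q₂ i) := by
  obtain ⟨κ, hκ, hcon⟩ := h.exists_contraction hdet
  have hshift : ∀ F : PolyRing k 2, shift (Pi.single (Fin.last 3) (1 : k))
      (rename Fin.castSucc F) = Polynomial.C (rename Fin.castSucc F) := fun F => by
    have : (shift (Pi.single (Fin.last 3) (1 : k))).comp (rename Fin.castSucc) =
        (Polynomial.CAlgHom (R := k) (A := PolyRing k 3)).comp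
          (rename (Fin.castSucc : Fin (2 + 1) → Fin (2 + 1 + 1))) := by
      ext1 i
      have hi : (Pi.single (Fin.last 3) (1 : k) : Fin (3 + 1) → k) i.castSucc = 0 :=
        Pi.single_eq_of_ne (Fin.castSucc_lt_last i).ne _
      rw [AlgHom.comp_apply, rename_X, shift_X, hi]
      simp
    exact DFunLike.congr_fun this F
  have hQ0 : Q ≠ 0 := by
    rintro rfl
    refine hg0 ?_
    have := aeval_mul_const_of_isHomogeneous h.hom_g (0 : Fin 3 → PolyRing k 3) 0
    simp only [Pi.zero_apply, zero_mul] at this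
    exact this.trans (by simp)
  have key : ∀ q, 0 < q → ∀ i, (shift (Pi.single (Fin.last 3) (1 : k)) (Q i)).coeff q = 0 := by
    intro q hq
    induction q using Nat.strong_induction_on with | _ q ih =>
    rcases lt_or_ge D' q with hlt | hle
    · exact fun i => coeff_shift_eq_zero _ (hQ i) hlt
    have h1 : ∀ i, ∑ a, (shift (Pi.single (Fin.last 3) (1 : k)) (Q a)).coeff q *
        aeval Q (pderiv a (P i)) = 0 := fun i => by
      have := coeff_shift_aeval (Pi.single (Fin.last 3) (1 : k)) hq
        (fun i j hj hjq => ih j hjq hj i) (P i)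
      rw [hν, hshift, Polynomial.coeff_C, if_neg hq.ne'] at this
      rw [this]
      exact Finset.sum_congr rfl fun _ _ => mul_comm _ _
    have h2 : ∀ e, cross3 Q (fun a => (shift (Pi.single (Fin.last 3) (1 : k)) (Q a)).coeff q) e =
        0 := fun e => by
      have h3 := hcon Q (fun a => (shift (Pi.single (Fin.last 3) (1 : k)) (Q a)).coeff q) e
      have h4 := det3_sum Finset.univ
        (fun a => (shift (Pi.single (Fin.last 3) (1 : k)) (Q a)).coeff q)
        (fun i => aeval Q (P i)) (fun a i => aeval Q (pderiv a (P i)))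
        (fun i => aeval Q (pderiv e (P i)))
      have h5 : ∀ a, det3 (fun i => aeval Q (P i)) (fun i => aeval Q (pderiv a (P i)))
          (fun i => aeval Q (pderiv e (P i))) =
          aeval Q (det3 P (fun j => pderiv a (P j)) (fun j => pderiv e (P j))) := fun a => by
        simp only [det3, map_add, map_sub, map_mul]
      simp only [h5, h1] at h4
      rw [← h4] at h3
      have h6 : det3 (fun i => aeval Q (P i)) (fun _ => 0)
          (fun i => aeval Q (pderiv e (P i))) = 0 := by simp [det3]
      rw [h6, eq_comm] at h3
      exact ((mul_eq_zero.1 ((mul_eq_zero.1 h3).resolve_left (pow_ne_zero _ hg0))).resolve_left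
        (C_eq_zero.not.2 hκ))
    exact fun i => eq_zero_of_dvd_of_isHomogeneous (hQ i)
      (isHomogeneous_coeff_shift _ (hQ i) (j := D' - q) (by omega)) (by omega)
      (dvd_of_cross3_eq_zero hcop hQ0 h2 i)
  choose Q₂ hQ₂ using fun i => exists_rename_of_coeff_shift (n := 3) fun q hq => key q hq i
  exact ⟨Q₂, hQ₂⟩

end PlaneReduction

section PlaneInverse

variable {k : Type} [Field k]

lemma exists_eq_C_mul_pow_of_aeval {σ : Type*} {n : ℕ} {s : σ → Fin n}
    {F : MvPolynomial σ k} (hF : F.IsHomogeneous 3) (hFi : Irreducible (rename s F))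
    {μ : MvPolynomial (Fin n) k} {c : k} (hc : c ≠ 0) {N : ℕ}
    (h : aeval (fun j => X (s j) * μ) F = C c * rename s F ^ N) :
    ∃ m b, b ≠ 0 ∧ μ = C b * rename s F ^ m ∧ N = 1 + 3 * m := by
  rw [aeval_mul_const_of_isHomogeneous hF] at h
  rw [show (fun j => (X (s j) : MvPolynomial (Fin n) k)) = X ∘ s from rfl, ← aeval_rename,
    aeval_X_left, AlgHom.id_apply] at h
  obtain _ | N := N
  · exact absurd (isUnit_of_mul_isUnit_left (y := μ ^ 3) (by rw [h]; simpa using hc)) hFi.not_isUnit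
  have h1 : μ ^ 3 = C c * rename s F ^ N := by
    apply mul_left_cancel₀ hFi.ne_zero
    rw [h]; ring
  obtain ⟨m, b, hb, hm⟩ := exists_C_mul_pow_of_dvd hFi hc (h1 ▸ dvd_pow_self μ three_ne_zero)
  refine ⟨m, b, hb, hm, ?_⟩
  have hFh : (rename s F).IsHomogeneous 3 := hF.rename_isHomogeneous
  have h2 : ∀ (a : k) l, (C a * rename s F ^ l).IsHomogeneous (0 + 3 * l) := fun a l =>
    (isHomogeneous_C _ a).mul (hFh.pow l)
  have h3 := IsHomogeneous.inj_right (h1 ▸ h2 c N) ((hm ▸ h2 b m).pow 3)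
    (h1 ▸ mul_ne_zero (C_eq_zero.not.2 hc) (pow_ne_zero _ hFi.ne_zero))
  omega

lemma isLocalHom_rename_castSucc {n : ℕ} : IsLocalHom
    (rename Fin.castSucc : MvPolynomial (Fin n) k →ₐ[k] MvPolynomial (Fin (n + 1)) k) :=
  isLocalHom_of_leftInverse (aeval (Fin.snoc X 0 : Fin (n + 1) → MvPolynomial (Fin n) k))
    fun F => by
      have : (Fin.snoc X 0 : Fin (n + 1) → MvPolynomial (Fin n) k) ∘ Fin.castSucc = X := by
        funext i; simp
      rw [aeval_rename, this, aeval_X_left, AlgHom.id_apply]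

lemma CubicMap.exists_inverse [IsAlgClosed k] {E g : PolyRing k 2} {P : Fin 3 → PolyRing k 2}
    {D : ℕ} {b : k} (h : CubicMap E g P D b)
    (hdet : ∃ a a', det3 P (fun i => pderiv a (P i)) (fun i => pderiv a' (P i)) ≠ 0)
    (hE : Irreducible (rename Fin.castSucc E : PolyRing k 3))
    {p G : Fin (3 + 1) → PolyRing k 3} {d e m : ℕ} {c c' b' : k} {μ ν : PolyRing k 3}
    (hm : ComplementMaps (rename Fin.castSucc E) (rename Fin.castSucc g) p G d e c c' μ ν)
    (hb' : b' ≠ 0)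
    (hp : ∀ i : Fin 3, p i.castSucc =
      C b' * rename Fin.castSucc g ^ m * rename Fin.castSucc (P i)) :
    ∃ (Q : Fin 3 → PolyRing k 2) (D' N : ℕ) (β : k), β ≠ 0 ∧ (∀ i, (Q i).IsHomogeneous D') ∧
      CoprimeFamily Q ∧ (∀ j, aeval P (Q j) = X j * (C β * g ^ N)) ∧ D * D' = 1 + 3 * N := by
  have hcs := Fin.castSucc_injective 3
  have hinj := rename_injective (R := k) _ hcs
  have hEh : (rename Fin.castSucc E : PolyRing k 3).IsHomogeneous 3 := h.hom_E.rename_isHomogeneous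
  have hg0 : (rename Fin.castSucc g : PolyRing k 3) ≠ 0 :=
    (map_ne_zero_iff _ hinj).2 h.irr.ne_zero
  have hC : ∀ {n : ℕ} {a : k}, a ≠ 0 → (C a : MvPolynomial (Fin n) k) ≠ 0 :=
    fun ha => C_eq_zero.not.2 ha
  have hbind : ∀ (v : Fin (3 + 1) → PolyRing k 3) (F : PolyRing k 2),
      bind₁ v (rename Fin.castSucc F) = aeval (fun i : Fin 3 => v i.castSucc) F := fun v F => by
    rw [bind₁, aeval_rename]; rfl
  obtain ⟨Q, D', m', β, β', hβ, hβ', hGQ, hcop, hQ, hQg⟩ :=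
    exists_primitive h.hom_g hE hEh (fun i : Fin 3 => hm.hom_G i.castSucc) hm.c'_ne
      ((hbind G g).symm.trans hm.G_g)
  have hQg0 : aeval Q g ≠ 0 := by
    rw [hQg]; exact mul_ne_zero (hC hβ) (pow_ne_zero _ hE.ne_zero)
  have hAQ : ∃ S : PolyRing k 3, S ≠ 0 ∧ ∀ i, S * aeval Q (P i) = X i.castSucc * ν := by
    refine ⟨C b' * (C c' * rename Fin.castSucc E ^ e) ^ m *
      (C β' * rename Fin.castSucc E ^ m') ^ D, mul_ne_zero (mul_ne_zero (hC hb') (pow_ne_zero _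
        (mul_ne_zero (hC hm.c'_ne) (pow_ne_zero _ hE.ne_zero)))) (pow_ne_zero _
        (mul_ne_zero (hC hβ') (pow_ne_zero _ hE.ne_zero))), fun i => ?_⟩
    have h1 := hm.G_p i.castSucc
    have h2 := aeval_mul_const_of_isHomogeneous (h.hom_P i) Q (C β' * rename Fin.castSucc E ^ m')
    rw [hp, map_mul, map_mul, map_pow, hm.G_g, bind₁_C_right, hbind, funext hGQ] at h1
    simp only [mul_comm _ (Q _)] at h1
    rw [h2] at h1
    rw [← h1]
    ring
  obtain ⟨S, hS, hAQ⟩ := hAQ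
  have h01 : Fin.castSucc (0 : Fin 3) ≠ Fin.castSucc 1 := by simp
  obtain ⟨ν', hν'⟩ := exists_eq_X_mul (q := fun i => aeval Q (P i)) h01 fun i j =>
    mul_left_cancel₀ hS (by linear_combination X i.castSucc * hAQ j - X j.castSucc * hAQ i)
  obtain ⟨N₁, β₁, -, rfl, -⟩ := exists_eq_C_mul_pow_of_aeval h.hom_E hE
    (mul_ne_zero h.c_ne (pow_ne_zero D hβ)) (μ := ν') (N := D' * D) (by
      rw [← funext hν', ← comp_aeval, AlgHom.comp_apply, h.aeval_eq, map_mul, map_pow, hQg,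
        ← algebraMap_eq, AlgHom.commutes, algebraMap_eq, mul_pow, pow_mul, C_mul, C_pow, mul_assoc])
  obtain ⟨Q₂, hQ₂⟩ := h.exists_rename hdet hQ hcop hQg0 (ν := C β₁ * E ^ N₁) fun i => by
    rw [hν']; simp
  obtain rfl : Q = fun i => rename Fin.castSucc (Q₂ i) := funext hQ₂
  have hQg₂ : aeval Q₂ g = C β * E ^ D' := hinj <| by
    rw [← AlgHom.comp_apply, comp_aeval, hQg]; simp
  have hAP : ∃ S : PolyRing k 3, S ≠ 0 ∧
      ∀ j, S * rename Fin.castSucc (aeval P (Q₂ j)) = X j.castSucc * μ := by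
    refine ⟨C β' * (C c * rename Fin.castSucc g ^ d) ^ m' *
      (C b' * rename Fin.castSucc g ^ m) ^ D', mul_ne_zero (mul_ne_zero (hC hβ') (pow_ne_zero _
        (mul_ne_zero (hC hm.c_ne) (pow_ne_zero _ hg0)))) (pow_ne_zero _
        (mul_ne_zero (hC hb') (pow_ne_zero _ hg0))), fun j => ?_⟩
    have hQj : (Q₂ j).IsHomogeneous D' := (IsHomogeneous.rename_isHomogeneous_iff hcs).1 (hQ j)
    have h1 := hm.p_G j.castSucc
    have h2 := aeval_mul_const_of_isHomogeneous hQj (fun i => rename Fin.castSucc (P i))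
      (C b' * rename Fin.castSucc g ^ m : PolyRing k 3)
    rw [hGQ, map_mul, map_mul, map_pow, hm.p_f, bind₁_C_right, hbind, funext hp] at h1
    simp only [mul_comm _ (rename Fin.castSucc (P _))] at h1
    rw [h2, ← comp_aeval, AlgHom.comp_apply] at h1
    rw [← h1]
    ring
  obtain ⟨T, hT, hAP⟩ := hAP
  obtain ⟨μ', hμ'⟩ := exists_eq_X_mul (s := id) (q := fun i => aeval P (Q₂ i))
    (zero_ne_one (α := Fin 3)) fun i j => hinj <| mul_left_cancel₀ hT <| by
      simp only [id, map_mul, rename_X]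
      linear_combination X i.castSucc * hAP j - X j.castSucc * hAP i
  obtain ⟨N, γ, hγ, rfl, hN⟩ := exists_eq_C_mul_pow_of_aeval (s := id) h.hom_g
    (by simpa using h.irr) (mul_ne_zero hβ (pow_ne_zero D' h.c_ne)) (μ := μ') (N := D * D') (by
      rw [← funext hμ', ← comp_aeval, AlgHom.comp_apply, hQg₂, map_mul, map_pow, h.aeval_eq,
        ← algebraMap_eq, AlgHom.commutes, algebraMap_eq, mul_pow, pow_mul, C_mul, C_pow, mul_assoc,
        rename_id_apply])
  have : IsLocalHom (rename Fin.castSucc : PolyRing k 2 →ₐ[k] PolyRing k 3).toRingHom :=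
    ⟨isLocalHom_rename_castSucc.map_nonunit⟩
  refine ⟨Q₂, D', N, γ, hγ, fun j => (IsHomogeneous.rename_isHomogeneous_iff hcs).1 (hQ j),
    CoprimeFamily.of_map (rename Fin.castSucc : PolyRing k 2 →ₐ[k] PolyRing k 3).toRingHom hinj
      hcop, fun j => ?_, hN⟩
  simpa using hμ' j

end PlaneInverse

section DegreeOne

variable {k : Type} [Field k]

lemma originIdeal_height_le (m : ℕ) : (originIdeal k m).height ≤ m := by
  have h : originIdeal k m = Ideal.span (X '' Set.univ) := by
    ext p
    rw [mem_originIdeal, mem_ideal_span_X_image]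
    refine ⟨fun h d hd => ?_, fun h => ?_⟩
    · by_contra! h0
      obtain rfl : d = 0 := Finsupp.ext fun i => h0 i trivial
      exact mem_support_iff.1 hd h
    · by_contra h0
      obtain ⟨i, -, hi⟩ := h 0 (mem_support_iff.2 h0)
      exact hi rfl
  have h1 := Ideal.height_le_card_of_mem_minimalPrimes_span (p := originIdeal k m)
    (Set.finite_univ.image (X : Fin m → MvPolynomial (Fin m) k))
    (by rw [← h, Ideal.minimalPrimes_eq_subsingleton_self]; rfl)
  refine h1.trans ?_
  have h3 : ((X : Fin m → MvPolynomial (Fin m) k) '' Set.univ).ncard ≤ m :=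
    (Set.ncard_image_le Set.finite_univ).trans (by simp)
  exact_mod_cast h3

lemma eq_of_isPrime_lt_originIdeal {E F : PolyRing k 2} (hE : Irreducible E) (hEF : ¬ E ∣ F)
    {𝔮 𝔩 : Ideal (PolyRing k 2)} [𝔮.IsPrime] [𝔩.IsPrime] (hEq : E ∈ 𝔮) (hFq : F ∈ 𝔮) (hle : 𝔮 ≤ 𝔩)
    (hlt : 𝔩 < originIdeal k (2 + 1)) : 𝔮 = 𝔩 := by
  by_contra hne
  have := (Ideal.span_singleton_prime hE.ne_zero).2 hE.prime
  have h0 : (⊥ : Ideal (PolyRing k 2)) < Ideal.span {E} :=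
    bot_lt_iff_ne_bot.2 (by simpa using hE.ne_zero)
  have h1 : Ideal.span {E} < 𝔮 := lt_of_le_of_ne ((Ideal.span_singleton_le_iff_mem _).2 hEq)
    fun h => hEF (Ideal.mem_span_singleton.1 (h ▸ hFq))
  have h2 := Ideal.height_add_one_le_of_lt_of_isPrime h0
  have h3 := Ideal.height_add_one_le_of_lt_of_isPrime h1
  have h4 := Ideal.height_add_one_le_of_lt_of_isPrime (lt_of_le_of_ne hle hne)
  have h5 := Ideal.height_add_one_le_of_lt_of_isPrime hlt
  have h6 := originIdeal_height_le (k := k) (2 + 1)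
  have h7 : (4 : ℕ∞) ≤ (2 + 1 : ℕ) := by
    refine le_trans ?_ h6
    refine le_trans ?_ h5
    rw [show (4 : ℕ∞) = 3 + 1 by norm_num]
    gcongr
    refine le_trans ?_ h4
    rw [show (3 : ℕ∞) = 2 + 1 by norm_num]
    gcongr
    refine le_trans ?_ h3
    rw [show (2 : ℕ∞) = 1 + 1 by norm_num]
    gcongr
    exact le_trans (by simp) h2
  exact absurd h7 (by decide)

/-- A cubic map does not contract the curve `g` to a point. -/
lemma CubicMap.false_of_dvd [IsAlgClosed k] {E g : PolyRing k 2} {P : Fin 3 → PolyRing k 2}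
    {D : ℕ} {b : k} (h : CubicMap E g P D b) (hE : Irreducible E)
    (hdet : ∃ a a', det3 P (fun i => pderiv a (P i)) (fun i => pderiv a' (P i)) ≠ 0)
    {Q : Fin 3 → PolyRing k 2} (hQ : CoprimeFamily Q) (hdvd : ∀ j, g ∣ aeval P (Q j)) : False := by
  obtain ⟨a₀, a₁, hdet⟩ := hdet
  have hg := h.irr.prime
  have := (Ideal.span_singleton_prime hg.ne_zero).2 hg
  set φ := (Ideal.Quotient.mkₐ k (Ideal.span {g})).comp (aeval P)
  have hφ : ∀ F, F ∈ RingHom.ker φ ↔ g ∣ aeval P F := fun F => by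
    rw [RingHom.mem_ker, ← Ideal.mem_span_singleton, ← Ideal.Quotient.eq_zero_iff_mem]; rfl
  obtain ⟨i, hi⟩ := h.coprime g hg
  have hX : X i ∉ RingHom.ker φ := by rwa [hφ, aeval_X]
  have : (RingHom.ker φ).IsPrime := RingHom.ker_isPrime φ
  obtain ⟨a, ha, hai⟩ := exists_common_zero_notMem hX
  rw [aeval_X] at hai
  obtain ⟨j, hj⟩ := hQ E hE.prime
  let ψ : PolyRing k 2 →ₐ[k] Polynomial k := aeval fun i => Polynomial.C (a i) * Polynomial.X
  have : (RingHom.ker ψ).IsPrime := RingHom.ker_isPrime ψ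
  have hψ : ∀ F x, (ψ F).eval x = aeval (fun i => a i * x) F := fun F x => by
    have : ((Polynomial.aeval x).comp ψ : PolyRing k 2 →ₐ[k] k) = aeval fun i => a i * x := by
      ext1 i; simp [ψ]
    simpa [Polynomial.aeval_def] using DFunLike.congr_fun this F
  have hle : RingHom.ker φ ≤ RingHom.ker ψ := fun F hF => by
    rw [RingHom.mem_ker]
    refine Polynomial.funext fun x => ?_
    obtain ⟨s, rfl⟩ := IsAlgClosed.exists_pow_nat_eq x h.pos
    rw [hψ, Polynomial.eval_zero]
    have h1 : aeval (fun i => X i * C (s ^ D) : Fin 3 → PolyRing k 2) F ∈ RingHom.ker φ := by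
      rw [hφ] at hF ⊢
      have h1 : ∀ G : PolyRing k 2, ∀ {N}, G.IsHomogeneous N →
          aeval (fun l => X l * C s) G = G * C s ^ N := fun G N hG => by
        rw [aeval_mul_const_of_isHomogeneous hG, aeval_X_left, AlgHom.id_apply]
      have h2 := map_dvd (aeval fun l => (X l * C s : PolyRing k 2)) hF
      rw [h1 g h.hom_g, ← AlgHom.comp_apply, comp_aeval] at h2
      simp only [h1 _ (h.hom_P _)] at h2
      rw [← AlgHom.comp_apply, comp_aeval]
      refine (dvd_mul_right _ _).trans (h2.trans ?_)
      simp
    have h2 := ha _ h1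
    rw [← AlgHom.comp_apply, comp_aeval] at h2
    simpa using h2
  have hlt : RingHom.ker ψ < originIdeal k (2 + 1) := by
    refine lt_of_le_of_ne (fun F hF => ?_) fun h0 => ?_
    · rw [mem_originIdeal]
      rw [RingHom.mem_ker] at hF
      have := hψ F 0
      rw [hF] at this
      simpa [aeval_zero', eq_comm] using this
    · have h1 : (X i : PolyRing k 2) ∈ originIdeal k (2 + 1) := by simp
      rw [← h0, RingHom.mem_ker, aeval_X] at h1
      simp [hai] at h1
  have hEk : E ∈ RingHom.ker φ := by
    rw [hφ, h.aeval_eq]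
    exact dvd_mul_of_dvd_right (dvd_pow_self _ h.pos.ne') _
  have heq := eq_of_isPrime_lt_originIdeal hE hj hEk ((hφ _).2 (hdvd j)) hle hlt
  refine h.not_pow_dvd_det3 hdet (h.pow_dvd_det3_of_dvd (y := a) (fun h0 => hai (by simp [h0]))
    (fun i j => ?_) a₀ a₁)
  have h1 : C (a i) * X j - C (a j) * X i ∈ RingHom.ker φ := by
    rw [heq, RingHom.mem_ker]
    simp [ψ]
    ring
  rw [hφ] at h1
  simpa using h1

end DegreeOne

section LinearEquivalence

variable {k : Type} [Field k]

lemma ComplementMaps.symm {n : ℕ} {f g : PolyRing k n} {p G : Fin (n + 1) → PolyRing k n}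
    {d e : ℕ} {c c' : k} {μ ν : PolyRing k n} (h : ComplementMaps f g p G d e c c' μ ν) :
    ComplementMaps g f G p e d c' c ν μ :=
  ⟨h.hom_G, h.hom_p, h.c'_ne, h.c_ne, h.ν_ne, h.μ_ne, h.G_g, h.p_f, h.G_p, h.p_G⟩

lemma linearIndependent_of_det3_ne_zero {n : ℕ} {P : Fin 3 → MvPolynomial (Fin n) k}
    (h : ∃ a a', det3 P (fun i => pderiv a (P i)) (fun i => pderiv a' (P i)) ≠ 0) :
    LinearIndependent k P := by
  obtain ⟨a, a', h⟩ := h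
  refine Fintype.linearIndependent_iff.2 fun t ht i => ?_
  have h0 : ∑ j, C (t j) * P j = 0 := by simpa [smul_eq_C_mul] using ht
  have h1 : ∀ l, ∑ j, C (t j) * pderiv l (P j) = 0 := fun l => by
    simpa [Derivation.leibniz] using congrArg (pderiv l) h0
  have h2 := mul_det3 (fun j => C (t j)) P (fun i => pderiv a (P i)) (fun i => pderiv a' (P i)) i
  rw [h0, h1, h1] at h2
  simpa [h] using h2

lemma exists_linChange_snoc {P : Fin 3 → PolyRing k 2} (hP : ∀ i, (P i).IsHomogeneous 1)
    (hli : LinearIndependent k P) : ∃ ψ ψ' : Fin (3 + 1) → PolyRing k 3, LinChange ψ ψ' ∧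
      ∀ i : Fin 3, ψ i.castSucc = rename Fin.castSucc (P i) := by
  let ψ : Fin (3 + 1) → PolyRing k 3 :=
    Fin.snoc (fun i : Fin 3 => rename Fin.castSucc (P i)) (X (Fin.last 3))
  have hψ : ∀ i : Fin 3, ψ i.castSucc = rename Fin.castSucc (P i) := fun i => by simp [ψ]
  have hψl : ψ (Fin.last 3) = X (Fin.last 3) := by simp only [ψ, Fin.snoc_last]
  have hhom : ∀ i, (ψ i).IsHomogeneous 1 := fun i => by
    induction i using Fin.lastCases with
    | last => rw [hψl]; exact isHomogeneous_X k _
    | cast i => rw [hψ]; exact (hP i).rename_isHomogeneous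
  have hψli : LinearIndependent k ψ := by
    refine Fintype.linearIndependent_iff.2 fun t ht => ?_
    rw [Fin.sum_univ_castSucc] at ht
    simp only [hψ, hψl] at ht
    have h1 := congrArg (aeval (Fin.snoc X 0 : Fin (3 + 1) → PolyRing k 2)) ht
    have h2 : (Fin.snoc X 0 : Fin (3 + 1) → PolyRing k 2) ∘ Fin.castSucc = X := by
      funext i; simp
    have h3 : ∀ F : PolyRing k 2, aeval (Fin.snoc X 0 : Fin (3 + 1) → PolyRing k 2)
        (rename Fin.castSucc F) = F := fun F => by
      rw [aeval_rename, h2, aeval_X_left, AlgHom.id_apply]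
    simp only [map_add, map_sum, map_smul, h3, aeval_X, Fin.snoc_last, smul_zero, add_zero,
      map_zero] at h1
    have h4 := Fintype.linearIndependent_iff.1 hli _ h1
    simp only [h4, zero_smul, Finset.sum_const_zero, zero_add] at ht
    intro i
    induction i using Fin.lastCases with
    | last => exact (smul_eq_zero.1 ht).resolve_right (X_ne_zero _)
    | cast i => exact h4 i
  obtain ⟨ψ', h⟩ := exists_linChange hhom hψli
  exact ⟨ψ, ψ', h, hψ⟩

lemma ComplementMaps.exists_linChange_cone [IsAlgClosed k] {E : PolyRing k 2}
    (hE : E.IsHomogeneous 3) (hEs : IsSmoothForm E)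
    (hEi : Irreducible (rename Fin.castSucc E : PolyRing k 3)) {g : PolyRing k 3}
    (hg : Irreducible g) (hgd : g.IsHomogeneous 3) {p G : Fin (3 + 1) → PolyRing k 3} {d e : ℕ}
    {c c' : k} {μ ν : PolyRing k 3}
    (h : ComplementMaps (rename Fin.castSucc E) g p G d e c c' μ ν) :
    ∃ (θ θ' : Fin (3 + 1) → PolyRing k 3) (b : k), b ≠ 0 ∧ LinChange θ θ' ∧
      bind₁ θ (rename Fin.castSucc E) = C b * g := by
  obtain ⟨P, D, m, b, b', hb', hP, hcub, hdet⟩ := h.exists_cubicMap hE hEs hg hgd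
  obtain ⟨L, L', g₂, P₂, hL, hg₂, hP₂, hcub₂, hdet₂⟩ := hcub.exists_plane_form hdet
  have h' := h.comp_linChange hL
  rw [hg₂] at h'
  obtain ⟨Q, D', N, β, -, -, hcop, hPQ, hN⟩ := hcub₂.exists_inverse hdet₂ hEi h' hb' (m := m)
    fun i => by rw [hP, map_mul, map_mul, map_pow, hg₂, hP₂, bind₁_C_right]
  obtain rfl : N = 0 := by
    by_contra hN0
    have hloc := isLocalHom_rename_castSucc (k := k) (n := 3)
    exact hcub₂.false_of_dvd (hEi.of_map (f := rename Fin.castSucc)) hdet₂ hcop fun j => by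
      rw [hPQ]
      exact dvd_mul_of_dvd_right (dvd_mul_of_dvd_right (dvd_pow_self _ hN0) _) _
  obtain rfl : D = 1 := Nat.eq_one_of_mul_eq_one_right hN
  obtain ⟨ψ, ψ', hψ, hψP⟩ :=
    exists_linChange_snoc hcub₂.hom_P (linearIndependent_of_det3_ne_zero hdet₂)
  refine ⟨_, _, b, hcub₂.c_ne, hψ.trans hL.symm, ?_⟩
  have h1 : bind₁ ψ (rename Fin.castSucc E) = C b * bind₁ L g := by
    rw [hg₂, bind₁, aeval_rename, show ψ ∘ Fin.castSucc = fun i => rename Fin.castSucc (P₂ i) from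
      funext hψP, ← comp_aeval, AlgHom.comp_apply, hcub₂.aeval_eq]
    simp
  rw [← bind₁_bind₁, h1, map_mul, bind₁_C_right, hL.symm.bind_bind]

lemma ComplementMaps.exists_linChange [IsAlgClosed k] {f g : PolyRing k 3} (hf : Irreducible f)
    (hfd : f.IsHomogeneous 3) (hg : Irreducible g) (hgd : g.IsHomogeneous 3)
    (hrat : ¬ IsRationalForm f) {p G : Fin (3 + 1) → PolyRing k 3} {d e : ℕ}
    {c c' : k} {μ ν : PolyRing k 3} (h : ComplementMaps f g p G d e c c' μ ν) :
    ∃ (θ θ' : Fin (3 + 1) → PolyRing k 3) (b : k), b ≠ 0 ∧ LinChange θ θ' ∧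
      bind₁ θ f = C b * g := by
  obtain ⟨L, L', E, hL, hE, hEs, hfE⟩ :=
    (isRationalForm_or_exists_smooth_cone hf hfd).resolve_left hrat
  have h' := (h.symm.comp_linChange hL).symm
  rw [hfE] at h'
  obtain ⟨θ, θ', b, hb, hθ, hθE⟩ := h'.exists_linChange_cone hE hEs
    (hfE ▸ hL.irreducible hf) hg hgd
  exact ⟨_, _, b, hb, hL.trans hθ, by rw [← bind₁_bind₁, hfE, hθE]⟩

end LinearEquivalence

/-- Let `k` be algebraically closed and let `H = V(f)`, `H' = V(g)` be irreducible cubic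
hypersurfaces in `ℙ³_k` with isomorphic complements.  If `H` or `H'` is non-rational,
then there is an automorphism `φ` of `ℙ³_k` with `φ(H) = H'`. -/
theorem stmt2 (k : Type) [Field k] [IsAlgClosed k]
    (f g : MvPolynomial (Fin (3 + 1)) k)
    (hf : Irreducible f) (hfd : f.IsHomogeneous 3)
    (hg : Irreducible g) (hgd : g.IsHomogeneous 3)
    (H H' : Scheme) (ι : H ⟶ ProjSpace k 3) (ι' : H' ⟶ ProjSpace k 3)
    (hH : IsHypersurface f H ι) (hH' : IsHypersurface g H' ι')
    (hiso : IsoOver (PnFStruct k 3 f) (PnFStruct k 3 g))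
    (hnonrat : ¬ IsRationalSurface k (ι ≫ projStruct k 3) ∨
               ¬ IsRationalSurface k (ι' ≫ projStruct k 3)) :
    ∃ φ : ProjSpace k 3 ≅ ProjSpace k 3,
      φ.hom ≫ projStruct k 3 = projStruct k 3 ∧
      φ.hom.base '' zeroLocusSet k 3 f = zeroLocusSet k 3 g := by
  obtain ⟨p, G, d, e, c, c', μ, ν, h⟩ := exists_complementMaps (by norm_num) hf hfd hg hgd hiso
  rcases hnonrat with hn | hn
  · obtain ⟨θ, θ', b, hb, hθ, hfg⟩ := h.exists_linChange hf hfd hg hgd fun hr => hn (hr H ι hH)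
    refine ⟨linIso hθ.symm, linProj_projStruct hθ.symm, ?_⟩
    rw [← linIso_image_zeroLocusSet hθ.symm g, ← zeroLocusSet_C_mul hb (bind₁ θ' g),
      ← bind₁_C_right θ', ← map_mul, ← hfg, hθ.symm.bind_bind]
  · obtain ⟨θ, θ', b, hb, hθ, hfg⟩ :=
      h.symm.exists_linChange hg hgd hf hfd fun hr => hn (hr H' ι' hH')
    refine ⟨linIso hθ, linProj_projStruct hθ, ?_⟩
    rw [← linIso_image_zeroLocusSet hθ g, hfg, zeroLocusSet_C_mul hb]

end
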